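/- Fix integers c ≥ 2 and h ≥ 1, a positive real number α, and any ε > 0. Then f₃(T_{c,h,α}; n) ≲ n^E where E = c^h · (1 + 1/(c² − 1)) + (−1)^h/(2(c + 1)) + 1/(2(1 − c)) + ε; that is, there exist constants C and N such that for all n > N, every set of n points in ℝ³ contains at most C · n^E distance T_{c,h,α}-configurations. -/

import Mathlib

open scoped InnerProductSpace

noncomputable section

/-- Points in three-dimensional space. -/
abbrev Pt3 : Type := EuclideanSpace ℝ (Fin 3)

/-- The vertex set of the perfect `c`-ary rooted tree `T_{c,h}` of height `h`: a vertex is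
a list of child-selectors of length at most `h` (the root is the empty list, and the
leaves are the lists of length exactly `h`), so there are `c ^ h` leaves. -/
def TreeVert (c h : ℕ) : Type := {l : List (Fin c) // l.length ≤ h}

/-- Adjacency in the perfect `c`-ary tree `T_{c,h}`: a vertex is adjacent precisely to its
parent and to its children. -/
def treeAdj (c h : ℕ) (u v : TreeVert c h) : Prop :=
  (∃ i : Fin c, u.1 = i :: v.1) ∨ (∃ i : Fin c, v.1 = i :: u.1)

/-- The set of distance `T_{c,h,α}`-configurations in a point set `E ⊆ ℝ³`, where every
edge of `T_{c,h}` carries the same weight `α`. -/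
def distTreeConfigs3 (c h : ℕ) (α : ℝ) (E : Finset Pt3) : Set (TreeVert c h → Pt3) :=
  {φ | (∀ v, φ v ∈ E) ∧ Function.Injective φ ∧
    ∀ u v, treeAdj c h u v → ‖φ u - φ v‖ = α}

section

open MvPolynomial

theorem finrank_map_add_finrank_inf_ker {V W : Type*} [AddCommGroup V] [Module ℝ V]
    [AddCommGroup W] [Module ℝ W] (f : V →ₗ[ℝ] W) (S : Submodule ℝ V) [FiniteDimensional ℝ S] :
    Module.finrank ℝ (S.map f) + Module.finrank ℝ (S ⊓ LinearMap.ker f : Submodule ℝ V) =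
      Module.finrank ℝ S := by
  rw [← LinearMap.finrank_range_add_finrank_ker (f.domRestrict S), LinearMap.range_domRestrict,
    LinearMap.ker_domRestrict, ← Submodule.map_comap_subtype, Submodule.finrank_map_subtype_eq]

theorem finrank_map_of_injective {V W : Type*} [AddCommGroup V] [Module ℝ V]
    [AddCommGroup W] [Module ℝ W] (f : V →ₗ[ℝ] W) (hf : Function.Injective f)
    (S : Submodule ℝ V) :
    Module.finrank ℝ (S.map f) = Module.finrank ℝ S :=
  (LinearEquiv.finrank_eq (Submodule.equivMapOfInjective f hf S)).symm

theorem finrank_restrictTotalDegree (n E : ℕ) :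
    Module.finrank ℝ (restrictTotalDegree (Fin n) ℝ E) = (E + n).choose n := by
  classical
  have h1 : Module.finrank ℝ (restrictTotalDegree (Fin n) ℝ E) =
      Nat.card {s : Fin n →₀ ℕ | (s.sum fun _ e => e) ≤ E} :=
    Module.finrank_eq_nat_card_basis
      (basisRestrictSupport ℝ {s : Fin n →₀ ℕ | (s.sum fun _ e => e) ≤ E})
  have h2 : {s : Fin n →₀ ℕ | (s.sum fun _ e => e) ≤ E} =
      ((Finset.range (E + 1)).biUnion
        fun k => Finset.finsuppAntidiag (Finset.univ : Finset (Fin n)) k : Finset (Fin n →₀ ℕ)) := by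
    ext s
    simp [Finsupp.sum_fintype]
  rw [h1, h2, Nat.card_coe_set_eq, Set.ncard_coe_finset, Finset.card_biUnion]
  · simp only [Finset.card_finsuppAntidiag_nat_eq_multichoose, Finset.card_univ, Fintype.card_fin]
    exact Nat.sum_range_multichoose E n
  · intro i _ j _ hij
    refine Finset.disjoint_left.2 fun s hs hs' => ?_
    simp only [Finset.mem_finsuppAntidiag] at hs hs'
    exact hij (hs.1.symm.trans hs'.1)

/-- Simultaneous evaluation of a polynomial at the points of a finite set. -/
def evalOn {n : ℕ} (Y : Finset (Fin n → ℝ)) : MvPolynomial (Fin n) ℝ →ₗ[ℝ] (Y → ℝ) :=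
  LinearMap.pi fun y => (MvPolynomial.aeval (R := ℝ) (y : Fin n → ℝ)).toLinearMap

@[simp]
theorem evalOn_apply {n : ℕ} (Y : Finset (Fin n → ℝ)) (p : MvPolynomial (Fin n) ℝ) (y : Y) :
    evalOn Y p y = eval (y : Fin n → ℝ) p := by
  simp [evalOn, MvPolynomial.aeval_eq_eval]

/-- The affine Hilbert function of a finite set of points. -/
def hilb {n : ℕ} (Y : Finset (Fin n → ℝ)) (E : ℕ) : ℕ :=
  Module.finrank ℝ ((restrictTotalDegree (Fin n) ℝ E).map (evalOn Y))

theorem hilb_of_isRelPrime {n : ℕ} {p q : MvPolynomial (Fin n) ℝ} (hp : p ≠ 0) (hq : q ≠ 0)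
    (hpq : IsRelPrime p q) (Y : Finset (Fin n → ℝ)) (hYp : ∀ y ∈ Y, eval y p = 0)
    (hYq : ∀ y ∈ Y, eval y q = 0) {E : ℕ} (hE : p.totalDegree + q.totalDegree ≤ E) :
    hilb Y E + (E - p.totalDegree + n).choose n + (E - q.totalDegree + n).choose n ≤
      (E + n).choose n + (E - p.totalDegree - q.totalDegree + n).choose n := by
  have hVm : ∀ k r, r ∈ restrictTotalDegree (Fin n) ℝ k ↔ r.totalDegree ≤ k :=
    fun k r => mem_restrictTotalDegree _ _ _
  let A := (restrictTotalDegree (Fin n) ℝ (E - p.totalDegree)).map (LinearMap.mulLeft ℝ p)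
  let B := (restrictTotalDegree (Fin n) ℝ (E - q.totalDegree)).map (LinearMap.mulLeft ℝ q)
  have hA : Module.finrank ℝ A = (E - p.totalDegree + n).choose n := by
    rw [finrank_map_of_injective _ (fun x y h => mul_left_cancel₀ hp h),
      finrank_restrictTotalDegree]
  have hB : Module.finrank ℝ B = (E - q.totalDegree + n).choose n := by
    rw [finrank_map_of_injective _ (fun x y h => mul_left_cancel₀ hq h),
      finrank_restrictTotalDegree]
  have hAB : Module.finrank ℝ (A ⊓ B : Submodule ℝ _) ≤
      (E - p.totalDegree - q.totalDegree + n).choose n := by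
    have hAB' := finrank_map_of_injective
      (LinearMap.mulLeft ℝ (p * q)) (fun x y h => mul_left_cancel₀ (mul_ne_zero hp hq) h)
      (restrictTotalDegree (Fin n) ℝ (E - p.totalDegree - q.totalDegree))
    rw [← finrank_restrictTotalDegree, ← hAB']
    apply Submodule.finrank_mono
    rintro x ⟨⟨y, hy, rfl⟩, ⟨z, hz, hzy⟩⟩
    simp only [LinearMap.mulLeft_apply] at hzy ⊢
    have hdvd : p ∣ z := hpq.dvd_of_dvd_mul_left ⟨y, hzy⟩
    obtain ⟨w, rfl⟩ := hdvd
    have hyw : y = q * w := by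
      apply mul_left_cancel₀ hp
      rw [← hzy]; ring
    refine ⟨w, ?_, by simp [hyw]⟩
    rw [SetLike.mem_coe, hVm]
    by_cases hw : w = 0
    · simp [hw]
    · have := (hVm _ _).1 hz
      rw [totalDegree_mul_of_isDomain hp hw] at this
      omega
  have hsup : A ⊔ B ≤ restrictTotalDegree (Fin n) ℝ E ⊓ LinearMap.ker (evalOn Y) := by
    apply sup_le
    · rintro _ ⟨y, hy, rfl⟩
      refine ⟨(hVm _ _).2 ?_, ?_⟩
      · have := (hVm _ _).1 hy
        exact (totalDegree_mul _ _).trans (by omega)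
      · ext a
        simp [hYp a a.2]
    · rintro _ ⟨y, hy, rfl⟩
      refine ⟨(hVm _ _).2 ?_, ?_⟩
      · have := (hVm _ _).1 hy
        exact (totalDegree_mul _ _).trans (by omega)
      · ext a
        simp [hYq a a.2]
  have h1 := finrank_map_add_finrank_inf_ker (evalOn Y) (restrictTotalDegree (Fin n) ℝ E)
  have h2 := Submodule.finrank_sup_add_finrank_inf_eq A B
  have : FiniteDimensional ℝ (restrictTotalDegree (Fin n) ℝ E ⊓ LinearMap.ker (evalOn Y) : Submodule ℝ _) :=
    Submodule.finiteDimensional_of_le inf_le_left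
  have h3 := Submodule.finrank_mono hsup
  rw [finrank_restrictTotalDegree] at h1
  rw [hilb]
  omega

theorem card_le_hilb {n : ℕ} (Y : Finset (Fin n → ℝ)) {E : ℕ} (hE : Y.card ≤ E + 1) :
    Y.card ≤ hilb Y E := by
  classical
  suffices h : (restrictTotalDegree (Fin n) ℝ E).map (evalOn Y) = ⊤ by
    rw [hilb, h]; simp
  have hsep : ∀ y z : Fin n → ℝ, ∃ l : MvPolynomial (Fin n) ℝ, l.totalDegree ≤ 1 ∧
      eval z l = 0 ∧ (y ≠ z → eval y l ≠ 0) := by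
    intro y z
    by_cases h : y = z
    · exact ⟨0, by simp, by simp, fun h' => absurd h h'⟩
    · obtain ⟨i, hi⟩ := Function.ne_iff.1 h
      refine ⟨X i - C (z i), ?_, by simp, fun _ => by simpa [sub_eq_zero] using hi⟩
      exact (totalDegree_sub_C_le _ _).trans (by simp)
  choose l hl1 hl2 hl3 using hsep
  rw [eq_top_iff]
  intro v _
  have hv : v = ∑ y : Y, (v y) • (Pi.single y 1 : Y → ℝ) := by
    ext z
    simp [Finset.sum_apply, Pi.single_apply]
  rw [hv]
  refine Submodule.sum_mem _ fun y _ => Submodule.smul_mem _ _ ?_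
  set c : ℝ := ∏ z ∈ Y.erase y, eval (y : Fin n → ℝ) (l y z)
  have hc : c ≠ 0 := Finset.prod_ne_zero_iff.2 fun z hz =>
    hl3 _ _ (Finset.ne_of_mem_erase hz).symm
  refine ⟨c⁻¹ • ∏ z ∈ Y.erase y, l y z, Submodule.smul_mem _ _ ?_, ?_⟩
  · rw [mem_restrictTotalDegree]
    refine (totalDegree_finsetProd _ _).trans ((Finset.sum_le_sum fun z _ => hl1 y z).trans ?_)
    simp [Finset.card_erase_of_mem y.2]; omega
  · ext z
    rw [evalOn_apply, smul_eval, eval_prod, Pi.single_apply]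
    split_ifs with h
    · subst h; exact inv_mul_cancel₀ hc
    · rw [Finset.prod_eq_zero (i := (z : Fin n → ℝ)), mul_zero]
      · exact Finset.mem_erase.2 ⟨fun h' => h (Subtype.ext h'), z.2⟩
      · exact hl2 _ _

theorem hilb_mono {n : ℕ} {A B : Finset (Fin n → ℝ)} (h : A ⊆ B) (E : ℕ) :
    hilb A E ≤ hilb B E := by
  have : (restrictTotalDegree (Fin n) ℝ E).map (evalOn A) =
      ((restrictTotalDegree (Fin n) ℝ E).map (evalOn B)).map
        (LinearMap.funLeft ℝ ℝ fun a : A => (⟨a, h a.2⟩ : B)) := by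
    rw [← Submodule.map_comp]
    congr 1
  rw [hilb, this, hilb]
  exact Submodule.finrank_map_le _ _

theorem hilb_add_hilb_le {n : ℕ} {A B : Finset (Fin n → ℝ)} [DecidableEq (Fin n → ℝ)]
    {s : MvPolynomial (Fin n) ℝ}
    {k : ℕ} (hs : s.totalDegree ≤ k) (hA : ∀ a ∈ A, eval a s = 0) (hB : ∀ b ∈ B, eval b s ≠ 0)
    (E : ℕ) : hilb A (E + k) + hilb B E ≤ hilb (A ∪ B) (E + k) := by
  have hVm : ∀ k r, r ∈ restrictTotalDegree (Fin n) ℝ k ↔ r.totalDegree ≤ k :=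
    fun k r => mem_restrictTotalDegree _ _ _
  let rA : ((A ∪ B : Finset (Fin n → ℝ)) → ℝ) →ₗ[ℝ] (A → ℝ) :=
    LinearMap.funLeft ℝ ℝ fun a : A => ⟨a, Finset.mem_union_left _ a.2⟩
  let rB : ((A ∪ B : Finset (Fin n → ℝ)) → ℝ) →ₗ[ℝ] (B → ℝ) :=
    LinearMap.funLeft ℝ ℝ fun a : B => ⟨a, Finset.mem_union_right _ a.2⟩
  have h1 := finrank_map_add_finrank_inf_ker rA ((restrictTotalDegree (Fin n) ℝ (E + k)).map (evalOn (A ∪ B)))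
  have h2 : ((restrictTotalDegree (Fin n) ℝ (E + k)).map (evalOn (A ∪ B))).map rA = (restrictTotalDegree (Fin n) ℝ (E + k)).map (evalOn A) := by
    rw [← Submodule.map_comp]
    congr 1
  let m : (B → ℝ) →ₗ[ℝ] (B → ℝ) := LinearMap.pi fun b =>
    (eval (b : Fin n → ℝ) s) • LinearMap.proj b
  have hm : Function.Injective m := by
    intro x y hxy
    ext b
    have := congrFun hxy b
    simpa [m, hB b b.2] using this
  have h3 : ((restrictTotalDegree (Fin n) ℝ E).map (evalOn B)).map m ≤
      ((restrictTotalDegree (Fin n) ℝ (E + k)).map (evalOn (A ∪ B)) ⊓ LinearMap.ker rA).map rB := by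
    rintro _ ⟨_, ⟨p, hp, rfl⟩, rfl⟩
    refine ⟨evalOn (A ∪ B) (s * p), ⟨⟨s * p, (hVm _ _).2 ?_, rfl⟩, ?_⟩, ?_⟩
    · have := (hVm _ _).1 hp
      exact (totalDegree_mul _ _).trans (by omega)
    · rw [SetLike.mem_coe, LinearMap.mem_ker]
      ext a
      simp [rA, LinearMap.funLeft, hA a a.2]
    · ext b
      simp [rB, m, LinearMap.funLeft]
  have h4 := (Submodule.finrank_mono h3).trans (Submodule.finrank_map_le _ _)
  rw [finrank_map_of_injective m hm] at h4
  rw [h2] at h1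
  simp only [hilb]
  omega

theorem card_common_zeros_le {p q : MvPolynomial (Fin 2) ℝ} (hp : p ≠ 0) (hq : q ≠ 0)
    (hpq : IsRelPrime p q) (Y : Finset (Fin 2 → ℝ)) (hYp : ∀ y ∈ Y, eval y p = 0)
    (hYq : ∀ y ∈ Y, eval y q = 0) : Y.card ≤ p.totalDegree * q.totalDegree := by
  set a := p.totalDegree with ha
  set b := q.totalDegree with hb
  have h1 := hilb_of_isRelPrime hp hq hpq Y hYp hYq (E := a + b + Y.card) (by omega)
  have h2 := card_le_hilb Y (E := a + b + Y.card) (by omega)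
  have e1 : a + b + Y.card - a = b + Y.card := by omega
  have e2 : a + b + Y.card - b = a + Y.card := by omega
  have e3 : b + Y.card - b = Y.card := by omega
  have hc : ∀ k : ℕ, 2 * (k + 2).choose 2 = (k + 2) * (k + 1) := by
    intro k
    rw [Nat.choose_two_right, Nat.mul_div_cancel' (Nat.even_mul_pred_self _).two_dvd]
    simp
  rw [← ha, ← hb, e1, e2, e3] at h1
  have := hc (a + b + Y.card)
  have := hc (b + Y.card)
  have := hc (a + Y.card)
  have := hc (Y.card)
  nlinarith

theorem finite_setOf_not_isRelPrime {σ : Type*} {p w : MvPolynomial σ ℝ} (hp : p ≠ 0)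
    (hpw : IsRelPrime p w) (q : MvPolynomial σ ℝ) :
    {β : ℝ | ¬IsRelPrime p (q - C β * w)}.Finite := by
  classical
  have hsub : {β : ℝ | ¬IsRelPrime p (q - C β * w)} ⊆
      ⋃ r ∈ (UniqueFactorizationMonoid.factors p).toFinset, {β : ℝ | r ∣ q - C β * w} := by
    intro β hβ
    simp only [Set.mem_ofPred_eq, IsRelPrime, not_forall] at hβ
    obtain ⟨d, hdp, hdq, hd⟩ := hβ
    obtain ⟨r, hr, hrd⟩ := WfDvdMonoid.exists_irreducible_factor hd (ne_zero_of_dvd_ne_zero hp hdp)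
    obtain ⟨s, hs, hrs⟩ :=
      UniqueFactorizationMonoid.exists_mem_factors_of_dvd hp hr (hrd.trans hdp)
    simp only [Set.mem_iUnion]
    exact ⟨s, Multiset.mem_toFinset.2 hs, hrs.symm.dvd.trans (hrd.trans hdq)⟩
  refine Set.Finite.subset (Set.Finite.biUnion (Finset.finite_toSet _) fun r hr => ?_) hsub
  apply Set.Subsingleton.finite
  intro β hβ γ hγ
  by_contra hne
  have hrirr := UniqueFactorizationMonoid.irreducible_of_factor r (Multiset.mem_toFinset.1 hr)
  refine hrirr.not_isUnit
    (hpw (UniqueFactorizationMonoid.dvd_of_mem_factors (Multiset.mem_toFinset.1 hr)) ?_)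
  have h1 : r ∣ C (γ - β) * w := by
    have hβ' : r ∣ q - C β * w := hβ
    have hγ' : r ∣ q - C γ * w := hγ
    convert dvd_sub hβ' hγ' using 1
    simp only [map_sub]; ring
  have h2 : IsUnit (C (γ - β) : MvPolynomial σ ℝ) :=
    (isUnit_iff_ne_zero.2 (sub_ne_zero.2 (Ne.symm hne))).map C
  exact (h2.dvd_mul_left).1 h1

theorem hasStrictFDerivAt_eval {n : ℕ} (p : MvPolynomial (Fin n) ℝ) (x : Fin n → ℝ) :
    HasStrictFDerivAt (fun y : Fin n → ℝ => eval y p)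
      (∑ i, (eval x (pderiv i p)) • (ContinuousLinearMap.proj i : (Fin n → ℝ) →L[ℝ] ℝ)) x := by
  induction p using MvPolynomial.induction_on with
  | C a => simpa using hasStrictFDerivAt_const a x
  | add p q hp hq =>
    simp only [map_add, add_smul, Finset.sum_add_distrib]
    exact hp.add hq
  | mul_X p j hp =>
    have hj : HasStrictFDerivAt (fun y : Fin n → ℝ => y j)
      (ContinuousLinearMap.proj j : (Fin n → ℝ) →L[ℝ] ℝ) x := hasStrictFDerivAt_apply j x
    simp only [map_mul, eval_X]
    refine (hp.mul hj).congr_fderiv ?_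
    ext v
    simp [pderiv_X, Pi.single_apply, mul_add, Finset.sum_add_distrib, Finset.mul_sum,
      apply_ite, mul_comm, mul_left_comm]

/-- The product of the polynomials in `G` with a polynomial vanishing on a sphere of radius `R`. -/
def barrier {n : ℕ} (G : List (MvPolynomial (Fin n) ℝ)) (R : ℝ) : MvPolynomial (Fin n) ℝ :=
  (C (R ^ 2) - ∑ i, X i ^ 2) * G.prod

/-- The open sign cell of `y`. -/
def signCell {n : ℕ} (G : List (MvPolynomial (Fin n) ℝ)) (R : ℝ) (y : Fin n → ℝ) :
    Set (Fin n → ℝ) :=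
  {x | ∑ i, x i ^ 2 < R ^ 2 ∧ ∀ g ∈ G, 0 < eval y g * eval x g}

theorem isOpen_signCell {n : ℕ} (G : List (MvPolynomial (Fin n) ℝ)) (R : ℝ) (y : Fin n → ℝ) :
    IsOpen (signCell G R y) := by
  classical
  have : signCell G R y = {x | ∑ i, x i ^ 2 < R ^ 2} ∩
      ⋂ g ∈ G.toFinset, {x | 0 < eval y g * eval x g} := by
    ext x; simp [signCell]
  rw [this]
  refine IsOpen.inter (isOpen_lt (by fun_prop) continuous_const) ?_
  exact isOpen_biInter_finset fun g _ =>
    isOpen_lt continuous_const (continuous_const.mul (MvPolynomial.continuous_eval g))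

theorem list_prod_mul_pos {n : ℕ} (G : List (MvPolynomial (Fin n) ℝ)) {x y : Fin n → ℝ}
    (h : ∀ g ∈ G, 0 < eval y g * eval x g) : 0 < eval y G.prod * eval x G.prod := by
  induction G with
  | nil => simp
  | cons g G ih =>
    simp only [List.mem_cons, forall_eq_or_imp] at h
    have := mul_pos h.1 (ih h.2)
    simp only [List.prod_cons, map_mul]
    linarith

theorem exists_isLocalMaxOn_signCell {n : ℕ} (G : List (MvPolynomial (Fin n) ℝ)) (R : ℝ)
    {Z : Set (Fin n → ℝ)} (hZ : IsClosed Z) {y₀ y : Fin n → ℝ} (hyZ : y ∈ Z)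
    (hy : y ∈ signCell G R y₀) {L : (Fin n → ℝ) → ℝ} (hL : Continuous L)
    (hLF : ∀ x, ∑ i, x i ^ 2 ≤ R ^ 2 → 2 * |L x| < |eval y (barrier G R)|) :
    ∃ x ∈ Z ∩ signCell G R y₀,
      IsLocalMaxOn (fun z => eval y₀ G.prod * (eval z (barrier G R) - L z)) Z x := by
  classical
  set K : Set (Fin n → ℝ) := Z ∩ ({x | ∑ i, x i ^ 2 ≤ R ^ 2} ∩
      ⋂ g ∈ G.toFinset, {x | 0 ≤ eval y₀ g * eval x g}) with hK
  have hKmem : ∀ x, x ∈ K ↔ x ∈ Z ∧ ∑ i, x i ^ 2 ≤ R ^ 2 ∧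
      ∀ g ∈ G, 0 ≤ eval y₀ g * eval x g := by
    intro x; simp [hK]
  have hKclosed : IsClosed K := by
    refine hZ.inter ((isClosed_le (by fun_prop) continuous_const).inter ?_)
    exact isClosed_biInter fun g _ =>
      isClosed_le continuous_const (continuous_const.mul (MvPolynomial.continuous_eval g))
  have hKb : K ⊆ Metric.closedBall 0 |R| := by
    intro x hx
    rw [mem_closedBall_zero_iff, pi_norm_le_iff_of_nonneg (abs_nonneg _)]
    intro i
    rw [Real.norm_eq_abs, ← sq_le_sq]
    exact (Finset.single_le_sum (f := fun i => x i ^ 2) (fun i _ => sq_nonneg _)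
      (Finset.mem_univ i)).trans ((hKmem x).1 hx).2.1
  have hKc : IsCompact K := (isCompact_closedBall 0 |R|).of_isClosed_subset hKclosed hKb
  have hsub : ∀ z ∈ Z, z ∈ signCell G R y₀ → z ∈ K := fun z hz hz' =>
    (hKmem z).2 ⟨hz, hz'.1.le, fun g hg => (hz'.2 g hg).le⟩
  have hΦ : Continuous fun z => eval y₀ G.prod * (eval z (barrier G R) - L z) :=
    continuous_const.mul ((MvPolynomial.continuous_eval _).sub hL)
  obtain ⟨x, hxK, hx⟩ := hKc.exists_isMaxOn ⟨y, hsub y hyZ hy⟩ hΦ.continuousOn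
  have hxK' := (hKmem x).1 hxK
  have hev : ∀ z, eval z (barrier G R) = (R ^ 2 - ∑ i, z i ^ 2) * eval z G.prod := by
    intro z; simp [barrier]
  have hcell : x ∈ signCell G R y₀ := by
    by_contra hcon
    have hF : eval x (barrier G R) = 0 := by
      rw [hev]
      by_contra hne
      have h1 : R ^ 2 - ∑ i, x i ^ 2 ≠ 0 := left_ne_zero_of_mul hne
      have h2 := right_ne_zero_of_mul hne
      refine hcon ⟨lt_of_le_of_ne hxK'.2.1 fun h => h1 (by rw [h]; ring), fun g hg => ?_⟩
      refine lt_of_le_of_ne (hxK'.2.2 g hg) (Ne.symm (mul_ne_zero ?_ ?_))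
      · exact left_ne_zero_of_mul (hy.2 g hg).ne'
      · intro h0
        apply h2
        rw [map_list_prod]
        exact List.prod_eq_zero (List.mem_map.2 ⟨g, hg, h0⟩)
    have h1 : eval y₀ G.prod * (eval y (barrier G R) - L y) ≤
      eval y₀ G.prod * (eval x (barrier G R) - L x) := hx (hsub y hyZ hy)
    have h2 : 0 < eval y₀ G.prod * eval y (barrier G R) := by
      have := mul_pos (sub_pos.2 hy.1) (list_prod_mul_pos G hy.2)
      rw [hev]; linarith
    have h3 : eval y₀ G.prod * eval y (barrier G R) =
        |eval y₀ G.prod| * |eval y (barrier G R)| := by rw [← abs_mul, abs_of_pos h2]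
    have h4 : 0 < |eval y₀ G.prod| := abs_pos.2 (left_ne_zero_of_mul h2.ne')
    have h5 : eval y₀ G.prod * L y ≤ |eval y₀ G.prod| * |L y| := by
      rw [← abs_mul]; exact le_abs_self _
    have h6 : -(eval y₀ G.prod * L x) ≤ |eval y₀ G.prod| * |L x| := by
      rw [← abs_mul]; exact neg_le_abs _
    have h7 := mul_lt_mul_of_pos_left (hLF x hxK'.2.1) h4
    have h8 := mul_lt_mul_of_pos_left (hLF y hy.1.le) h4
    rw [hF] at h1
    linarith
  refine ⟨x, ⟨hxK'.1, hcell⟩, ?_⟩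
  have : ∀ᶠ z in nhdsWithin x Z, z ∈ Z ∧ z ∈ signCell G R y₀ :=
    (eventually_mem_nhdsWithin).and
      (mem_nhdsWithin_of_mem_nhds ((isOpen_signCell G R y₀).mem_nhds hcell))
  filter_upwards [this] with z hz
  exact hx (hsub z hz.1 hz.2)

theorem totalDegree_pderiv_le {n : ℕ} (i : Fin n) (p : MvPolynomial (Fin n) ℝ) :
    (pderiv i p).totalDegree ≤ p.totalDegree := by
  classical
  conv_lhs => rw [p.as_sum, map_sum]
  refine totalDegree_finsetSum_le fun s hs => ?_
  rw [pderiv_monomial]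
  have hle : s - Finsupp.single i 1 ≤ s := tsub_le_self
  refine (totalDegree_monomial_le _ _).trans ((Finsupp.sum_le_sum_index hle
    (fun _ _ _ _ h => h) (fun _ _ => rfl)).trans ?_)
  exact le_totalDegree hs

theorem totalDegree_barrier_le {n : ℕ} (G : List (MvPolynomial (Fin n) ℝ)) (R : ℝ) {D : ℕ}
    (hG : (G.map totalDegree).sum ≤ D) : (barrier G R).totalDegree ≤ D + 2 := by
  have h1 : (C (R ^ 2) - ∑ i, X i ^ 2 : MvPolynomial (Fin n) ℝ).totalDegree ≤ 2 := by
    refine (totalDegree_sub _ _).trans (max_le (by rw [totalDegree_C]; exact Nat.zero_le _) ?_)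
    exact totalDegree_finsetSum_le fun i _ => (totalDegree_pow _ _).trans (by simp)
  have h2 := totalDegree_list_prod G
  have h3 := totalDegree_mul (C (R ^ 2) - ∑ i, X i ^ 2 : MvPolynomial (Fin n) ℝ) G.prod
  unfold barrier
  omega

theorem exists_pos_le_of_finset {X : Type*} (Y : Finset X) (f : X → ℝ) (hf : ∀ y ∈ Y, 0 < f y) :
    ∃ μ > 0, ∀ y ∈ Y, μ ≤ f y := by
  rcases Y.eq_empty_or_nonempty with rfl | h
  · exact ⟨1, one_pos, by simp⟩
  · obtain ⟨y, hy, hy'⟩ := Y.exists_min_image f h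
    exact ⟨f y, hf y hy, hy'⟩

theorem exists_Ioo_notMem_of_finite {s : Set ℝ} (hs : s.Finite) {δ : ℝ} (hδ : 0 < δ) :
    ∃ x ∈ Set.Ioo 0 δ, x ∉ s := by
  obtain ⟨x, hx⟩ := ((Set.Ioo_infinite hδ).sdiff hs).nonempty
  exact ⟨x, hx.1, hx.2⟩

theorem exists_mem_signCell {n : ℕ} {G : List (MvPolynomial (Fin n) ℝ)} {Y : Finset (Fin n → ℝ)}
    (hY0 : ∀ y ∈ Y, ∀ g ∈ G, eval y g ≠ 0) : ∃ R : ℝ, 0 < R ∧ ∀ y ∈ Y, y ∈ signCell G R y := by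
  refine ⟨1 + ∑ y ∈ Y, ∑ i, y i ^ 2, by positivity, fun y hy => ⟨?_, fun g hg =>
    mul_self_pos.2 (hY0 y hy g hg)⟩⟩
  have h1 : ∑ i, y i ^ 2 ≤ ∑ y ∈ Y, ∑ i, y i ^ 2 :=
    Finset.single_le_sum (f := fun y : Fin n → ℝ => ∑ i, y i ^ 2)
      (fun y _ => by positivity) hy
  have h2 : 0 ≤ ∑ i, y i ^ 2 := by positivity
  nlinarith

theorem eval_barrier_ne_zero {n : ℕ} {G : List (MvPolynomial (Fin n) ℝ)} {R : ℝ}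
    {x y : Fin n → ℝ} (hx : x ∈ signCell G R y) : eval x (barrier G R) ≠ 0 := by
  have h1 := list_prod_mul_pos G hx.2
  have h2 := sub_pos.2 hx.1
  have : eval x (barrier G R) = (R ^ 2 - ∑ i, x i ^ 2) * eval x G.prod := by simp [barrier]
  rw [this]
  exact mul_ne_zero h2.ne' (right_ne_zero_of_mul h1.ne')

theorem card_le_of_disjoint_signCells {n : ℕ} {G : List (MvPolynomial (Fin n) ℝ)} {R : ℝ}
    {Y : Finset (Fin n → ℝ)} {N : ℕ}
    (hY : ∀ y ∈ Y, ∀ y' ∈ Y, y ≠ y' → ∃ g ∈ G, eval y g * eval y' g < 0)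
    (T : Set (Fin n → ℝ)) (hT : ∀ Z : Finset (Fin n → ℝ), (Z : Set (Fin n → ℝ)) ⊆ T → Z.card ≤ N)
    (h : ∀ y ∈ Y, ∃ x ∈ signCell G R y, x ∈ T) : Y.card ≤ N := by
  classical
  choose! φ hφ hφT using h
  have hinj : Set.InjOn φ Y := by
    intro y hy y' hy' he
    by_contra hne
    obtain ⟨g, hg, hlt⟩ := hY y hy y' hy' hne
    have h1 := (hφ y hy).2 g hg
    have h2 := (hφ y' hy').2 g hg
    rw [← he] at h2
    have := mul_pos h1 h2
    nlinarith [sq_nonneg (eval (φ y) g)]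
  rw [← Finset.card_image_of_injOn hinj]
  apply hT
  intro x hx
  obtain ⟨y, hy, rfl⟩ := Finset.mem_image.1 hx
  exact hφT y hy

theorem abs_le_of_sum_sq_le {n : ℕ} {x : Fin n → ℝ} {R : ℝ} (hR : 0 < R)
    (h : ∑ i, x i ^ 2 ≤ R ^ 2) (i : Fin n) : |x i| ≤ R := by
  rw [← abs_of_pos hR, ← sq_le_sq]
  exact (Finset.single_le_sum (f := fun i => x i ^ 2) (fun i _ => sq_nonneg _)
      (Finset.mem_univ i)).trans h

/-- A finite set of points in the plane realising distinct strict sign vectors of polynomials of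
total degree `D` has at most `(D + 2) ^ 2` elements. -/
theorem card_le_of_signs_plane {G : List (MvPolynomial (Fin 2) ℝ)} {D : ℕ}
    (hG : (G.map totalDegree).sum ≤ D) {Y : Finset (Fin 2 → ℝ)}
    (hY0 : ∀ y ∈ Y, ∀ g ∈ G, eval y g ≠ 0)
    (hY : ∀ y ∈ Y, ∀ y' ∈ Y, y ≠ y' → ∃ g ∈ G, eval y g * eval y' g < 0) :
    Y.card ≤ (D + 2) * (D + 2) := by
  classical
  obtain ⟨R, hR, hYR⟩ := exists_mem_signCell hY0
  set F := barrier G R with hF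
  have hFd : F.totalDegree ≤ D + 2 := totalDegree_barrier_le G R hG
  obtain ⟨μ, hμ, hμY⟩ := exists_pos_le_of_finset Y (fun y => |eval y F|)
    fun y hy => abs_pos.2 (eval_barrier_ne_zero (hYR y hy))
  have hδ : 0 < μ / (8 * R) := by positivity
  have hc : ∀ q : MvPolynomial (Fin 2) ℝ, {a : ℝ | q - C a = 0}.Finite := by
    intro q
    apply Set.Subsingleton.finite
    intro a ha b hb
    have ha' : q - C a = 0 := ha
    have hb' : q - C b = 0 := hb
    exact C_injective _ _ ((sub_eq_zero.1 ha').symm.trans (sub_eq_zero.1 hb'))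
  obtain ⟨a, ⟨ha0, had⟩, ha⟩ := exists_Ioo_notMem_of_finite (hc (pderiv 0 F)) hδ
  have ha : pderiv 0 F - C a ≠ 0 := ha
  obtain ⟨b, ⟨hb0, hbd⟩, hb⟩ := exists_Ioo_notMem_of_finite ((hc (pderiv 1 F)).union
    (finite_setOf_not_isRelPrime ha (isRelPrime_one_right) (pderiv 1 F))) hδ
  have hb1 : pderiv 1 F - C b ≠ 0 := fun h => hb (Or.inl h)
  have hb2 : IsRelPrime (pderiv 0 F - C a) (pderiv 1 F - C b) := by
    by_contra h
    exact hb (Or.inr (by simpa using h))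
  refine card_le_of_disjoint_signCells (R := R) hY
    {x | eval x (pderiv 0 F - C a) = 0 ∧ eval x (pderiv 1 F - C b) = 0} ?_ ?_
  · intro Z hZ
    refine (card_common_zeros_le ha hb1 hb2 Z (fun z hz => (hZ hz).1) fun z hz => (hZ hz).2).trans
      (Nat.mul_le_mul ?_ ?_)
    · exact (totalDegree_sub_C_le _ _).trans ((totalDegree_pderiv_le _ _).trans hFd)
    · exact (totalDegree_sub_C_le _ _).trans ((totalDegree_pderiv_le _ _).trans hFd)
  · intro y hy
    have hbound : ∀ x : Fin 2 → ℝ, ∑ i, x i ^ 2 ≤ R ^ 2 →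
        2 * |a * x 0 + b * x 1| < |eval y (barrier G R)| := by
      intro x hx
      have h0 := abs_le_of_sum_sq_le hR hx 0
      have h1 := abs_le_of_sum_sq_le hR hx 1
      have h2 := hμY y hy
      have h3 : |a * x 0 + b * x 1| ≤ a * |x 0| + b * |x 1| := by
        refine (abs_add_le _ _).trans ?_
        rw [abs_mul, abs_mul, abs_of_pos ha0, abs_of_pos hb0]
      have h4 : a * |x 0| ≤ μ / (8 * R) * R := mul_le_mul had.le h0 (abs_nonneg _) hδ.le
      have h5 : b * |x 1| ≤ μ / (8 * R) * R := mul_le_mul hbd.le h1 (abs_nonneg _) hδ.le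
      have h6 : μ / (8 * R) * R = μ / 8 := by field_simp
      simp only [hF] at h2
      linarith
    obtain ⟨x, ⟨_, hxc⟩, hx⟩ := exists_isLocalMaxOn_signCell G R isClosed_univ (Set.mem_univ y)
      (hYR y hy) (L := fun x => a * x 0 + b * x 1) (by fun_prop) hbound
    refine ⟨x, hxc, ?_⟩
    rw [isLocalMaxOn_univ_iff] at hx
    have hne : eval y G.prod ≠ 0 := by
      have := list_prod_mul_pos G (hYR y hy).2
      exact left_ne_zero_of_mul this.ne'
    have hd := (hasStrictFDerivAt_eval (C (eval y G.prod) * (F - (C a * X 0 + C b * X 1))) x)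
    have h0 := IsLocalMax.hasFDerivAt_eq_zero (by simpa using hx) hd.hasFDerivAt
    constructor
    · have := congrArg (fun l : (Fin 2 → ℝ) →L[ℝ] ℝ => l (Pi.single 0 1)) h0
      simpa [pderiv_mul, pderiv_X, Pi.single_apply, hne] using this
    · have := congrArg (fun l : (Fin 2 → ℝ) →L[ℝ] ℝ => l (Pi.single 1 1)) h0
      simpa [pderiv_mul, pderiv_X, Pi.single_apply, hne] using this

theorem eq_C_of_pderiv_eq_zero {n : ℕ} {p : MvPolynomial (Fin n) ℝ} (h : ∀ i, pderiv i p = 0)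
    (y : Fin n → ℝ) : p = C (eval y p) := by
  apply MvPolynomial.funext
  intro x
  rw [eval_C]
  refine is_const_of_fderiv_eq_zero (𝕜 := ℝ) (f := fun z : Fin n → ℝ => eval z p)
    (fun z => (hasStrictFDerivAt_eval p z).hasFDerivAt.differentiableAt) (fun z => ?_) x y
  rw [(hasStrictFDerivAt_eval p z).hasFDerivAt.fderiv]
  simp [h]

theorem exists_eval_ne_zero_of_isOpen {n : ℕ} {p : MvPolynomial (Fin n) ℝ} (hp : p ≠ 0)
    (y : Fin n → ℝ) {δ : ℝ} (hδ : 0 < δ) : ∃ z ∈ Metric.ball y δ, eval z p ≠ 0 := by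
  by_contra! h
  apply hp
  apply MvPolynomial.funext_set (fun i => Metric.ball (y i) δ)
  · intro i
    rw [Real.ball_eq_Ioo]
    exact Set.Ioo_infinite (by linarith)
  · intro x hx
    rw [h x, map_zero]
    rw [ball_pi y hδ]
    exact hx

theorem exists_eval_eq_of_isOpen {n : ℕ} {k : MvPolynomial (Fin n) ℝ} (hk : k ≠ 0)
    (hk0 : ∀ x, 0 ≤ eval x k) {U : Set (Fin n → ℝ)} (hU : IsOpen U) {y : Fin n → ℝ} (hy : y ∈ U)
    (hky : eval y k = 0) : ∃ κ > 0, ∀ η ∈ Set.Ioo 0 κ, ∃ x ∈ U, eval x k = η := by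
  obtain ⟨δ, hδ, hball⟩ := Metric.isOpen_iff.1 hU y hy
  obtain ⟨z, hz, hzk⟩ := exists_eval_ne_zero_of_isOpen hk y hδ
  refine ⟨eval z k, lt_of_le_of_ne (hk0 z) (Ne.symm hzk), fun η hη => ?_⟩
  have := (convex_ball y δ).isPreconnected.intermediate_value (Metric.mem_ball_self hδ) hz
    (MvPolynomial.continuous_eval k).continuousOn
  rw [hky] at this
  obtain ⟨x, hx, hxη⟩ := this ⟨hη.1.le, hη.2.le⟩
  exact ⟨x, hball hx, hxη⟩

/-- A finite set of points on a plane algebraic curve of degree at most `d` realising distinct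
strict sign vectors of polynomials of total degree `D` has at most `2 d (2 d + D + 2)` elements. -/
theorem card_le_of_signs_curve {G : List (MvPolynomial (Fin 2) ℝ)} {D d : ℕ}
    (hG : (G.map totalDegree).sum ≤ D) {g : MvPolynomial (Fin 2) ℝ} (hg : g ≠ 0)
    (hgd : g.totalDegree ≤ d) {Y : Finset (Fin 2 → ℝ)} (hYg : ∀ y ∈ Y, eval y g = 0)
    (hY0 : ∀ y ∈ Y, ∀ g ∈ G, eval y g ≠ 0)
    (hY : ∀ y ∈ Y, ∀ y' ∈ Y, y ≠ y' → ∃ g ∈ G, eval y g * eval y' g < 0) :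
    Y.card ≤ (2 * d) * (2 * d + (D + 2)) := by
  classical
  rcases Y.eq_empty_or_nonempty with rfl | ⟨y₀, hy₀⟩
  · simp
  obtain ⟨R, hR, hYR⟩ := exists_mem_signCell hY0
  set F := barrier G R with hF
  have hFd : F.totalDegree ≤ D + 2 := totalDegree_barrier_le G R hG
  set k := g ^ 2 with hk
  have hk0 : k ≠ 0 := pow_ne_zero 2 hg
  have hkd : k.totalDegree ≤ 2 * d := (totalDegree_pow _ _).trans (by omega)
  have hknn : ∀ x, 0 ≤ eval x k := fun x => by rw [hk, map_pow]; positivity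
  have hkY : ∀ y ∈ Y, eval y k = 0 := fun y hy => by rw [hk, map_pow, hYg y hy]; simp
  obtain ⟨i, hi⟩ : ∃ i, pderiv i k ≠ 0 := by
    by_contra! h
    apply hk0
    rw [eq_C_of_pderiv_eq_zero h y₀, hkY y₀ hy₀, C_0]
  obtain ⟨j, hij⟩ : ∃ j : Fin 2, i ≠ j := ⟨i + 1, by fin_cases i <;> simp⟩
  have hκ : ∀ y ∈ Y, ∃ κ > 0, ∀ η ∈ Set.Ioo 0 κ, ∃ x ∈ signCell G R y, eval x k = η :=
    fun y hy => exists_eval_eq_of_isOpen hk0 hknn (isOpen_signCell G R y) (hYR y hy) (hkY y hy)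
  choose! κ hκ0 hκ using hκ
  obtain ⟨κ₀, hκ₀, hκ₀Y⟩ := exists_pos_le_of_finset Y κ hκ0
  obtain ⟨η, ⟨hη0, hηκ⟩, hη⟩ := exists_Ioo_notMem_of_finite
    (finite_setOf_not_isRelPrime hi (isRelPrime_one_right) k) hκ₀
  have hη : IsRelPrime (k - C η) (pderiv i k) := by
    by_contra h
    exact hη (by simpa using fun h' => h (IsRelPrime.symm h'))
  have hkη : k - C η ≠ 0 := by
    intro h
    have := congrArg (eval y₀) h
    rw [map_sub, hkY y₀ hy₀, eval_C, map_zero] at this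
    linarith
  have hx : ∀ y ∈ Y, ∃ x ∈ signCell G R y, eval x k = η := fun y hy =>
    hκ y hy η ⟨hη0, hηκ.trans_le (hκ₀Y y hy)⟩
  choose! y' hy'c hy'k using hx
  obtain ⟨μ, hμ, hμY⟩ := exists_pos_le_of_finset Y (fun y => |eval (y' y) F|)
    fun y hy => abs_pos.2 (eval_barrier_ne_zero (hy'c y hy))
  have hδ : 0 < μ / (4 * R) := by positivity
  set J₀ := pderiv i k * pderiv j F - pderiv j k * pderiv i F with hJ₀
  have hsub : {b : ℝ | J₀ - C b * pderiv i k = 0}.Finite := by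
    apply Set.Subsingleton.finite
    intro a ha b hb
    have ha' : J₀ - C a * pderiv i k = 0 := ha
    have hb' : J₀ - C b * pderiv i k = 0 := hb
    exact C_injective _ _ (mul_right_cancel₀ hi
      ((sub_eq_zero.1 ha').symm.trans (sub_eq_zero.1 hb')))
  obtain ⟨b, ⟨hb0, hbd⟩, hb⟩ := exists_Ioo_notMem_of_finite
    (hsub.union (finite_setOf_not_isRelPrime hkη hη J₀)) hδ
  have hb1 : J₀ - C b * pderiv i k ≠ 0 := fun h => hb (Or.inl h)
  have hb2 : IsRelPrime (k - C η) (J₀ - C b * pderiv i k) := by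
    by_contra h
    exact hb (Or.inr h)
  refine card_le_of_disjoint_signCells (R := R) hY
    {x | eval x (k - C η) = 0 ∧ eval x (J₀ - C b * pderiv i k) = 0} ?_ ?_
  · intro Z hZ
    refine (card_common_zeros_le hkη hb1 hb2 Z (fun z hz => (hZ hz).1) fun z hz => (hZ hz).2).trans
      (Nat.mul_le_mul ?_ ?_)
    · exact (totalDegree_sub_C_le _ _).trans hkd
    · have e1 := (totalDegree_pderiv_le i k).trans hkd
      have e2 := (totalDegree_pderiv_le j k).trans hkd
      have e3 := (totalDegree_pderiv_le i F).trans hFd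
      have e4 := (totalDegree_pderiv_le j F).trans hFd
      refine (totalDegree_sub _ _).trans (max_le ((totalDegree_sub _ _).trans (max_le ?_ ?_)) ?_)
      · exact (totalDegree_mul _ _).trans (by omega)
      · exact (totalDegree_mul _ _).trans (by omega)
      · refine (totalDegree_mul _ _).trans ?_
        rw [totalDegree_C]
        omega
  · intro y hy
    have hbound : ∀ x : Fin 2 → ℝ, ∑ i, x i ^ 2 ≤ R ^ 2 →
        2 * |b * x j| < |eval (y' y) (barrier G R)| := by
      intro x hx
      have h1 := abs_le_of_sum_sq_le hR hx j
      have h2 := hμY y hy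
      have h5 : b * |x j| ≤ μ / (4 * R) * R := mul_le_mul hbd.le h1 (abs_nonneg _) hδ.le
      have h6 : μ / (4 * R) * R = μ / 4 := by field_simp
      simp only [hF] at h2
      rw [abs_mul, abs_of_pos hb0]
      linarith
    obtain ⟨x, ⟨hxη, hxc⟩, hx⟩ := exists_isLocalMaxOn_signCell G R
      (isClosed_eq (MvPolynomial.continuous_eval k) continuous_const) (Z := {x | eval x k = η})
      (hy'k y hy) (hy'c y hy) (L := fun x => b * x j) (by fun_prop) hbound
    have hxη : eval x k = η := hxη
    refine ⟨x, hxc, by simp [hxη], ?_⟩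
    have hne : eval y G.prod ≠ 0 := by
      have := list_prod_mul_pos G (hYR y hy).2
      exact left_ne_zero_of_mul this.ne'
    have hd := (hasStrictFDerivAt_eval (C (eval y G.prod) * (F - C b * X j)) x)
    have hx' : IsLocalMaxOn (fun z => eval z (C (eval y G.prod) * (F - C b * X j)))
        {z | eval z k = eval x k} x := by
      rw [hxη]; simpa using hx
    obtain ⟨s, t, hst, h0⟩ := IsLocalExtrOn.exists_multipliers_of_hasStrictFDerivAt_1d
      (f := fun x => eval x k) (φ := fun z => eval z (C (eval y G.prod) * (F - C b * X j)))
      (Or.inr hx') (hasStrictFDerivAt_eval k x) hd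
    have ei := congrArg (fun l : (Fin 2 → ℝ) →L[ℝ] ℝ => l (Pi.single i 1)) h0
    have ej := congrArg (fun l : (Fin 2 → ℝ) →L[ℝ] ℝ => l (Pi.single j 1)) h0
    simp [-Fin.sum_univ_two, Pi.single_apply, pderiv_X] at ei ej
    rw [if_neg hij.symm, map_zero, sub_zero] at ei
    have hdet : eval y G.prod * eval x (J₀ - C b * pderiv i k) = 0 := by
      simp only [hJ₀, map_sub, map_mul, eval_C]
      by_cases hs : s = 0
      · have ht : t ≠ 0 := fun ht => hst (by rw [hs, ht]; rfl)
        apply mul_left_cancel₀ ht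
        linear_combination eval x (pderiv i k) * ej - eval x (pderiv j k) * ei
      · apply mul_left_cancel₀ hs
        linear_combination (eval y G.prod * (eval x (pderiv j F) - b)) * ei -
          (eval y G.prod * eval x (pderiv i F)) * ej
    exact (mul_eq_zero.1 hdet).resolve_left hne

/-- `x` lies on the sphere of radius `α` centred at `p`. -/
def OnSphere (α : ℝ) (p x : Fin 3 → ℝ) : Prop :=
  (p 0 - x 0) ^ 2 + (p 1 - x 1) ^ 2 + (p 2 - x 2) ^ 2 = α ^ 2

/-- The denominator in stereographic projection. -/
def stereoDen : MvPolynomial (Fin 2) ℝ := C 1 + X 0 ^ 2 + X 1 ^ 2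

/-- The numerators of the coordinates in stereographic projection. -/
def stereoNum (α : ℝ) (p : Fin 3 → ℝ) : Fin 3 → MvPolynomial (Fin 2) ℝ :=
  ![C (p 0) * stereoDen + C (2 * α) * X 0, C (p 1) * stereoDen + C (2 * α) * X 1,
    C (p 2) * stereoDen + C α * (X 0 ^ 2 + X 1 ^ 2 - C 1)]

/-- Inverse stereographic projection onto the sphere of radius `α` centred at `p`. -/
def stereo (α : ℝ) (p : Fin 3 → ℝ) (w : Fin 2 → ℝ) (i : Fin 3) : ℝ :=
  eval w (stereoNum α p i) / eval w stereoDen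

theorem eval_stereoDen (w : Fin 2 → ℝ) : eval w stereoDen = 1 + w 0 ^ 2 + w 1 ^ 2 := by
  simp [stereoDen]

theorem eval_stereoDen_pos (w : Fin 2 → ℝ) : 0 < eval w stereoDen := by
  rw [eval_stereoDen]; positivity

theorem exists_stereo_eq {α : ℝ} (hα : 0 < α) {p x : Fin 3 → ℝ} (h : OnSphere α p x)
    (hx : x 2 ≠ p 2 + α) : ∃ w, stereo α p w = x := by
  have hd : α - (x 2 - p 2) ≠ 0 := fun h' => hx (by linarith)
  have h' : (p 0 - x 0) ^ 2 + (p 1 - x 1) ^ 2 + (p 2 - x 2) ^ 2 = α ^ 2 := h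
  refine ⟨![(x 0 - p 0) / (α - (x 2 - p 2)), (x 1 - p 1) / (α - (x 2 - p 2))], ?_⟩
  set δ := α - (x 2 - p 2) with hδ
  have hden : 1 + ((x 0 - p 0) / δ) ^ 2 + ((x 1 - p 1) / δ) ^ 2 = 2 * α / δ := by
    field_simp
    rw [hδ]
    linear_combination h'
  have hdn := eval_stereoDen ![(x 0 - p 0) / δ, (x 1 - p 1) / δ]
  simp only [Matrix.cons_val_zero, Matrix.cons_val_one] at hdn
  rw [hden] at hdn
  have hsq : ((x 0 - p 0) / δ) ^ 2 + ((x 1 - p 1) / δ) ^ 2 = 2 * α / δ - 1 := by linarith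
  funext i
  fin_cases i
  · simp [stereo, stereoNum, hdn]
    field_simp
    ring
  · simp [stereo, stereoNum, hdn]
    field_simp
    ring
  · simp [stereo, stereoNum, hdn, hsq]
    field_simp
    rw [hδ]; ring

theorem totalDegree_stereoDen_le : stereoDen.totalDegree ≤ 2 := by
  refine (totalDegree_add _ _).trans (max_le ((totalDegree_add _ _).trans (max_le ?_ ?_)) ?_)
  · rw [totalDegree_C]; exact Nat.zero_le _
  · exact (totalDegree_pow _ _).trans (by simp)
  · exact (totalDegree_pow _ _).trans (by simp)

theorem totalDegree_stereoNum_le (α : ℝ) (p : Fin 3 → ℝ) (i : Fin 3) :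
    (stereoNum α p i).totalDegree ≤ 2 := by
  have hC : ∀ (a : ℝ) {q : MvPolynomial (Fin 2) ℝ}, q.totalDegree ≤ 2 →
      (C a * q).totalDegree ≤ 2 := by
    intro a q hq
    refine (totalDegree_mul _ _).trans ?_
    rw [totalDegree_C]; omega
  have hX : ∀ i : Fin 2, (X i : MvPolynomial (Fin 2) ℝ).totalDegree ≤ 2 := fun i => by simp
  have hX2 : ∀ i : Fin 2, (X i ^ 2 : MvPolynomial (Fin 2) ℝ).totalDegree ≤ 2 := fun i =>
    (totalDegree_pow _ _).trans (by simp)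
  fin_cases i
  · exact (totalDegree_add _ _).trans (max_le (hC _ totalDegree_stereoDen_le) (hC _ (hX 0)))
  · exact (totalDegree_add _ _).trans (max_le (hC _ totalDegree_stereoDen_le) (hC _ (hX 1)))
  · refine (totalDegree_add _ _).trans (max_le (hC _ totalDegree_stereoDen_le) (hC _ ?_))
    refine (totalDegree_sub_C_le _ _).trans ((totalDegree_add _ _).trans (max_le (hX2 0) (hX2 1)))

theorem exists_pullback (α : ℝ) (p : Fin 3 → ℝ) {f : MvPolynomial (Fin 3) ℝ} {D : ℕ}
    (hf : f.totalDegree ≤ D) : ∃ g : MvPolynomial (Fin 2) ℝ, g.totalDegree ≤ 2 * D ∧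
      ∀ w, eval w g = eval w stereoDen ^ D * eval (stereo α p w) f := by
  have hs : ∀ s ∈ f.support, s 0 + s 1 + s 2 ≤ D := by
    intro s hs
    have := (le_totalDegree hs).trans hf
    rwa [Finsupp.sum_fintype _ _ (fun _ => rfl), Fin.sum_univ_three] at this
  refine ⟨∑ s ∈ f.support, C (coeff s f) * ((∏ i, stereoNum α p i ^ s i) *
    stereoDen ^ (D - (s 0 + s 1 + s 2))), ?_, fun w => ?_⟩
  · refine totalDegree_finsetSum_le fun s hs' => ?_
    have h0 := hs s hs'
    have hpow : ∀ (q : MvPolynomial (Fin 2) ℝ) (k : ℕ), q.totalDegree ≤ 2 →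
        (q ^ k).totalDegree ≤ 2 * k := fun q k hq =>
      (totalDegree_pow _ _).trans (by rw [mul_comm 2]; exact Nat.mul_le_mul_left _ hq)
    refine (totalDegree_mul _ _).trans ?_
    rw [totalDegree_C, zero_add]
    refine (totalDegree_mul _ _).trans ?_
    have h1 := (totalDegree_finsetProd Finset.univ (fun i => stereoNum α p i ^ s i)).trans
      (Finset.sum_le_sum fun i _ => hpow _ (s i) (totalDegree_stereoNum_le α p i))
    have h2 := hpow _ (D - (s 0 + s 1 + s 2)) totalDegree_stereoDen_le
    rw [Fin.sum_univ_three] at h1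
    omega
  · rw [map_sum, eval_eq' (stereo α p w) f, Finset.mul_sum]
    refine Finset.sum_congr rfl fun s hs' => ?_
    have h0 := hs s hs'
    have hd := (eval_stereoDen_pos w).ne'
    simp only [map_mul, eval_C, map_pow, Fin.prod_univ_three, stereo, div_pow]
    obtain ⟨r, hr⟩ := Nat.exists_eq_add_of_le h0
    rw [hr, Nat.add_sub_cancel_left]
    field_simp
    ring

/-- A finite subset of a sphere pulls back under stereographic projection, up to one point. -/
theorem exists_stereo_preimage {α : ℝ} (hα : 0 < α) {p : Fin 3 → ℝ} (Y : Finset (Fin 3 → ℝ))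
    (hY : ∀ y ∈ Y, OnSphere α p y) : ∃ Y' : Finset (Fin 2 → ℝ), Y.card ≤ Y'.card + 1 ∧
      (∀ w ∈ Y', stereo α p w ∈ Y) ∧ Set.InjOn (stereo α p) Y' := by
  classical
  have h : ∀ y ∈ Y.filter (fun y => y 2 ≠ p 2 + α), ∃ w, stereo α p w = y := fun y hy =>
    exists_stereo_eq hα (hY y (Finset.mem_filter.1 hy).1) (Finset.mem_filter.1 hy).2
  choose! ψ hψ using h
  refine ⟨(Y.filter (fun y => y 2 ≠ p 2 + α)).image ψ, ?_, ?_, ?_⟩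
  · rw [Finset.card_image_of_injOn (fun a ha b hb hab => by rw [← hψ a ha, ← hψ b hb, hab])]
    rw [← Finset.card_filter_add_card_filter_not (s := Y) (fun y => y 2 ≠ p 2 + α)]
    gcongr
    rw [Finset.card_le_one]
    have hpole : ∀ a ∈ Y.filter (fun y => ¬ y 2 ≠ p 2 + α), a = ![p 0, p 1, p 2 + α] := by
      intro a ha
      obtain ⟨ha, h2⟩ := Finset.mem_filter.1 ha
      have h2 := not_not.1 h2
      have h3 : (p 0 - a 0) ^ 2 + (p 1 - a 1) ^ 2 + (p 2 - a 2) ^ 2 = α ^ 2 := hY a ha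
      rw [h2] at h3
      have h4 : p 0 - a 0 = 0 := by nlinarith [sq_nonneg (p 0 - a 0), sq_nonneg (p 1 - a 1)]
      have h5 : p 1 - a 1 = 0 := by nlinarith [sq_nonneg (p 0 - a 0), sq_nonneg (p 1 - a 1)]
      funext i
      fin_cases i
      · simp; linarith
      · simp; linarith
      · simpa using h2
    intro a ha b hb
    rw [hpole a ha, hpole b hb]
  · intro w hw
    obtain ⟨y, hy, rfl⟩ := Finset.mem_image.1 hw
    rw [hψ y hy]
    exact (Finset.mem_filter.1 hy).1
  · intro a ha b hb hab
    obtain ⟨y, hy, rfl⟩ := Finset.mem_image.1 ha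
    obtain ⟨z, hz, rfl⟩ := Finset.mem_image.1 hb
    rw [hψ y hy, hψ z hz] at hab
    rw [hab]

theorem exists_pullback_list (α : ℝ) (p : Fin 3 → ℝ) {D : ℕ} (G : List (MvPolynomial (Fin 3) ℝ))
    (hG : ∀ g ∈ G, g.totalDegree ≤ D) : ∃ G' : List (MvPolynomial (Fin 2) ℝ),
      (G'.map totalDegree).sum ≤ G.length * (2 * D) ∧
      (∀ g' ∈ G', ∃ g ∈ G, ∀ w, eval w g' = eval w stereoDen ^ D * eval (stereo α p w) g) ∧
      (∀ g ∈ G, ∃ g' ∈ G', ∀ w, eval w g' = eval w stereoDen ^ D * eval (stereo α p w) g) := by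
  induction G with
  | nil => exact ⟨[], by simp⟩
  | cons g G ih =>
    obtain ⟨G', h1, h2, h3⟩ := ih fun g hg => hG g (List.mem_cons_of_mem _ hg)
    obtain ⟨g', hg', hw⟩ := exists_pullback α p (hG g List.mem_cons_self)
    refine ⟨g' :: G', ?_, ?_, ?_⟩
    · simp only [List.map_cons, List.sum_cons, List.length_cons]
      linarith
    · intro f hf
      rcases List.mem_cons.1 hf with rfl | hf
      · exact ⟨g, List.mem_cons_self, hw⟩
      · obtain ⟨e, he, he'⟩ := h2 f hf
        exact ⟨e, List.mem_cons_of_mem _ he, he'⟩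
    · intro f hf
      rcases List.mem_cons.1 hf with rfl | hf
      · exact ⟨g', List.mem_cons_self, hw⟩
      · obtain ⟨e, he, he'⟩ := h3 f hf
        exact ⟨e, List.mem_cons_of_mem _ he, he'⟩

theorem card_le_of_signs_sphere {α : ℝ} (hα : 0 < α) (p : Fin 3 → ℝ) {D : ℕ}
    {G : List (MvPolynomial (Fin 3) ℝ)} (hG : ∀ g ∈ G, g.totalDegree ≤ D)
    {Y : Finset (Fin 3 → ℝ)} (hYp : ∀ y ∈ Y, OnSphere α p y)
    (hY0 : ∀ y ∈ Y, ∀ g ∈ G, eval y g ≠ 0)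
    (hY : ∀ y ∈ Y, ∀ y' ∈ Y, y ≠ y' → ∃ g ∈ G, eval y g * eval y' g < 0) :
    Y.card ≤ (G.length * (2 * D) + 2) * (G.length * (2 * D) + 2) + 1 ∧
    ∀ (f : MvPolynomial (Fin 3) ℝ) (d : ℕ), f.totalDegree ≤ d → (∀ y ∈ Y, eval y f = 0) →
      (∃ w, eval (stereo α p w) f ≠ 0) →
      Y.card ≤ (2 * (2 * d)) * (2 * (2 * d) + (G.length * (2 * D) + 2)) + 1 := by
  obtain ⟨Y', hcard, hmem, hinj⟩ := exists_stereo_preimage hα Y hYp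
  obtain ⟨G', hdeg, h1, h2⟩ := exists_pullback_list α p G hG
  have hne : ∀ w (k : ℕ), eval w stereoDen ^ k ≠ 0 := fun w k =>
    pow_ne_zero _ (eval_stereoDen_pos w).ne'
  have hY0' : ∀ y ∈ Y', ∀ g ∈ G', eval y g ≠ 0 := by
    intro y hy g hg
    obtain ⟨e, he, he'⟩ := h1 g hg
    rw [he']
    exact mul_ne_zero (hne _ _) (hY0 _ (hmem y hy) e he)
  have hY' : ∀ y ∈ Y', ∀ y' ∈ Y', y ≠ y' → ∃ g ∈ G', eval y g * eval y' g < 0 := by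
    intro y hy y' hy' hyy
    obtain ⟨g, hg, hlt⟩ := hY _ (hmem y hy) _ (hmem y' hy') fun h => hyy (hinj hy hy' h)
    obtain ⟨g', hg', hgg⟩ := h2 g hg
    refine ⟨g', hg', ?_⟩
    rw [hgg, hgg]
    have := mul_pos (pow_pos (eval_stereoDen_pos y) D) (pow_pos (eval_stereoDen_pos y') D)
    have := mul_neg_of_pos_of_neg this hlt
    linarith
  constructor
  · have := card_le_of_signs_plane hdeg hY0' hY'
    omega
  · intro f d hfd hYf ⟨w, hw⟩
    obtain ⟨g, hg, hgw⟩ := exists_pullback α p hfd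
    have hg0 : g ≠ 0 := by
      rintro rfl
      have := hgw w
      rw [map_zero] at this
      exact mul_ne_zero (hne _ _) hw this.symm
    have := card_le_of_signs_curve hdeg hg0 hg
      (fun y hy => by rw [hgw, hYf _ (hmem y hy), mul_zero]) hY0' hY'
    omega

theorem OnSphere.symm {α : ℝ} {p x : Fin 3 → ℝ} (h : OnSphere α p x) : OnSphere α x p := by
  unfold OnSphere at *
  linear_combination h

theorem exists_smul_of_cross_eq_zero {a b : Fin 3 → ℝ} (ha : a ≠ 0)
    (h0 : a 1 * b 2 = a 2 * b 1) (h1 : a 2 * b 0 = a 0 * b 2) (h2 : a 0 * b 1 = a 1 * b 0) :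
    ∃ t : ℝ, b = t • a := by
  obtain ⟨i, hi⟩ := Function.ne_iff.1 ha
  have hi : a i ≠ 0 := hi
  refine ⟨b i / a i, ?_⟩
  funext j
  simp only [Pi.smul_apply, smul_eq_mul]
  rw [div_mul_eq_mul_div, eq_div_iff hi]
  fin_cases i <;> fin_cases j <;> simp <;> linarith

theorem eq_of_collinear_onSphere {α : ℝ} {x q w : Fin 3 → ℝ} {s t : ℝ} (hs : s ≠ 0) (ht : t ≠ 0)
    (hw : w ≠ 0) (h0 : OnSphere α x q) (h1 : OnSphere α x (q + s • w))
    (h2 : OnSphere α x (q + t • w)) : s = t := by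
  unfold OnSphere at *
  simp only [Pi.add_apply, Pi.smul_apply, smul_eq_mul] at h1 h2
  have hw' : w 0 ^ 2 + w 1 ^ 2 + w 2 ^ 2 ≠ 0 := by
    intro h
    apply hw
    funext i
    have a0 : w 0 = 0 := by nlinarith [sq_nonneg (w 0), sq_nonneg (w 1), sq_nonneg (w 2)]
    have a1 : w 1 = 0 := by nlinarith [sq_nonneg (w 0), sq_nonneg (w 1), sq_nonneg (w 2)]
    have a2 : w 2 = 0 := by nlinarith [sq_nonneg (w 0), sq_nonneg (w 1), sq_nonneg (w 2)]
    fin_cases i <;> simp [a0, a1, a2]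
  have e1 : s * (s * (w 0 ^ 2 + w 1 ^ 2 + w 2 ^ 2) -
      2 * ((x 0 - q 0) * w 0 + (x 1 - q 1) * w 1 + (x 2 - q 2) * w 2)) = 0 := by
    linear_combination h1 - h0
  have e2 : t * (t * (w 0 ^ 2 + w 1 ^ 2 + w 2 ^ 2) -
      2 * ((x 0 - q 0) * w 0 + (x 1 - q 1) * w 1 + (x 2 - q 2) * w 2)) = 0 := by
    linear_combination h2 - h0
  have e1 := (mul_eq_zero.1 e1).resolve_left hs
  have e2 := (mul_eq_zero.1 e2).resolve_left ht
  apply mul_right_cancel₀ hw'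
  linarith

theorem not_onSphere_three {α : ℝ} {x q : Fin 3 → Fin 3 → ℝ} (hx : Function.Injective x)
    (hq : Function.Injective q) (h : ∀ i j, OnSphere α (x i) (q j)) : False := by
  have hline : ∀ (a b : Fin 3 → Fin 3 → ℝ) (w : Fin 3 → ℝ) (s t : ℝ), Function.Injective b →
      w ≠ 0 → b 1 - b 0 = s • w → b 2 - b 0 = t • w → (∀ j, OnSphere α (a 0) (b j)) → False := by
    intro a b w s t hb hw h1 h2 ho
    have e1 : b 1 = b 0 + s • w := by rw [← h1]; abel
    have e2 : b 2 = b 0 + t • w := by rw [← h2]; abel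
    have hs : s ≠ 0 := by
      rintro rfl
      have : b 1 = b 0 := by simpa using e1
      exact absurd (hb this) (by decide)
    have ht : t ≠ 0 := by
      rintro rfl
      have : b 2 = b 0 := by simpa using e2
      exact absurd (hb this) (by decide)
    have := eq_of_collinear_onSphere hs ht hw (ho 0) (e1 ▸ ho 1) (e2 ▸ ho 2)
    rw [this, ← e2] at e1
    exact absurd (hb e1) (by decide)
  set u := q 1 - q 0 with hu
  set v := q 2 - q 0 with hv
  have hu0 : u ≠ 0 := fun h' => absurd (hq (sub_eq_zero.1 h')) (by decide)
  set N : Fin 3 → ℝ := ![u 1 * v 2 - u 2 * v 1, u 2 * v 0 - u 0 * v 2, u 0 * v 1 - u 1 * v 0]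
    with hN
  have hN0 : N ≠ 0 := by
    intro hN0
    have c0 := congrFun hN0 0
    have c1 := congrFun hN0 1
    have c2 := congrFun hN0 2
    simp [hN] at c0 c1 c2
    obtain ⟨t, ht⟩ := exists_smul_of_cross_eq_zero hu0 (sub_eq_zero.1 c0) (sub_eq_zero.1 c1)
      (sub_eq_zero.1 c2)
    exact hline x q u 1 t hq hu0 (by rw [one_smul]) ht (h 0)
  have horth : ∀ i j, (x i 0 - x 0 0) * (q j 0 - q 0 0) + (x i 1 - x 0 1) * (q j 1 - q 0 1) +
      (x i 2 - x 0 2) * (q j 2 - q 0 2) = 0 := by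
    intro i j
    have h1 := h i j
    have h2 := h i 0
    have h3 := h 0 j
    have h4 := h 0 0
    unfold OnSphere at h1 h2 h3 h4
    linear_combination (1 / 2) * (h2 - h1 + h3 - h4)
  have hpar : ∀ i, ∃ t : ℝ, x i - x 0 = t • N := by
    intro i
    have h1 := horth i 1
    have h2 := horth i 2
    apply exists_smul_of_cross_eq_zero hN0
    · simp [hN, hu, hv]
      linear_combination (q 2 0 - q 0 0) * h1 - (q 1 0 - q 0 0) * h2
    · simp [hN, hu, hv]
      linear_combination (q 2 1 - q 0 1) * h1 - (q 1 1 - q 0 1) * h2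
    · simp [hN, hu, hv]
      linear_combination (q 2 2 - q 0 2) * h1 - (q 1 2 - q 0 2) * h2
  obtain ⟨s, hs⟩ := hpar 1
  obtain ⟨t, ht⟩ := hpar 2
  exact hline q x N s t hx hN0 hs ht fun j => (h j 0).symm

theorem exists_injective_fin_three {X : Type*} {Z : Finset X} (h : 2 < Z.card) :
    ∃ x : Fin 3 → X, Function.Injective x ∧ ∀ i, x i ∈ Z := by
  obtain ⟨a, b, c, ha, hb, hc, hab, hac, hbc⟩ := Finset.two_lt_card_iff.1 h
  refine ⟨![a, b, c], ?_, ?_⟩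
  · intro i j hij
    fin_cases i <;> fin_cases j <;> simp_all [eq_comm]
  · intro i; fin_cases i <;> simp [ha, hb, hc]

theorem min_card_le_two {α : ℝ} {P Q : Finset (Fin 3 → ℝ)}
    (h : ∀ p ∈ P, ∀ q ∈ Q, OnSphere α p q) (hQ : 2 < Q.card) : P.card ≤ 2 := by
  by_contra! hP
  obtain ⟨x, hx, hxP⟩ := exists_injective_fin_three hP
  obtain ⟨q, hq, hqQ⟩ := exists_injective_fin_three hQ
  exact not_onSphere_three hx hq fun i j => h _ (hxP i) _ (hqQ j)

open Classical in
/-- The points of `Q` on the sphere of radius `α` centred at `p`. -/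
def nb (α : ℝ) (p : Fin 3 → ℝ) (Q : Finset (Fin 3 → ℝ)) : Finset (Fin 3 → ℝ) :=
  Q.filter (OnSphere α p)

/-- The number of hinges with apex in `P` and both endpoints in `Q`. -/
def hinge (α : ℝ) (P Q : Finset (Fin 3 → ℝ)) : ℕ := ∑ p ∈ P, (nb α p Q).card ^ 2

theorem mem_nb {α : ℝ} {p x : Fin 3 → ℝ} {Q : Finset (Fin 3 → ℝ)} :
    x ∈ nb α p Q ↔ x ∈ Q ∧ OnSphere α p x := by
  simp [nb]

theorem sq_le_choose_three (k : ℕ) : k ^ 2 ≤ 4 + 6 * k.choose 3 := by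
  rcases k with _ | _ | _ | k
  · simp
  · exact le_add_right (by norm_num)
  · exact le_add_right (by norm_num)
  · have h := Nat.add_one_mul_choose_eq (k + 2) 2
    have h2 := Nat.add_one_mul_choose_eq (k + 1) 1
    rw [Nat.choose_one_right] at h2
    have e : k + 1 + 1 = k + 2 := rfl
    have e' : k + 2 + 1 = k + 3 := rfl
    have e3 : 2 + 1 = 3 := rfl
    have e4 : 1 + 1 = 2 := rfl
    have e5 : k + 1 + 1 + 1 = k + 3 := rfl
    simp only [e, e', e3, e4] at h h2
    rw [e5]
    nlinarith

theorem hinge_le_four_mul_add (α : ℝ) (P Q : Finset (Fin 3 → ℝ)) :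
    hinge α P Q ≤ 4 * P.card + 2 * Q.card ^ 3 := by
  classical
  have h1 : ∑ p ∈ P, (nb α p Q).card.choose 3 ≤ 2 * Q.card.choose 3 := by
    have : ∀ p ∈ P, (nb α p Q).card.choose 3 =
        ∑ T ∈ Q.powersetCard 3, if T ⊆ nb α p Q then 1 else 0 := by
      intro p _
      rw [← Finset.card_powersetCard, ← Finset.sum_filter, ← Finset.card_eq_sum_ones]
      congr 1
      ext T
      simp only [Finset.mem_powersetCard, Finset.mem_filter]
      constructor
      · rintro ⟨h, h'⟩
        exact ⟨⟨h.trans (Finset.filter_subset _ _), h'⟩, h⟩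
      · rintro ⟨⟨_, h'⟩, h⟩
        exact ⟨h, h'⟩
    rw [Finset.sum_congr rfl this, Finset.sum_comm, ← Finset.card_powersetCard, mul_comm,
      ← smul_eq_mul]
    refine Finset.sum_le_card_nsmul _ _ _ fun T hT => ?_
    rw [← Finset.sum_filter, ← Finset.card_eq_sum_ones]
    refine min_card_le_two (Q := T) (α := α) (fun p hp q hq => ?_) ?_
    · exact (mem_nb.1 ((Finset.mem_filter.1 hp).2 hq)).2
    · rw [(Finset.mem_powersetCard.1 hT).2]; norm_num
  have h2 : 6 * Q.card.choose 3 ≤ Q.card ^ 3 := by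
    have := Nat.descFactorial_eq_factorial_mul_choose Q.card 3
    have h3 := Nat.descFactorial_le_pow Q.card 3
    rw [this] at h3
    exact h3
  calc hinge α P Q ≤ ∑ p ∈ P, (4 + 6 * (nb α p Q).card.choose 3) :=
        Finset.sum_le_sum fun p _ => sq_le_choose_three _
    _ = 4 * P.card + 6 * ∑ p ∈ P, (nb α p Q).card.choose 3 := by
        rw [Finset.sum_add_distrib, Finset.mul_sum]; simp [mul_comm]
    _ ≤ _ := by omega

/-- The shape of the bounds for hinges. -/
def hingeBound (ε : ℝ) (m n : ℕ) : ℝ :=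
  √(m * (n : ℝ) ^ 3) * (n : ℝ) ^ ε + (n : ℝ) ^ 2 + m

theorem hingeBound_nonneg (ε : ℝ) (m n : ℕ) : 0 ≤ hingeBound ε m n := by
  unfold hingeBound; positivity

theorem hinge_mono {α : ℝ} {P P' Q Q' : Finset (Fin 3 → ℝ)} (hP : P ⊆ P') (hQ : Q ⊆ Q') :
    hinge α P Q ≤ hinge α P' Q' := by
  unfold hinge
  refine (Finset.sum_le_sum fun p _ => ?_).trans (Finset.sum_le_sum_of_subset hP)
  gcongr
  intro x hx
  rw [mem_nb] at hx ⊢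
  exact ⟨hQ hx.1, hx.2⟩

theorem hinge_union_le {α : ℝ} [DecidableEq (Fin 3 → ℝ)] (P Q Q' : Finset (Fin 3 → ℝ)) :
    hinge α P (Q ∪ Q') ≤ 2 * hinge α P Q + 2 * hinge α P Q' := by
  unfold hinge
  rw [Finset.mul_sum, Finset.mul_sum, ← Finset.sum_add_distrib]
  refine Finset.sum_le_sum fun p _ => ?_
  have h : (nb α p (Q ∪ Q')).card ≤ (nb α p Q).card + (nb α p Q').card := by
    refine le_trans (Finset.card_le_card ?_) (Finset.card_union_le _ _)
    intro x hx
    simp only [mem_nb, Finset.mem_union] at hx ⊢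
    tauto
  refine (Nat.pow_le_pow_left h 2).trans ?_
  zify
  nlinarith [sq_nonneg (((nb α p Q).card : ℤ) - (nb α p Q').card)]

theorem hinge_le_of_card_le {α : ℝ} {P Q : Finset (Fin 3 → ℝ)} {k : ℕ} (hP : P.card ≤ k) :
    hinge α P Q ≤ k * Q.card ^ 2 := by
  refine le_trans (Finset.sum_le_card_nsmul P _ (Q.card ^ 2) fun p _ => ?_) ?_
  · exact Nat.pow_le_pow_left (Finset.card_le_card (fun x hx => (mem_nb.1 hx).1)) 2
  · rw [smul_eq_mul]; gcongr

theorem hinge_sdiff_add {α : ℝ} [DecidableEq (Fin 3 → ℝ)] {P₀ P : Finset (Fin 3 → ℝ)} (h : P₀ ⊆ P)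
    (Q : Finset (Fin 3 → ℝ)) : hinge α (P \ P₀) Q + hinge α P₀ Q = hinge α P Q :=
  Finset.sum_sdiff h

/-- If every sphere meets few classes of a partition, hinges are controlled by the classes. -/
theorem hinge_le_sum_classes {α : ℝ} {ι : Type*} [DecidableEq ι] (lab : (Fin 3 → ℝ) → ι)
    (P Q : Finset (Fin 3 → ℝ)) {κ : ℝ}
    (hκ : ∀ p ∈ P, (((nb α p Q).image lab).card : ℝ) ≤ κ) :
    ∃ (I : Finset ι) (P' : ι → Finset (Fin 3 → ℝ)),
      (∑ i ∈ I, ((Q.filter (lab · = i)).card : ℝ)) = Q.card ∧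
      ∑ i ∈ I, ((P' i).card : ℝ) ≤ κ * P.card ∧
      (hinge α P Q : ℝ) ≤ κ * ∑ i ∈ I, (hinge α (P' i) (Q.filter (lab · = i)) : ℝ) := by
  classical
  refine ⟨Q.image lab, fun i => P.filter fun p => i ∈ (nb α p Q).image lab, ?_, ?_, ?_⟩
  · rw [Finset.card_eq_sum_card_image lab Q]; push_cast; rfl
  · have : ∑ i ∈ Q.image lab, ((P.filter fun p => i ∈ (nb α p Q).image lab).card : ℝ) =
        ∑ p ∈ P, ∑ i ∈ Q.image lab, if i ∈ (nb α p Q).image lab then (1 : ℝ) else 0 := by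
      rw [Finset.sum_comm]
      refine Finset.sum_congr rfl fun i _ => ?_
      rw [Finset.card_filter]; push_cast; rfl
    rw [this, mul_comm, ← nsmul_eq_mul]
    refine Finset.sum_le_card_nsmul _ _ _ fun p hp => ?_
    refine le_trans ?_ (hκ p hp)
    rw [← Finset.sum_filter, Finset.sum_const, nsmul_one]
    exact_mod_cast Finset.card_le_card fun i hi => (Finset.mem_filter.1 hi).2
  · have hcell : ∀ p ∈ P, ((nb α p Q).card : ℝ) ^ 2 ≤ κ * ∑ i ∈ Q.image lab,
        if i ∈ (nb α p Q).image lab then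
          ((nb α p (Q.filter (lab · = i))).card : ℝ) ^ 2 else 0 := by
      intro p hp
      have hsub : (nb α p Q).image lab ⊆ Q.image lab :=
        Finset.image_subset_image fun x hx => (mem_nb.1 hx).1
      rw [← Finset.sum_filter, Finset.filter_mem_eq_inter, Finset.inter_eq_right.2 hsub]
      have h1 : ((nb α p Q).card : ℝ) =
          ∑ i ∈ (nb α p Q).image lab, ((nb α p (Q.filter (lab · = i))).card : ℝ) := by
        rw [Finset.card_eq_sum_card_image lab (nb α p Q)]
        push_cast
        refine Finset.sum_congr rfl fun i _ => ?_
        congr 2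
        ext x
        simp only [mem_nb, Finset.mem_filter]
        tauto
      rw [h1]
      refine sq_sum_le_card_mul_sum_sq.trans ?_
      exact mul_le_mul_of_nonneg_right (hκ p hp) (Finset.sum_nonneg fun i _ => by positivity)
    unfold hinge
    push_cast
    refine (Finset.sum_le_sum hcell).trans (le_of_eq ?_)
    rw [← Finset.mul_sum, Finset.sum_comm]
    congr 1
    refine Finset.sum_congr rfl fun i _ => ?_
    rw [Finset.sum_filter]

theorem sum_sqrt_le {ι : Type*} (I : Finset ι) (m n : ι → ℝ) (hm : ∀ i ∈ I, 0 ≤ m i)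
    (hn : ∀ i ∈ I, 0 ≤ n i) {M N s : ℝ} (hM : ∑ i ∈ I, m i ≤ M) (hN : ∑ i ∈ I, n i ≤ N)
    (hs : ∀ i ∈ I, n i ≤ s) (hs0 : 0 ≤ s) :
    ∑ i ∈ I, √(m i * n i ^ 3) ≤ s * (√M * √N) := by
  have h1 : ∀ i ∈ I, √(m i * n i ^ 3) ≤ s * (√(m i) * √(n i)) := by
    intro i hi
    have : m i * n i ^ 3 ≤ (s * (√(m i) * √(n i))) ^ 2 := by
      rw [mul_pow, mul_pow, Real.sq_sqrt (hm i hi), Real.sq_sqrt (hn i hi)]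
      have h2 : n i ^ 2 ≤ s ^ 2 := pow_le_pow_left₀ (hn i hi) (hs i hi) 2
      have h3 := mul_le_mul_of_nonneg_right h2 (mul_nonneg (hm i hi) (hn i hi))
      nlinarith
    exact Real.sqrt_le_iff.2 ⟨by positivity, this⟩
  refine (Finset.sum_le_sum h1).trans ?_
  rw [← Finset.mul_sum]
  refine mul_le_mul_of_nonneg_left ?_ hs0
  calc ∑ i ∈ I, √(m i) * √(n i) ≤ √(∑ i ∈ I, √(m i) ^ 2) * √(∑ i ∈ I, √(n i) ^ 2) :=
        Real.sum_mul_le_sqrt_mul_sqrt _ _ _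
    _ = √(∑ i ∈ I, m i) * √(∑ i ∈ I, n i) := by
        rw [Finset.sum_congr rfl fun i hi => Real.sq_sqrt (hm i hi),
          Finset.sum_congr rfl fun i hi => Real.sq_sqrt (hn i hi)]
    _ ≤ _ := by gcongr

theorem hinge_recursion {α ε t κ B : ℝ} {ι : Type*} [DecidableEq ι] [DecidableEq (Fin 3 → ℝ)]
    (hε : 0 ≤ ε) (ht : 1 < t) (hκ : 0 ≤ κ) (hB : 0 ≤ B)
    (h1 : 2 * κ * √κ * t ^ (-(1 + ε)) ≤ 1 / 2) (h2 : 2 * κ / t ≤ 1 / 2)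
    (𝒬 : Finset (Fin 3 → ℝ) → Prop) (hereditary : ∀ Q Q', Q' ⊆ Q → 𝒬 Q → 𝒬 Q')
    (hyp : ∀ P Q, 𝒬 Q → ∃ (lab : (Fin 3 → ℝ) → ι) (Q₀ P₀ : Finset (Fin 3 → ℝ)),
      Q₀ ⊆ Q ∧ P₀ ⊆ P ∧ P₀.card ≤ 2 ∧
      (∀ i, (((Q \ Q₀).filter (lab · = i)).card : ℝ) ≤ Q.card / t) ∧
      (∀ p ∈ P \ P₀, (((nb α p (Q \ Q₀)).image lab).card : ℝ) ≤ κ) ∧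
      (hinge α P Q₀ : ℝ) ≤ B * hingeBound ε P.card Q.card) :
    ∃ A : ℝ, 0 ≤ A ∧ ∀ P Q, 𝒬 Q → (hinge α P Q : ℝ) ≤ A * hingeBound ε P.card Q.card := by
  set A : ℝ := 2 * (4 * B + 12 * κ ^ 2 + 2) with hA
  have hA0 : 0 ≤ A := by positivity
  have key : ∀ n : ℕ, ∀ P Q : Finset (Fin 3 → ℝ), Q.card = n → 𝒬 Q → (hinge α P Q : ℝ) ≤
      A * (√(P.card * (Q.card : ℝ) ^ 3) * (Q.card : ℝ) ^ ε + (Q.card : ℝ) ^ 2) + 6 * P.card := by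
    intro n
    induction n using Nat.strong_induction_on with
    | _ n ih =>
    intro P Q hQn hQ
    obtain ⟨m, hm⟩ : ∃ m : ℝ, (P.card : ℝ) = m := ⟨_, rfl⟩
    obtain ⟨N, hN⟩ : ∃ N : ℝ, (Q.card : ℝ) = N := ⟨_, rfl⟩
    have hm0 : 0 ≤ m := by rw [← hm]; positivity
    have hN0 : 0 ≤ N := by rw [← hN]; positivity
    rw [hm, hN]
    have hS0 : 0 ≤ √(m * N ^ 3) * N ^ ε := by positivity
    by_cases hmn : N ^ 3 ≤ m
    · have := hinge_le_four_mul_add α P Q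
      have h3 : (hinge α P Q : ℝ) ≤ 4 * m + 2 * N ^ 3 := by
        rw [← hm, ← hN]; exact_mod_cast this
      nlinarith [sq_nonneg N, mul_nonneg hA0 (add_nonneg hS0 (sq_nonneg N))]
    push Not at hmn
    have hNpos : 0 < Q.card := by
      rcases Nat.eq_zero_or_pos Q.card with h | h
      · rw [← hN, h] at hmn; norm_num at hmn; linarith
      · exact h
    have hN1 : 1 ≤ N := by rw [← hN]; exact_mod_cast hNpos
    have hNε : 1 ≤ N ^ ε := Real.one_le_rpow hN1 hε
    set S := √(m * N ^ 3) with hS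
    have hmS : m ≤ S := Real.le_sqrt_of_sq_le (by nlinarith)
    have hSS : S ≤ S * N ^ ε := le_mul_of_one_le_right (Real.sqrt_nonneg _) hNε
    obtain ⟨lab, Q₀, P₀, hQ₀, hP₀, hP₀c, hcl, hnb, hB₀⟩ := hyp P Q hQ
    obtain ⟨I, P', hI1, hI2, hI3⟩ := hinge_le_sum_classes lab (P \ P₀) (Q \ Q₀) hnb
    have e1 : (hinge α P Q : ℝ) ≤ 2 * N ^ 2 + 2 * hinge α (P \ P₀) Q₀ +
        2 * hinge α (P \ P₀) (Q \ Q₀) := by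
      have a1 := hinge_sdiff_add (α := α) hP₀ Q
      have a2 := hinge_le_of_card_le (α := α) (Q := Q) hP₀c
      have a3 := hinge_union_le (α := α) (P \ P₀) Q₀ (Q \ Q₀)
      rw [Finset.union_sdiff_of_subset hQ₀] at a3
      have : hinge α P Q ≤ 2 * Q.card ^ 2 + 2 * hinge α (P \ P₀) Q₀ +
        2 * hinge α (P \ P₀) (Q \ Q₀) := by omega
      rw [← hN]; exact_mod_cast this
    have e2 : (hinge α (P \ P₀) Q₀ : ℝ) ≤ B * (S * N ^ ε + N ^ 2 + m) := by
      rw [hingeBound, hm, hN] at hB₀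
      refine le_trans ?_ hB₀
      exact_mod_cast hinge_mono Finset.sdiff_subset le_rfl
    rw [hN] at hcl
    have hsz : ((Q \ Q₀).card : ℝ) ≤ N := by
      rw [← hN]; exact_mod_cast Finset.card_le_card Finset.sdiff_subset
    have hszP : ((P \ P₀).card : ℝ) ≤ m := by
      rw [← hm]; exact_mod_cast Finset.card_le_card Finset.sdiff_subset
    have ht0 : 0 < t := by linarith
    have e3 : ∀ i ∈ I, (hinge α (P' i) ((Q \ Q₀).filter (lab · = i)) : ℝ) ≤
        A * (√((P' i).card * (((Q \ Q₀).filter (lab · = i)).card : ℝ) ^ 3) * (N / t) ^ ε +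
          N / t * ((Q \ Q₀).filter (lab · = i)).card) + 6 * (P' i).card := by
      intro i _
      have hlt : (((Q \ Q₀).filter (lab · = i)).card : ℝ) < N :=
        (hcl i).trans_lt (div_lt_self (by linarith) ht)
      have hlt' : ((Q \ Q₀).filter (lab · = i)).card < n := by
        rw [← hQn]; rw [← hN] at hlt; exact_mod_cast hlt
      have hsub : (Q \ Q₀).filter (lab · = i) ⊆ Q :=
        (Finset.filter_subset _ _).trans Finset.sdiff_subset
      refine (ih _ hlt' (P' i) _ rfl (hereditary _ _ hsub hQ)).trans ?_
      have := hcl i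
      gcongr
      rw [sq]
      gcongr
    have e4 := sum_sqrt_le I (fun i => ((P' i).card : ℝ))
      (fun i => (((Q \ Q₀).filter (lab · = i)).card : ℝ)) (fun _ _ => by positivity)
      (fun _ _ => by positivity) (M := κ * m) (N := N) (s := N / t)
      (hI2.trans (by gcongr)) (hI1.le.trans hsz) (fun i _ => hcl i) (by positivity)
    have e5 : ∑ i ∈ I, (hinge α (P' i) ((Q \ Q₀).filter (lab · = i)) : ℝ) ≤
        A * (N / t * (√(κ * m) * √N) * (N / t) ^ ε + N / t * N) + 6 * (κ * m) := by
      refine (Finset.sum_le_sum e3).trans ?_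
      rw [Finset.sum_add_distrib, ← Finset.mul_sum, Finset.sum_add_distrib, ← Finset.sum_mul,
        ← Finset.mul_sum, ← Finset.mul_sum, hI1]
      have : ∑ i ∈ I, ((P' i).card : ℝ) ≤ κ * m := hI2.trans (by gcongr)
      gcongr
    have e6 : N / t * (√(κ * m) * √N) * (N / t) ^ ε = √κ * t ^ (-(1 + ε)) * (S * N ^ ε) := by
      have hs : S = √m * (N * √N) := by
        rw [hS, Real.sqrt_mul hm0]
        congr 1
        rw [show N ^ 3 = N ^ 2 * N by ring, Real.sqrt_mul (by positivity), Real.sqrt_sq hN0]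
      rw [hs, Real.sqrt_mul hκ, Real.div_rpow hN0 ht0.le, Real.rpow_neg ht0.le,
        Real.rpow_add ht0, Real.rpow_one]
      field_simp
    rw [e6] at e5
    have e7 : 2 * κ * (A * (√κ * t ^ (-(1 + ε)) * (S * N ^ ε))) ≤ A / 2 * (S * N ^ ε) := by
      have := mul_le_mul_of_nonneg_right h1 (mul_nonneg hA0 hS0)
      linarith
    have e8 : 2 * κ * (A * (N / t * N)) ≤ A / 2 * N ^ 2 := by
      have := mul_le_mul_of_nonneg_right h2 (mul_nonneg hA0 (sq_nonneg N))
      have e : 2 * κ * (A * (N / t * N)) = 2 * κ / t * (A * N ^ 2) := by field_simp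
      linarith
    have e9 : κ * (κ * m) ≤ κ ^ 2 * (S * N ^ ε) := by
      rw [← mul_assoc, ← sq]
      exact mul_le_mul_of_nonneg_left (hmS.trans hSS) (sq_nonneg κ)
    have e10 := mul_le_mul_of_nonneg_left e5 hκ
    have e11 : B * m ≤ B * (S * N ^ ε) := mul_le_mul_of_nonneg_left (hmS.trans hSS) hB
    have e12 : 0 ≤ B * N ^ 2 := by positivity
    have e13 : 0 ≤ κ ^ 2 * N ^ 2 := by positivity
    generalize S * N ^ ε = X at *
    generalize N ^ 2 = Y at *
    have e14 : A * X = A / 2 * X + (4 * B + 12 * κ ^ 2 + 2) * X := by rw [hA]; ring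
    have e15 : A * Y = A / 2 * Y + (4 * B + 12 * κ ^ 2 + 2) * Y := by rw [hA]; ring
    clear_value A
    linarith
  refine ⟨A + 6, by positivity, fun P Q hQ => (key _ P Q rfl hQ).trans ?_⟩
  unfold hingeBound
  have : (0 : ℝ) ≤ √(P.card * (Q.card : ℝ) ^ 3) * (Q.card : ℝ) ^ ε + (Q.card : ℝ) ^ 2 := by
    positivity
  have : (0 : ℝ) ≤ A * P.card := by positivity
  nlinarith

theorem card_le_of_antisymm {X : Type*} (A Y : Finset X) (hY : Y ⊆ A) (M : X → X → ℝ)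
    (hM : ∀ x y, M x y = -M y x) (h : ∀ y ∈ Y, 15 * A.card < 16 * (A.filter (0 < M y ·)).card) :
    8 * Y.card ≤ A.card := by
  classical
  rcases Y.eq_empty_or_nonempty with rfl | hne
  · simp
  have h1 : ∀ y ∈ Y, (A.filter (0 < M y ·)).card ≤ (Y.filter (0 < M y ·)).card +
      (A.card - Y.card) := by
    intro y _
    rw [← Finset.card_sdiff_of_subset hY]
    refine le_trans (Finset.card_le_card ?_) (Finset.card_union_le _ _)
    intro x hx
    simp only [Finset.mem_filter, Finset.mem_union, Finset.mem_sdiff] at hx ⊢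
    tauto
  have h2 : 2 * ∑ y ∈ Y, (Y.filter (0 < M y ·)).card ≤ Y.card * Y.card := by
    have e1 : ∑ y ∈ Y, (Y.filter (0 < M y ·)).card = ∑ y ∈ Y, (Y.filter (0 < M · y)).card := by
      simp only [Finset.card_filter]
      exact Finset.sum_comm
    have e2 : ∑ y ∈ Y, (Y.filter (0 < M y ·)).card + ∑ y ∈ Y, (Y.filter (0 < M · y)).card ≤
        Y.card * Y.card := by
      rw [← Finset.sum_add_distrib, ← smul_eq_mul]
      refine Finset.sum_le_card_nsmul _ _ _ fun y _ => ?_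
      rw [← Finset.card_union_of_disjoint]
      · exact Finset.card_le_card (Finset.union_subset (Finset.filter_subset _ _)
          (Finset.filter_subset _ _))
      · rw [Finset.disjoint_filter]
        intro x _ hx hx'
        rw [hM] at hx'
        linarith
    omega
  have hle := Finset.card_le_card hY
  have h3 : Y.card * (16 * Y.card) ≤ Y.card * A.card +
      16 * ∑ y ∈ Y, (Y.filter (0 < M y ·)).card := by
    have : ∑ y ∈ Y, 16 * Y.card ≤ ∑ y ∈ Y, (A.card + 16 * (Y.filter (0 < M y ·)).card) := by
      refine Finset.sum_le_sum fun y hy => ?_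
      have := h y hy
      have := h1 y hy
      omega
    rw [Finset.sum_add_distrib, ← Finset.mul_sum, Finset.sum_const, Finset.sum_const,
      smul_eq_mul, smul_eq_mul, ← Finset.mul_sum] at this
    linarith
  have hpos := hne.card_pos
  have h4 : Y.card * (8 * Y.card) ≤ Y.card * A.card := by nlinarith
  exact Nat.le_of_mul_le_mul_left h4 hpos

theorem sum_piFinset_update {k : ℕ} {X : Type*} [DecidableEq X] (A : Fin k → Finset X) (i : Fin k)
    (F : (Fin k → X) → ℕ) :
    ∑ p ∈ Fintype.piFinset A, ∑ y ∈ A i, F (Function.update p i y) =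
      (A i).card * ∑ p ∈ Fintype.piFinset A, F p := by
  rw [← smul_eq_mul, ← Finset.sum_const, Finset.sum_comm, ← Finset.sum_product',
    ← Finset.sum_product']
  refine Finset.sum_nbij' (fun z => (z.2 i, Function.update z.2 i z.1))
    (fun z => (z.2 i, Function.update z.2 i z.1)) ?_ ?_ ?_ ?_ ?_
  · rintro ⟨y, p⟩ h
    simp only [Finset.mem_product, Fintype.mem_piFinset] at h ⊢
    refine ⟨h.2 i, fun a => ?_⟩
    by_cases ha : a = i
    · subst ha; simpa using h.1
    · simpa [ha] using h.2 a
  · rintro ⟨y, p⟩ h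
    simp only [Finset.mem_product, Fintype.mem_piFinset] at h ⊢
    refine ⟨h.2 i, fun a => ?_⟩
    by_cases ha : a = i
    · subst ha; simpa using h.1
    · simpa [ha] using h.2 a
  · rintro ⟨y, p⟩ h; simp
  · rintro ⟨y, p⟩ h; simp
  · rintro ⟨y, p⟩ h; simp

/-- The determinant of the vectors attached to a point and to a tuple of points. -/
def tupleDet {k : ℕ} {X : Type*} (e : X → Fin (k + 1) → ℝ) (p : Fin k → X) (x : X) : ℝ :=
  Matrix.det (Matrix.of (Fin.cons (e x) (fun i => e (p i)) : Fin (k + 1) → Fin (k + 1) → ℝ))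

theorem tupleDet_update {k : ℕ} {X : Type*} (e : X → Fin (k + 1) → ℝ) (p : Fin k → X) (i : Fin k)
    (x y : X) :
    tupleDet e (Function.update p i y) x = -tupleDet e (Function.update p i x) y := by
  have h := (Matrix.detRowAlternating (R := ℝ) (n := Fin (k + 1))).map_swap
    (Fin.cons (e x) (fun i' => e (Function.update p i y i'))) (i := 0) (j := i.succ)
    (Fin.succ_ne_zero i).symm
  have h' : (Fin.cons (e x) (fun i' => e (Function.update p i y i')) : Fin (k + 1) → Fin (k + 1) → ℝ)
      ∘ Equiv.swap 0 i.succ = Fin.cons (e y) (fun i' => e (Function.update p i x i')) := by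
    funext a
    refine Fin.cases ?_ (fun b => ?_) a
    · simp
    · by_cases hb : b = i
      · subst hb; simp
      · have : (b.succ : Fin (k + 1)) ≠ i.succ := fun h => hb (Fin.succ_injective _ h)
        simp [Equiv.swap_apply_of_ne_of_ne (Fin.succ_ne_zero b) this, hb]
  rw [h'] at h
  unfold tupleDet
  have h2 : ∀ v : Fin (k + 1) → Fin (k + 1) → ℝ,
      Matrix.detRowAlternating v = Matrix.det (Matrix.of v) := fun v => rfl
  rw [h2, h2] at h
  rw [h, neg_neg]

theorem tupleDet_eq_sum {k : ℕ} {X : Type*} (e : X → Fin (k + 1) → ℝ) (p : Fin k → X) (x : X) :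
    tupleDet e p x = ∑ j : Fin (k + 1), ((-1) ^ (j : ℕ) *
      Matrix.det (Matrix.of fun i j' : Fin k => e (p i) (j.succAbove j'))) * e x j := by
  unfold tupleDet
  rw [Matrix.det_succ_row_zero]
  refine Finset.sum_congr rfl fun j _ => ?_
  have : (Matrix.of (Fin.cons (e x) (fun i => e (p i)) : Fin (k + 1) → Fin (k + 1) → ℝ)).submatrix
      Fin.succ j.succAbove = Matrix.of fun i j' : Fin k => e (p i) (j.succAbove j') := by
    ext a b; simp
  rw [this]
  simp
  ring

/-- A function is unbalanced on a finite set if it has the same strict sign on more than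
fifteen sixteenths of it. -/
def Unbalanced {X : Type*} (A : Finset X) (f : X → ℝ) : Prop :=
  15 * A.card < 16 * (A.filter (0 < f ·)).card ∨ 15 * A.card < 16 * (A.filter (f · < 0)).card

open Classical in
theorem card_unbalanced_update_le {k : ℕ} {X : Type*} (e : X → Fin (k + 1) → ℝ)
    (A : Fin k → Finset X) (p : Fin k → X) (i : Fin k) :
    4 * ((A i).filter fun y => Unbalanced (A i) (tupleDet e (Function.update p i y))).card ≤
      (A i).card := by
  set M : X → X → ℝ := fun y x => tupleDet e (Function.update p i y) x with hM
  have hanti : ∀ x y, M x y = -M y x := fun x y => tupleDet_update e p i y x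
  have h1 := card_le_of_antisymm (A i)
    ((A i).filter fun y => 15 * (A i).card < 16 * ((A i).filter (0 < M y ·)).card)
    (Finset.filter_subset _ _) M hanti fun y hy => (Finset.mem_filter.1 hy).2
  have h2 := card_le_of_antisymm (A i)
    ((A i).filter fun y => 15 * (A i).card < 16 * ((A i).filter (M y · < 0)).card)
    (Finset.filter_subset _ _) (fun x y => -M x y) (fun x y => by rw [hanti x y])
    fun y hy => by simpa using (Finset.mem_filter.1 hy).2
  have h3 : ((A i).filter fun y => Unbalanced (A i) (tupleDet e (Function.update p i y))).card ≤
      ((A i).filter fun y => 15 * (A i).card < 16 * ((A i).filter (0 < M y ·)).card).card +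
      ((A i).filter fun y => 15 * (A i).card < 16 * ((A i).filter (M y · < 0)).card).card := by
    refine le_trans (Finset.card_le_card ?_) (Finset.card_union_le _ _)
    intro y hy
    rw [Finset.mem_filter] at hy
    rw [Finset.mem_union, Finset.mem_filter, Finset.mem_filter]
    exact hy.2.imp (fun h => ⟨hy.1, h⟩) (fun h => ⟨hy.1, h⟩)
  omega

open Classical in
theorem exists_tuple_balanced {k : ℕ} {X : Type*} (e : X → Fin (k + 1) → ℝ)
    (A : Fin k → Finset X) (hA : ∀ i, (A i).Nonempty) (ω : Fin k → ℕ) :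
    ∃ p : Fin k → X, (∀ i, p i ∈ A i) ∧
      4 * ∑ i with Unbalanced (A i) (tupleDet e p), ω i ≤ ∑ i, ω i := by
  have hcard : ∀ i, 4 * ∑ p ∈ Fintype.piFinset A,
      (if Unbalanced (A i) (tupleDet e p) then 1 else 0) ≤ ∑ p ∈ Fintype.piFinset A, 1 := by
    intro i
    have h1 := sum_piFinset_update A i fun p => if Unbalanced (A i) (tupleDet e p) then 1 else 0
    have h2 : ∑ p ∈ Fintype.piFinset A, 4 * ∑ y ∈ A i,
        (if Unbalanced (A i) (tupleDet e (Function.update p i y)) then 1 else 0) ≤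
        ∑ p ∈ Fintype.piFinset A, (A i).card * 1 := by
      refine Finset.sum_le_sum fun p _ => ?_
      rw [← Finset.card_filter, mul_one]
      exact card_unbalanced_update_le e A p i
    rw [← Finset.mul_sum, h1, ← Finset.mul_sum] at h2
    refine Nat.le_of_mul_le_mul_left ?_ (hA i).card_pos
    linarith
  have hne : (Fintype.piFinset A).Nonempty := by
    choose a ha using hA
    exact ⟨a, Fintype.mem_piFinset.2 ha⟩
  by_contra! hcon
  have h3 : ∑ p ∈ Fintype.piFinset A, ∑ i, ω i < ∑ p ∈ Fintype.piFinset A,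
      4 * ∑ i with Unbalanced (A i) (tupleDet e p), ω i :=
    Finset.sum_lt_sum_of_nonempty hne fun p hp => hcon p (Fintype.mem_piFinset.1 hp)
  have h4 : ∑ p ∈ Fintype.piFinset A, 4 * ∑ i with Unbalanced (A i) (tupleDet e p), ω i ≤
      ∑ p ∈ Fintype.piFinset A, ∑ i, ω i := by
    simp only [Finset.sum_filter]
    rw [← Finset.mul_sum, Finset.sum_comm, Finset.sum_comm (s := Fintype.piFinset A),
      Finset.mul_sum]
    refine Finset.sum_le_sum fun i _ => ?_
    have := Nat.mul_le_mul_left (ω i) (hcard i)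
    rw [Finset.mul_sum, Finset.mul_sum, Finset.mul_sum] at this
    rw [Finset.mul_sum]
    refine le_of_eq_of_le (Finset.sum_congr rfl fun p _ => ?_) (this.trans (le_of_eq
      (Finset.sum_congr rfl fun p _ => mul_one _)))
    split_ifs <;> ring
  omega

open Classical in
theorem exists_balanced_of_det_ne_zero {k : ℕ} {X : Type*} (e : X → Fin (k + 1) → ℝ)
    (A : Fin k → Finset X) (hA : ∀ i, (A i).Nonempty) (ω : Fin k → ℕ)
    (hdet : ∀ p : Fin k → X, (∀ i, p i ∈ A i) →
      Matrix.det (Matrix.of fun i j : Fin k => e (p i) j.succ) ≠ 0) :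
    ∃ c : Fin (k + 1) → ℝ, c ≠ 0 ∧
      4 * ∑ i with Unbalanced (A i) (fun x => ∑ j, c j * e x j), ω i ≤ ∑ i, ω i := by
  obtain ⟨p, hp, hω⟩ := exists_tuple_balanced e A hA ω
  have h := funext (tupleDet_eq_sum e p)
  refine ⟨fun j => (-1) ^ (j : ℕ) *
      Matrix.det (Matrix.of fun i j' : Fin k => e (p i) (j.succAbove j')), ?_, ?_⟩
  · intro h0
    have := congrFun h0 0
    simp at this
    exact hdet p hp this
  · rw [← h]
    exact hω

theorem finite_setOf_det_add_smul_eq_zero {k : ℕ} (V B : Matrix (Fin k) (Fin k) ℝ)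
    (hV : V.det ≠ 0) : {s : ℝ | (s • V + B).det = 0}.Finite := by
  classical
  set q : Polynomial ℝ := Matrix.det ((Polynomial.X : Polynomial ℝ) • V.map Polynomial.C +
    B.map Polynomial.C) with hq
  have hq0 : q ≠ 0 := by
    intro h
    have := Polynomial.coeff_det_X_add_C_card V B
    rw [← hq, h] at this
    exact hV (by simpa using this.symm)
  refine (q.roots.toFinset.finite_toSet).subset fun s hs => ?_
  have hs : (s • V + B).det = 0 := hs
  simp only [Finset.mem_coe, Multiset.mem_toFinset, Polynomial.mem_roots hq0, Polynomial.IsRoot]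
  rw [← hs, hq, ← Polynomial.coe_evalRingHom, RingHom.map_det]
  congr 1
  ext i j
  simp
  exact mul_comm _ _

theorem unbalanced_smul {X : Type*} {A : Finset X} {f : X → ℝ} {r : ℝ} (hr : 0 < r)
    (h : Unbalanced A f) : Unbalanced A (fun x => r * f x) := by
  unfold Unbalanced at *
  simpa [mul_pos_iff_of_pos_left hr, mul_neg_iff, hr, hr.not_gt] using h

theorem eventually_unbalanced {X : Type*} {A : Finset X} {f : ℕ → X → ℝ} {g : X → ℝ}
    (hf : ∀ x, Filter.Tendsto (fun n => f n x) Filter.atTop (nhds (g x))) (h : Unbalanced A g) :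
    ∀ᶠ n in Filter.atTop, Unbalanced A (f n) := by
  rcases h with h | h
  · have : ∀ᶠ n in Filter.atTop, ∀ x ∈ A, 0 < g x → 0 < f n x := by
      rw [Filter.eventually_all_finset]
      intro x _
      by_cases hx : 0 < g x
      · filter_upwards [(hf x).eventually (lt_mem_nhds hx)] with n hn _ using hn
      · simp [hx]
    filter_upwards [this] with n hn
    left
    refine h.trans_le (Nat.mul_le_mul_left _ (Finset.card_le_card fun x hx => ?_))
    rw [Finset.mem_filter] at hx ⊢
    exact ⟨hx.1, hn x hx.1 hx.2⟩
  · have : ∀ᶠ n in Filter.atTop, ∀ x ∈ A, g x < 0 → f n x < 0 := by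
      rw [Filter.eventually_all_finset]
      intro x _
      by_cases hx : g x < 0
      · filter_upwards [(hf x).eventually (gt_mem_nhds hx)] with n hn _ using hn
      · simp [hx]
    filter_upwards [this] with n hn
    right
    refine h.trans_le (Nat.mul_le_mul_left _ (Finset.card_le_card fun x hx => ?_))
    rw [Finset.mem_filter] at hx ⊢
    exact ⟨hx.1, hn x hx.1 hx.2⟩

open Classical in
/-- Approximate ham sandwich theorem for several finite sets. -/
theorem exists_balanced {k : ℕ} {X : Type*} (e : X → Fin (k + 1) → ℝ) (τ : X → ℝ)
    (hτ : Function.Injective τ) (A : Fin k → Finset X) (hA : ∀ i, (A i).Nonempty)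
    (hd : ∀ i j, i ≠ j → Disjoint (A i) (A j)) (ω : Fin k → ℕ) :
    ∃ c : Fin (k + 1) → ℝ, c ≠ 0 ∧
      4 * ∑ i with Unbalanced (A i) (fun x => ∑ j, c j * e x j), ω i ≤ ∑ i, ω i := by
  set v : X → Fin (k + 1) → ℝ := fun x => Fin.cons 0 fun j : Fin k => τ x ^ (j : ℕ) with hv
  have hbad : (⋃ p ∈ Fintype.piFinset A, {s : ℝ | (s • Matrix.vandermonde (fun i => τ (p i)) +
      Matrix.of fun i j : Fin k => e (p i) j.succ).det = 0}).Finite := by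
    refine Set.Finite.biUnion (Finset.finite_toSet _) fun p hp => ?_
    refine finite_setOf_det_add_smul_eq_zero _ _ (Matrix.det_vandermonde_ne_zero_iff.2 ?_)
    intro i j hij
    by_contra hne
    have hp := Fintype.mem_piFinset.1 hp
    have := hτ hij
    exact Finset.disjoint_left.1 (hd i j hne) (hp i) (this ▸ hp j)
  have hs : ∀ n : ℕ, ∃ s : ℝ, s ∈ Set.Ioo (0 : ℝ) (1 / (n + 1)) ∧ ∀ p : Fin k → X,
      (∀ i, p i ∈ A i) → (s • Matrix.vandermonde (fun i => τ (p i)) +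
      Matrix.of fun i j : Fin k => e (p i) j.succ).det ≠ 0 := by
    intro n
    have hpos : (0 : ℝ) < 1 / (n + 1) := by positivity
    obtain ⟨s, hs, hs'⟩ := ((Set.Ioo_infinite hpos).sdiff hbad).nonempty
    refine ⟨s, hs, fun p hp h0 => hs' ?_⟩
    simp only [Set.mem_iUnion]
    exact ⟨p, Fintype.mem_piFinset.2 hp, h0⟩
  choose s hs hs' using hs
  have hs0 : Filter.Tendsto s Filter.atTop (nhds 0) :=
    squeeze_zero (fun n => (hs n).1.le) (fun n => (hs n).2.le)
      tendsto_one_div_add_atTop_nhds_zero_nat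
  have hc : ∀ n, ∃ c : Fin (k + 1) → ℝ, c ∈ Metric.sphere (0 : Fin (k + 1) → ℝ) 1 ∧
      4 * ∑ i with Unbalanced (A i) (fun x => ∑ j, c j * (e x j + s n * v x j)), ω i ≤
        ∑ i, ω i := by
    intro n
    obtain ⟨c, hc0, hc⟩ := exists_balanced_of_det_ne_zero (fun x j => e x j + s n * v x j) A hA ω
      (fun p hp => by
        convert hs' n p hp using 2
        ext i j
        simp [hv, Matrix.vandermonde_apply, add_comm])
    have hpos : 0 < ‖c‖ := norm_pos_iff.2 hc0
    refine ⟨‖c‖⁻¹ • c, by simp [norm_smul, hpos.ne'], le_trans ?_ hc⟩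
    refine Nat.mul_le_mul_left _ (Finset.sum_le_sum_of_subset fun i hi => ?_)
    simp only [Finset.mem_filter, Finset.mem_univ, true_and] at hi ⊢
    convert unbalanced_smul hpos hi using 2 with x
    rw [Finset.mul_sum]
    refine Finset.sum_congr rfl fun j _ => ?_
    simp only [Pi.smul_apply, smul_eq_mul]
    field_simp
  choose c hc hc' using hc
  obtain ⟨c₀, hc₀, θ, hθ, hlim⟩ := (isCompact_sphere (0 : Fin (k + 1) → ℝ) 1).tendsto_subseq hc
  refine ⟨c₀, fun h => by simp [h] at hc₀, ?_⟩
  have hev : ∀ᶠ n in Filter.atTop, ∀ i, Unbalanced (A i) (fun x => ∑ j, c₀ j * e x j) →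
      Unbalanced (A i) (fun x => ∑ j, c (θ n) j * (e x j + s (θ n) * v x j)) := by
    rw [Filter.eventually_all]
    intro i
    by_cases hi : Unbalanced (A i) (fun x => ∑ j, c₀ j * e x j)
    · have := eventually_unbalanced
        (f := fun n x => ∑ j, c (θ n) j * (e x j + s (θ n) * v x j)) (fun x => ?_) hi
      · filter_upwards [this] with n hn _ using hn
      · refine tendsto_finsetSum _ fun j _ => ?_
        have h1 : Filter.Tendsto (fun n => c (θ n) j) Filter.atTop (nhds (c₀ j)) :=
          (tendsto_pi_nhds.1 hlim) j
        have h2 := (hs0.comp hθ.tendsto_atTop).mul_const (v x j)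
        have h3 := h1.mul (h2.const_add (e x j))
        simpa using h3
    · simp [hi]
  obtain ⟨n, hn⟩ := hev.exists
  refine le_trans (Nat.mul_le_mul_left _ (Finset.sum_le_sum_of_subset fun i hi => ?_)) (hc' (θ n))
  simp only [Finset.mem_filter, Finset.mem_univ, true_and] at hi ⊢
  exact hn i hi

/-- The list of signs of a list of polynomials at a point. -/
def signLabel (fs : List (MvPolynomial (Fin 3) ℝ)) (x : Fin 3 → ℝ) : List SignType :=
  fs.map fun f => SignType.sign (eval x f)

/-- The points with a given sign label. -/
def signClass (Q : Finset (Fin 3 → ℝ)) (fs : List (MvPolynomial (Fin 3) ℝ)) (l : List SignType) :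
    Finset (Fin 3 → ℝ) :=
  Q.filter (signLabel fs · = l)

theorem mem_signClass {Q : Finset (Fin 3 → ℝ)} {fs : List (MvPolynomial (Fin 3) ℝ)}
    {l : List SignType} {x : Fin 3 → ℝ} :
    x ∈ signClass Q fs l ↔ x ∈ Q ∧ signLabel fs x = l :=
  Finset.mem_filter

/-- The labels without zeros carried by more than the fraction `1 / t` of all points. -/
def bigLabels (Q : Finset (Fin 3 → ℝ)) (t : ℕ) (fs : List (MvPolynomial (Fin 3) ℝ)) :
    Finset (List SignType) :=
  (Q.image (signLabel fs)).filter fun l => 0 ∉ l ∧ Q.card < t * (signClass Q fs l).card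

theorem disjoint_signClass {Q : Finset (Fin 3 → ℝ)} {fs : List (MvPolynomial (Fin 3) ℝ)}
    {l l' : List SignType} (h : l ≠ l') : Disjoint (signClass Q fs l) (signClass Q fs l') := by
  rw [Finset.disjoint_left]
  intro x hx hx'
  exact h ((Finset.mem_filter.1 hx).2.symm.trans (Finset.mem_filter.1 hx').2)

theorem sum_card_signClass (Q : Finset (Fin 3 → ℝ)) (t : ℕ)
    (fs : List (MvPolynomial (Fin 3) ℝ)) :
    ∑ l ∈ bigLabels Q t fs, (signClass Q fs l).card ≤ Q.card := by
  rw [Finset.card_eq_sum_card_image (signLabel fs) Q]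
  exact Finset.sum_le_sum_of_subset (Finset.filter_subset _ _)

theorem card_bigLabels_le (Q : Finset (Fin 3 → ℝ)) (t : ℕ)
    (fs : List (MvPolynomial (Fin 3) ℝ)) : (bigLabels Q t fs).card ≤ t := by
  rcases Q.eq_empty_or_nonempty with rfl | hne
  · simp [bigLabels]
  have h1 : (bigLabels Q t fs).card * Q.card ≤
      ∑ l ∈ bigLabels Q t fs, t * (signClass Q fs l).card := by
    rw [← smul_eq_mul]
    exact Finset.card_nsmul_le_sum _ _ _ fun l hl => (Finset.mem_filter.1 hl).2.2.le
  rw [← Finset.mul_sum] at h1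
  have h2 := Nat.mul_le_mul_left t (sum_card_signClass Q t fs)
  exact Nat.le_of_mul_le_mul_right (h1.trans h2) hne.card_pos

theorem signClass_cons_one (Q : Finset (Fin 3 → ℝ)) (f : MvPolynomial (Fin 3) ℝ)
    (fs : List (MvPolynomial (Fin 3) ℝ)) (l : List SignType) :
    signClass Q (f :: fs) (1 :: l) = (signClass Q fs l).filter (0 < eval · f) := by
  ext x
  simp only [mem_signClass, Finset.mem_filter, signLabel, List.map_cons, List.cons.injEq,
    sign_eq_one_iff]
  tauto

theorem signClass_cons_neg_one (Q : Finset (Fin 3 → ℝ)) (f : MvPolynomial (Fin 3) ℝ)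
    (fs : List (MvPolynomial (Fin 3) ℝ)) (l : List SignType) :
    signClass Q (f :: fs) (-1 :: l) = (signClass Q fs l).filter (eval · f < 0) := by
  ext x
  simp only [mem_signClass, Finset.mem_filter, signLabel, List.map_cons, List.cons.injEq,
    sign_eq_neg_one_iff]
  tauto

/-- The sum of the squares of the sizes of the large classes. -/
def energy (Q : Finset (Fin 3 → ℝ)) (t : ℕ) (fs : List (MvPolynomial (Fin 3) ℝ)) : ℕ :=
  ∑ l ∈ bigLabels Q t fs, (signClass Q fs l).card ^ 2

theorem energy_cons_le_sum (Q : Finset (Fin 3 → ℝ)) (t : ℕ) (f : MvPolynomial (Fin 3) ℝ)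
    (fs : List (MvPolynomial (Fin 3) ℝ)) :
    energy Q t (f :: fs) ≤ ∑ l ∈ bigLabels Q t fs, ((signClass Q (f :: fs) (1 :: l)).card ^ 2 +
      (signClass Q (f :: fs) (-1 :: l)).card ^ 2) := by
  classical
  have hsub : bigLabels Q t (f :: fs) ⊆
      (bigLabels Q t fs).image (List.cons 1) ∪ (bigLabels Q t fs).image (List.cons (-1)) := by
    intro l hl
    simp only [bigLabels, Finset.mem_filter, Finset.mem_image] at hl
    obtain ⟨⟨x, hx, rfl⟩, h0, hbig⟩ := hl
    have hmono : (signClass Q (f :: fs) (signLabel (f :: fs) x)).card ≤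
        (signClass Q fs (signLabel fs x)).card := by
      refine Finset.card_le_card fun y hy => ?_
      simp only [mem_signClass, signLabel, List.map_cons, List.cons.injEq] at hy ⊢
      exact ⟨hy.1, hy.2.2⟩
    have hmem : signLabel fs x ∈ bigLabels Q t fs := by
      simp only [bigLabels, Finset.mem_filter, Finset.mem_image]
      refine ⟨⟨x, hx, rfl⟩, fun h => h0 ?_, hbig.trans_le (Nat.mul_le_mul_left _ hmono)⟩
      exact List.mem_cons_of_mem _ h
    have hs : SignType.sign (eval x f) ≠ 0 := fun h => h0 (by simp [signLabel, h])
    rw [Finset.mem_union, Finset.mem_image, Finset.mem_image]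
    rcases SignType.trichotomy (SignType.sign (eval x f)) with h | h | h
    · exact Or.inr ⟨_, hmem, by simp [signLabel, h]⟩
    · exact absurd h hs
    · exact Or.inl ⟨_, hmem, by simp [signLabel, h]⟩
  refine (Finset.sum_le_sum_of_subset hsub).trans ?_
  rw [Finset.sum_add_distrib]
  have h := Finset.sum_union_inter (s₁ := (bigLabels Q t fs).image (List.cons 1))
    (s₂ := (bigLabels Q t fs).image (List.cons (-1)))
    (f := fun l => (signClass Q (f :: fs) l).card ^ 2)
  rw [Finset.sum_image fun _ _ _ _ h => (List.cons.inj h).2,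
    Finset.sum_image fun _ _ _ _ h => (List.cons.inj h).2] at h
  omega

theorem exists_energy_cons_le (Q : Finset (Fin 3 → ℝ)) {t : ℕ}
    (w : Fin (t + 1) → MvPolynomial (Fin 3) ℝ) (hw : LinearIndependent ℝ w)
    (fs : List (MvPolynomial (Fin 3) ℝ)) :
    ∃ f ∈ Submodule.span ℝ (Set.range w), f ≠ 0 ∧ 64 * energy Q t (f :: fs) ≤ 61 * energy Q t fs := by
  classical
  set b := bigLabels Q t fs with hb
  have hk : b.card + 1 ≤ t + 1 := Nat.succ_le_succ (card_bigLabels_le Q t fs)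
  obtain ⟨τ, hτ⟩ : ∃ τ : (Fin 3 → ℝ) → ℝ, Function.Injective τ := by
    have : Cardinal.mk (Fin 3 → ℝ) = Cardinal.mk ℝ := by
      simp only [Cardinal.mk_pi, Cardinal.prod_const, Cardinal.mk_fintype, Fintype.card_fin,
        Cardinal.lift_id, Cardinal.power_natCast]
      exact Cardinal.power_nat_eq (Cardinal.aleph0_le_mk ℝ) (by norm_num)
    obtain ⟨e⟩ := Cardinal.eq.1 this
    exact ⟨e, e.injective⟩
  set en := b.equivFin.symm with hen
  obtain ⟨c, hc0, hc⟩ := exists_balanced (k := b.card)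
    (fun x j => eval x (w (Fin.castLE hk j))) τ hτ (fun i => signClass Q fs (en i))
    (fun i => by
      have := (Finset.mem_filter.1 (en i).2).1
      obtain ⟨x, hx, hx'⟩ := Finset.mem_image.1 this
      exact ⟨x, Finset.mem_filter.2 ⟨hx, hx'⟩⟩)
    (fun i j hij => disjoint_signClass fun h => hij (en.injective (Subtype.ext h)))
    (fun i => (signClass Q fs (en i)).card ^ 2)
  set f := ∑ j, c j • w (Fin.castLE hk j) with hf
  have hfe : ∀ x, ∑ j, c j * eval x (w (Fin.castLE hk j)) = eval x f := by
    intro x; simp [hf, map_sum, smul_eval]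
  simp only [hfe] at hc
  refine ⟨f, ?_, ?_, ?_⟩
  · exact Submodule.sum_mem _ fun j _ => Submodule.smul_mem _ _ (Submodule.subset_span ⟨_, rfl⟩)
  · intro h0
    have hli := hw.comp _ (Fin.castLE_injective hk)
    rw [Fintype.linearIndependent_iff] at hli
    exact hc0 (funext fun j => hli c (by simpa [hf] using h0) j)
  have hc' : 4 * ∑ l ∈ b with Unbalanced (signClass Q fs l) (eval · f),
      (signClass Q fs l).card ^ 2 ≤ ∑ l ∈ b, (signClass Q fs l).card ^ 2 := by
    have h1 : ∀ F : List SignType → ℕ, ∑ i, F (en i) = ∑ l ∈ b, F l := by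
      intro F
      rw [Equiv.sum_comp en fun l : b => F l, Finset.sum_coe_sort]
    rw [h1 fun l => (signClass Q fs l).card ^ 2, Finset.sum_filter,
      h1 fun l => if Unbalanced (signClass Q fs l) (eval · f) then
        (signClass Q fs l).card ^ 2 else 0] at hc
    rwa [Finset.sum_filter]
  have hcell : ∀ l ∈ b, 16 * ((signClass Q (f :: fs) (1 :: l)).card ^ 2 +
      (signClass Q (f :: fs) (-1 :: l)).card ^ 2) ≤ 15 * (signClass Q fs l).card ^ 2 +
      if Unbalanced (signClass Q fs l) (eval · f) then (signClass Q fs l).card ^ 2 else 0 := by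
    intro l _
    rw [signClass_cons_one, signClass_cons_neg_one]
    set A := signClass Q fs l
    have hsum : (A.filter (0 < eval · f)).card + (A.filter (eval · f < 0)).card ≤ A.card := by
      rw [← Finset.card_union_of_disjoint]
      · exact Finset.card_le_card (Finset.union_subset (Finset.filter_subset _ _)
          (Finset.filter_subset _ _))
      · rw [Finset.disjoint_filter]
        intro x _ hx hx'
        linarith
    generalize hp : (A.filter (0 < eval · f)).card = p at *
    generalize hq : (A.filter (eval · f < 0)).card = q at *
    split_ifs with hU
    · nlinarith
    · simp only [Unbalanced, not_or, not_lt] at hU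
      rw [hp, hq] at hU
      nlinarith [Nat.mul_le_mul_left p hU.1, Nat.mul_le_mul_left q hU.2]
  have h5 := Finset.sum_le_sum hcell
  rw [← Finset.mul_sum, Finset.sum_add_distrib (f := fun l => 15 * _), ← Finset.mul_sum,
    ← Finset.sum_filter] at h5
  have h6 := energy_cons_le_sum Q t f fs
  rw [← hb] at h6
  have h7 : energy Q t fs = ∑ l ∈ b, (signClass Q fs l).card ^ 2 := rfl
  omega

theorem exists_energy_le (Q : Finset (Fin 3 → ℝ)) {t : ℕ}
    (w : Fin (t + 1) → MvPolynomial (Fin 3) ℝ) (hw : LinearIndependent ℝ w) (M : ℕ) :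
    ∃ fs : List (MvPolynomial (Fin 3) ℝ), fs.length = M ∧
      (∀ f ∈ fs, f ∈ Submodule.span ℝ (Set.range w) ∧ f ≠ 0) ∧
      64 ^ M * energy Q t fs ≤ 61 ^ M * Q.card ^ 2 := by
  induction M with
  | zero =>
    refine ⟨[], rfl, by simp, ?_⟩
    rw [pow_zero, pow_zero, one_mul, one_mul]
    unfold energy
    calc ∑ l ∈ bigLabels Q t [], (signClass Q [] l).card ^ 2
        ≤ ∑ l ∈ bigLabels Q t [], Q.card * (signClass Q [] l).card := by
          refine Finset.sum_le_sum fun l _ => ?_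
          rw [sq]
          exact Nat.mul_le_mul_right _ (Finset.card_le_card (Finset.filter_subset _ _))
      _ ≤ Q.card ^ 2 := by
          rw [← Finset.mul_sum, sq]
          exact Nat.mul_le_mul_left _ (sum_card_signClass _ _ _)
  | succ M ih =>
    obtain ⟨fs, hlen, hfs, hE⟩ := ih
    obtain ⟨f, hf, hf0, hfE⟩ := exists_energy_cons_le Q w hw fs
    refine ⟨f :: fs, by simp [hlen], ?_, ?_⟩
    · intro g hg
      rcases List.mem_cons.1 hg with rfl | hg
      · exact ⟨hf, hf0⟩
      · exact hfs g hg
    · rw [pow_succ, pow_succ]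
      calc 64 ^ M * 64 * energy Q t (f :: fs) = 64 ^ M * (64 * energy Q t (f :: fs)) := by ring
        _ ≤ 64 ^ M * (61 * energy Q t fs) := Nat.mul_le_mul_left _ hfE
        _ = 61 * (64 ^ M * energy Q t fs) := by ring
        _ ≤ 61 * (61 ^ M * Q.card ^ 2) := Nat.mul_le_mul_left _ hE
        _ = _ := by ring

/-- Polynomial partitioning, by polynomials from a given linear space. -/
theorem exists_partition (Q : Finset (Fin 3 → ℝ)) {t : ℕ}
    (w : Fin (t + 1) → MvPolynomial (Fin 3) ℝ) (hw : LinearIndependent ℝ w) {M : ℕ}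
    (hM : 61 ^ M * t ^ 2 ≤ 64 ^ M) :
    ∃ fs : List (MvPolynomial (Fin 3) ℝ), fs.length = M ∧
      (∀ f ∈ fs, f ∈ Submodule.span ℝ (Set.range w) ∧ f ≠ 0) ∧
      ∀ l : List SignType, 0 ∉ l → t * (signClass Q fs l).card ≤ Q.card := by
  obtain ⟨fs, hlen, hfs, hE⟩ := exists_energy_le Q w hw M
  refine ⟨fs, hlen, hfs, fun l hl => ?_⟩
  by_contra! hbig
  have hmem : l ∈ bigLabels Q t fs := by
    refine Finset.mem_filter.2 ⟨?_, hl, hbig⟩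
    have : (signClass Q fs l).Nonempty := by
      rw [← Finset.card_pos]
      exact Nat.pos_of_mul_pos_left (Nat.zero_lt_of_lt hbig)
    obtain ⟨x, hx⟩ := this
    rw [mem_signClass] at hx
    exact Finset.mem_image.2 ⟨x, hx⟩
  have h1 : (signClass Q fs l).card ^ 2 ≤ energy Q t fs :=
    Finset.single_le_sum (f := fun l => (signClass Q fs l).card ^ 2)
      (fun _ _ => Nat.zero_le _) hmem
  have h2 : Q.card ^ 2 < t ^ 2 * (signClass Q fs l).card ^ 2 := by
    rw [← mul_pow]
    exact Nat.pow_lt_pow_left hbig two_ne_zero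
  have h3 : 64 ^ M * energy Q t fs < 64 ^ M * energy Q t fs := by
    calc 64 ^ M * energy Q t fs ≤ 61 ^ M * Q.card ^ 2 := hE
      _ < 61 ^ M * (t ^ 2 * (signClass Q fs l).card ^ 2) :=
          Nat.mul_lt_mul_of_pos_left h2 (by positivity)
      _ = 61 ^ M * t ^ 2 * (signClass Q fs l).card ^ 2 := by ring
      _ ≤ 64 ^ M * energy Q t fs := Nat.mul_le_mul hM h1
  exact lt_irrefl _ h3

theorem exists_card_eq_image_signLabel (Y : Finset (Fin 3 → ℝ))
    (fs : List (MvPolynomial (Fin 3) ℝ)) (h0 : ∀ y ∈ Y, ∀ f ∈ fs, eval y f ≠ 0) :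
    ∃ Z ⊆ Y, (Y.image (signLabel fs)).card = Z.card ∧
      ∀ y ∈ Z, ∀ y' ∈ Z, y ≠ y' → ∃ f ∈ fs, eval y f * eval y' f < 0 := by
  classical
  have hex : ∀ l ∈ Y.image (signLabel fs), ∃ y ∈ Y, signLabel fs y = l := fun l hl =>
    Finset.mem_image.1 hl
  choose! r hr hr' using hex
  refine ⟨(Y.image (signLabel fs)).image r, ?_, ?_, ?_⟩
  · intro y hy
    obtain ⟨l, hl, rfl⟩ := Finset.mem_image.1 hy
    exact hr l hl
  · rw [Finset.card_image_of_injOn (f := r)]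
    intro l hl l' hl' h
    rw [← hr' l hl, ← hr' l' hl', h]
  · intro y hy y' hy' hne
    obtain ⟨l, hl, rfl⟩ := Finset.mem_image.1 hy
    obtain ⟨l', hl', rfl⟩ := Finset.mem_image.1 hy'
    by_contra! hcon
    apply hne
    have : signLabel fs (r l) = signLabel fs (r l') := by
      unfold signLabel
      refine List.map_congr_left fun f hf => ?_
      have h1 := hcon f hf
      have h2 := h0 _ (hr l hl) f hf
      have h3 := h0 _ (hr l' hl') f hf
      rcases lt_or_gt_of_ne h2 with h2 | h2 <;> rcases lt_or_gt_of_ne h3 with h3 | h3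
      · rw [sign_neg h2, sign_neg h3]
      · nlinarith
      · nlinarith
      · rw [sign_pos h2, sign_pos h3]
    rw [hr' l hl, hr' l' hl'] at this
    rw [this]

open Classical in
theorem hinge_zeros_list_le {α K : ℝ} {P Q : Finset (Fin 3 → ℝ)}
    (fs : List (MvPolynomial (Fin 3) ℝ)) (hK : 0 ≤ K)
    (h : ∀ f ∈ fs, (hinge α P (Q.filter (eval · f = 0)) : ℝ) ≤ K) :
    (hinge α P (Q.filter fun x => ∃ f ∈ fs, eval x f = 0) : ℝ) ≤ 4 ^ fs.length * K := by
  induction fs with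
  | nil => simp [hinge, nb, hK]
  | cons f fs ih =>
    have h1 := ih fun g hg => h g (List.mem_cons_of_mem _ hg)
    have h2 := h f (List.mem_cons_self ..)
    have h3 : Q.filter (fun x => ∃ g ∈ f :: fs, eval x g = 0) =
        Q.filter (eval · f = 0) ∪ Q.filter (fun x => ∃ g ∈ fs, eval x g = 0) := by
      ext x
      simp only [Finset.mem_filter, Finset.mem_union, List.mem_cons, exists_eq_or_imp]
      tauto
    have h4 := hinge_union_le (α := α) P (Q.filter (eval · f = 0))
      (Q.filter (fun x => ∃ g ∈ fs, eval x g = 0))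
    rw [← h3] at h4
    have h5 : (hinge α P (Q.filter fun x => ∃ g ∈ f :: fs, eval x g = 0) : ℝ) ≤
        2 * hinge α P (Q.filter (eval · f = 0)) +
          2 * hinge α P (Q.filter (fun x => ∃ g ∈ fs, eval x g = 0)) := by exact_mod_cast h4
    have h6 : K ≤ 4 ^ fs.length * K := le_mul_of_one_le_left hK (one_le_pow₀ (by norm_num))
    rw [List.length_cons, pow_succ]
    linarith

open Classical in
theorem hinge_le_of_partition {α ε κ B : ℝ} {t M D : ℕ} (hε : 0 ≤ ε) (ht : 1 < t) (hκ : 0 ≤ κ)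
    (hB : 0 ≤ B) (h1 : 2 * κ * √κ * (t : ℝ) ^ (-(1 + ε)) ≤ 1 / 2) (h2 : 2 * κ / t ≤ 1 / 2)
    (hM : 61 ^ M * t ^ 2 ≤ 64 ^ M)
    (𝒬 : Finset (Fin 3 → ℝ) → Prop) (hereditary : ∀ Q Q', Q' ⊆ Q → 𝒬 Q → 𝒬 Q')
    (hyp : ∀ Q, 𝒬 Q → 2 < Q.card → ∃ w : Fin (t + 1) → MvPolynomial (Fin 3) ℝ,
      LinearIndependent ℝ w ∧
      (∀ f ∈ Submodule.span ℝ (Set.range w), f.totalDegree ≤ D ∧ (f ≠ 0 → ∀ P,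
        (hinge α P (Q.filter (eval · f = 0)) : ℝ) ≤ B * hingeBound ε P.card Q.card)) ∧
      ∀ P : Finset (Fin 3 → ℝ), ∃ P₀ ⊆ P, P₀.card ≤ 2 ∧ ∀ p ∈ P \ P₀, ∀ fs : List (MvPolynomial (Fin 3) ℝ),
        fs.length = M → (∀ f ∈ fs, f.totalDegree ≤ D) → ∀ Y ⊆ Q, (∀ y ∈ Y, OnSphere α p y) →
        (∀ y ∈ Y, ∀ f ∈ fs, eval y f ≠ 0) →
        (∀ y ∈ Y, ∀ y' ∈ Y, y ≠ y' → ∃ f ∈ fs, eval y f * eval y' f < 0) → (Y.card : ℝ) ≤ κ) :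
    ∃ A : ℝ, 0 ≤ A ∧ ∀ P Q, 𝒬 Q → (hinge α P Q : ℝ) ≤ A * hingeBound ε P.card Q.card := by
  have ht' : (1 : ℝ) < t := by exact_mod_cast ht
  refine hinge_recursion (ι := List SignType) (B := 4 ^ M * B + 4) hε ht' hκ (by positivity) h1 h2
    𝒬 hereditary fun P Q hQ => ?_
  rcases le_or_gt Q.card 2 with hQ2 | hQ2
  · refine ⟨signLabel [], Q, ∅, subset_rfl, Finset.empty_subset _, by simp, ?_, ?_, ?_⟩
    · intro i; simp; positivity
    · intro p _; simp [nb, hκ]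
    · have a1 := hinge_le_of_card_le (α := α) (Q := Q) (le_refl P.card)
      have a2 : hinge α P Q ≤ 4 * P.card := by
        have : Q.card ^ 2 ≤ 4 := by nlinarith
        nlinarith
      have a3 : (hinge α P Q : ℝ) ≤ 4 * P.card := by exact_mod_cast a2
      have a4 : (P.card : ℝ) ≤ hingeBound ε P.card Q.card := by
        unfold hingeBound
        have : (0 : ℝ) ≤ √(P.card * (Q.card : ℝ) ^ 3) * (Q.card : ℝ) ^ ε + (Q.card : ℝ) ^ 2 := by
          positivity
        linarith
      have a5 : 0 ≤ 4 ^ M * B * hingeBound ε P.card Q.card :=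
        mul_nonneg (by positivity) (hingeBound_nonneg _ _ _)
      linarith
  obtain ⟨w, hw, hz, hcount⟩ := hyp Q hQ hQ2
  obtain ⟨P₀, hP₀, hP₀c, hP₀'⟩ := hcount P
  obtain ⟨fs, hlen, hfs, hcl⟩ := exists_partition Q w hw hM
  have hstrict : ∀ x ∈ Q \ Q.filter (fun x => ∃ f ∈ fs, eval x f = 0),
      x ∈ Q ∧ ∀ f ∈ fs, eval x f ≠ 0 := by
    intro x hx
    simp only [Finset.mem_sdiff, Finset.mem_filter, not_and, not_exists] at hx
    exact ⟨hx.1, hx.2 hx.1⟩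
  refine ⟨signLabel fs, Q.filter fun x => ∃ f ∈ fs, eval x f = 0, P₀, Finset.filter_subset _ _,
    hP₀, hP₀c, ?_, ?_, ?_⟩
  · intro l
    rw [le_div_iff₀ (by linarith)]
    by_cases hl : 0 ∈ l
    · rw [Finset.filter_false_of_mem]
      · simp
      · rintro x hx rfl
        obtain ⟨f, hf, hf'⟩ := List.mem_map.1 hl
        exact (hstrict x hx).2 f hf (sign_eq_zero_iff.1 hf')
    · have a1 := hcl l hl
      have a2 : ((Q \ Q.filter (fun x => ∃ f ∈ fs, eval x f = 0)).filter
          (signLabel fs · = l)).card ≤ (signClass Q fs l).card := by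
        refine Finset.card_le_card fun x hx => ?_
        rw [Finset.mem_filter] at hx
        exact mem_signClass.2 ⟨(hstrict x hx.1).1, hx.2⟩
      rw [mul_comm]
      exact_mod_cast (Nat.mul_le_mul_left t a2).trans a1
  · intro p hp
    obtain ⟨Z, hZ, hZc, hZs⟩ := exists_card_eq_image_signLabel
      (nb α p (Q \ Q.filter (fun x => ∃ f ∈ fs, eval x f = 0))) fs
      fun y hy => (hstrict y (mem_nb.1 hy).1).2
    rw [hZc]
    exact hP₀' p hp fs hlen (fun f hf => (hz f (hfs f hf).1).1) Z
      (fun y hy => (hstrict y (mem_nb.1 (hZ hy)).1).1) (fun y hy => (mem_nb.1 (hZ hy)).2)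
      (fun y hy => (hstrict y (mem_nb.1 (hZ hy)).1).2) hZs
  · have a1 := hinge_zeros_list_le (α := α) (P := P) (Q := Q) fs
      (mul_nonneg hB (hingeBound_nonneg ε P.card Q.card))
      fun f hf => (hz f (hfs f hf).1).2 (hfs f hf).2 P
    rw [hlen] at a1
    have := hingeBound_nonneg ε P.card Q.card
    linarith

theorem eventually_mul_pow_mul_pow_le (C : ℝ) (k : ℕ) {r : ℝ} (hr0 : 0 ≤ r) (hr : r < 1) :
    ∀ᶠ j : ℕ in Filter.atTop, C * ((j : ℝ) ^ k * r ^ j) ≤ 1 / 2 := by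
  have h := (tendsto_pow_const_mul_const_pow_of_lt_one k hr0 hr).const_mul C
  rw [mul_zero] at h
  exact h.eventually (ge_mem_nhds (by norm_num))

theorem pow_mul_sq_le (j : ℕ) : 61 ^ (30 * j) * (2 ^ j) ^ 2 ≤ 64 ^ (30 * j) := by
  calc 61 ^ (30 * j) * (2 ^ j) ^ 2 = (61 ^ 30 * 4) ^ j := by
        rw [mul_pow, ← pow_mul, ← pow_mul, mul_comm j 2, pow_mul 2 2 j]; norm_num
    _ ≤ (64 ^ 30) ^ j := Nat.pow_le_pow_left (by norm_num) j
    _ = _ := by rw [← pow_mul]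

/-- Parameters for partitioning space. -/
theorem exists_params_space {ε : ℝ} (hε : 0 < ε) : ∃ (t M D : ℕ) (κ : ℝ), 1 < t ∧ 0 ≤ κ ∧
    2 * κ * √κ * (t : ℝ) ^ (-(1 + ε)) ≤ 1 / 2 ∧ 2 * κ / t ≤ 1 / 2 ∧ 61 ^ M * t ^ 2 ≤ 64 ^ M ∧
    t + 1 ≤ (D + 3).choose 3 ∧
    (((M * (2 * D) + 2) * (M * (2 * D) + 2) + 1 : ℕ) : ℝ) ≤ κ := by
  have hr : (2 : ℝ) ^ (-(3 * ε)) < 1 := Real.rpow_lt_one_of_one_lt_of_neg (by norm_num) (by linarith)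
  obtain ⟨j, hj1, hj2, hj⟩ := ((eventually_mul_pow_mul_pow_le (2 * 400 ^ 3) 3 (by positivity) hr).and
    ((eventually_mul_pow_mul_pow_le (2 * 400 ^ 2) 2 (r := 1 / 2) (by norm_num) (by norm_num)).and
    (Filter.eventually_ge_atTop 1))).exists
  have hj' : (1 : ℝ) ≤ j := by exact_mod_cast hj
  have h2j : (1 : ℝ) ≤ 2 ^ j := one_le_pow₀ (by norm_num)
  refine ⟨2 ^ (3 * j), 30 * (3 * j), 2 ^ (j + 1), (400 * j * 2 ^ j) ^ 2, ?_, by positivity, ?_, ?_,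
    pow_mul_sq_le _, ?_, ?_⟩
  · exact Nat.one_lt_two_pow (by omega)
  · rw [Real.sqrt_sq (by positivity)]
    refine le_trans (le_of_eq ?_) hj1
    have : (((2 ^ (3 * j) : ℕ) : ℝ)) ^ (-(1 + ε)) =
        ((2 : ℝ) ^ (3 * j))⁻¹ * ((2 : ℝ) ^ (-(3 * ε))) ^ j := by
      push_cast
      rw [neg_add, Real.rpow_add (by positivity), Real.rpow_neg_one]
      congr 1
      rw [← Real.rpow_natCast, ← Real.rpow_natCast, ← Real.rpow_mul (by norm_num),
        ← Real.rpow_mul (by norm_num)]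
      congr 1
      push_cast
      ring
    rw [this, pow_mul']
    field_simp
  · refine le_trans (le_of_eq ?_) hj2
    push_cast
    rw [pow_mul', one_div, inv_pow]
    field_simp
  · have e : (2 ^ (j + 1) + 3).choose 3 * 6 =
        (2 ^ (j + 1) + 3) * (2 ^ (j + 1) + 2) * (2 ^ (j + 1) + 1) := by
      have := Nat.descFactorial_eq_factorial_mul_choose (2 ^ (j + 1) + 3) 3
      simp [Nat.descFactorial, Nat.factorial] at this
      linarith
    have e2 : 2 ^ (3 * j) = (2 ^ j) ^ 3 := by rw [← pow_mul, mul_comm]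
    have e3 : 2 ^ (j + 1) = 2 * 2 ^ j := by ring
    rw [e3] at e ⊢
    rw [e2]
    nlinarith [Nat.zero_le ((2 ^ j) ^ 3), Nat.zero_le ((2 ^ j) ^ 2)]
  · push_cast
    have : (30 * (3 * (j : ℝ)) * (2 * 2 ^ (j + 1)) + 2) ≤ 362 * j * 2 ^ j := by
      rw [pow_succ]; nlinarith
    have h0 : (0 : ℝ) ≤ 30 * (3 * (j : ℝ)) * (2 * 2 ^ (j + 1)) + 2 := by positivity
    have h1 : (1 : ℝ) ≤ j * 2 ^ j := by nlinarith
    nlinarith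

/-- Parameters for partitioning surfaces of bounded degree. -/
theorem exists_params_surface {ε : ℝ} (hε : 0 ≤ ε) (d : ℕ) :
    ∃ (t M D : ℕ) (κ : ℝ), d ≤ D ∧ 1 < t ∧ 0 ≤ κ ∧
    2 * κ * √κ * (t : ℝ) ^ (-(1 + ε)) ≤ 1 / 2 ∧ 2 * κ / t ≤ 1 / 2 ∧ 61 ^ M * t ^ 2 ≤ 64 ^ M ∧
    t + 1 ≤ (D + 2).choose 2 ∧
    (((2 * (2 * d)) * (2 * (2 * d) + (M * (2 * D) + 2)) + 1 : ℕ) : ℝ) ≤ κ := by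
  set K : ℝ := 4 * d * (4 * d + 242) + 1 with hK
  have hK0 : 0 ≤ K := by positivity
  have hr : √2 / 2 < 1 := by
    have : √2 < 2 := by rw [Real.sqrt_lt' (by norm_num)]; norm_num
    linarith
  obtain ⟨j, hj1, hj2, hj, hjd⟩ := ((eventually_mul_pow_mul_pow_le (2 * (K * √K)) 2
    (by positivity) hr).and
    ((eventually_mul_pow_mul_pow_le (2 * K) 1 (r := 1 / 2) (by norm_num) (by norm_num)).and
    ((Filter.eventually_ge_atTop 1).and (Filter.eventually_ge_atTop d)))).exists
  have hj' : (1 : ℝ) ≤ j := by exact_mod_cast hj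
  have h2j : (1 : ℝ) ≤ 2 ^ j := one_le_pow₀ (by norm_num)
  refine ⟨2 ^ (2 * j), 30 * (2 * j), 2 ^ (j + 1), K * (j * 2 ^ j), ?_, ?_, by positivity, ?_, ?_,
    pow_mul_sq_le _, ?_, ?_⟩
  · calc d ≤ j := hjd
      _ ≤ j + 1 := Nat.le_succ _
      _ ≤ _ := Nat.lt_two_pow_self.le
  · exact Nat.one_lt_two_pow (by omega)
  · have h1 : (((2 ^ (2 * j) : ℕ) : ℝ)) ^ (-(1 + ε)) ≤ ((2 : ℝ) ^ (2 * j))⁻¹ := by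
      push_cast
      rw [← Real.rpow_neg_one]
      exact Real.rpow_le_rpow_of_exponent_le (one_le_pow₀ (by norm_num)) (by linarith)
    have h2 : √(K * (j * 2 ^ j)) ≤ √K * (j * √2 ^ j) := by
      rw [Real.sqrt_mul hK0, Real.sqrt_mul (by positivity)]
      have h3 : √((2 : ℝ) ^ j) = √2 ^ j := by
        rw [Real.sqrt_eq_iff_mul_self_eq (by positivity) (by positivity), ← mul_pow,
          Real.mul_self_sqrt (by norm_num)]
      rw [h3]
      gcongr
      exact Real.sqrt_le_iff.2 ⟨by positivity, by nlinarith⟩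
    refine le_trans ?_ hj1
    calc 2 * (K * (j * 2 ^ j)) * √(K * (j * 2 ^ j)) * (((2 ^ (2 * j) : ℕ) : ℝ)) ^ (-(1 + ε))
        ≤ 2 * (K * (j * 2 ^ j)) * (√K * (j * √2 ^ j)) * ((2 : ℝ) ^ (2 * j))⁻¹ := by gcongr
      _ = _ := by
        rw [pow_mul', div_pow]
        field_simp
  · refine le_trans (le_of_eq ?_) hj2
    push_cast
    rw [pow_mul', one_div, inv_pow]
    field_simp
  · have e : (2 ^ (j + 1) + 2).choose 2 * 2 =
        (2 ^ (j + 1) + 2) * (2 ^ (j + 1) + 1) := by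
      have := Nat.descFactorial_eq_factorial_mul_choose (2 ^ (j + 1) + 2) 2
      simp [Nat.descFactorial, Nat.factorial] at this
      linarith
    have e2 : 2 ^ (2 * j) = (2 ^ j) ^ 2 := by rw [← pow_mul, mul_comm]
    have e3 : 2 ^ (j + 1) = 2 * 2 ^ j := by ring
    rw [e3] at e ⊢
    rw [e2]
    generalize 2 ^ j = x at e ⊢
    generalize (2 * x + 2).choose 2 = y at e ⊢
    nlinarith [Nat.zero_le (x ^ 2)]
  · push_cast
    have h1 : (1 : ℝ) ≤ j * 2 ^ j := by nlinarith
    have hd : (0 : ℝ) ≤ d := by positivity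
    have e : (30 * (2 * (j : ℝ)) * (2 * 2 ^ (j + 1))) = 240 * (j * 2 ^ j) := by ring
    rw [e, hK]
    generalize (j : ℝ) * 2 ^ j = x at *
    nlinarith [mul_nonneg hd (sub_nonneg.2 h1), mul_nonneg (mul_nonneg hd hd) (sub_nonneg.2 h1)]

theorem hilb_le_linear {p q : MvPolynomial (Fin 3) ℝ} (hp : p ≠ 0) (hq : q ≠ 0)
    (hpq : IsRelPrime p q) (Y : Finset (Fin 3 → ℝ)) (hYp : ∀ y ∈ Y, eval y p = 0)
    (hYq : ∀ y ∈ Y, eval y q = 0) {E : ℕ} (hE : p.totalDegree + q.totalDegree ≤ E) :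
    hilb Y E ≤ p.totalDegree * q.totalDegree * (E + 2) := by
  have h := hilb_of_isRelPrime hp hq hpq Y hYp hYq hE
  generalize p.totalDegree = a at *
  generalize q.totalDegree = b at *
  obtain ⟨y, rfl⟩ := Nat.exists_eq_add_of_le hE
  have e1 : a + b + y - a = b + y := by omega
  have e2 : a + b + y - b = a + y := by omega
  have e3 : a + b + y - a - b = y := by omega
  rw [e3, e1, e2] at h
  have key : ∀ x : ℕ, 6 * (x + 3).choose 3 = (x + 3) * (x + 2) * (x + 1) := fun x => by
    have := Nat.descFactorial_eq_factorial_mul_choose (x + 3) 3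
    simp [Nat.descFactorial, Nat.factorial] at this
    linarith
  have k1 := key (a + b + y)
  have k2 := key y
  have k3 := key (a + y)
  have k4 := key (b + y)
  have h0 : 0 ≤ a * b * (a + b) := Nat.zero_le _
  nlinarith

/-- The polynomial cutting out the sphere of radius `α` centred at `p`. -/
def spherePoly (α : ℝ) (p : Fin 3 → ℝ) : MvPolynomial (Fin 3) ℝ :=
  (C (p 0) - X 0) ^ 2 + (C (p 1) - X 1) ^ 2 + (C (p 2) - X 2) ^ 2 - C (α ^ 2)

theorem eval_spherePoly (α : ℝ) (p x : Fin 3 → ℝ) : eval x (spherePoly α p) =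
    (p 0 - x 0) ^ 2 + (p 1 - x 1) ^ 2 + (p 2 - x 2) ^ 2 - α ^ 2 := by
  simp [spherePoly]

theorem eval_spherePoly_eq_zero {α : ℝ} {p x : Fin 3 → ℝ} :
    eval x (spherePoly α p) = 0 ↔ OnSphere α p x := by
  rw [eval_spherePoly, OnSphere, sub_eq_zero]

theorem totalDegree_spherePoly_le (α : ℝ) (p : Fin 3 → ℝ) : (spherePoly α p).totalDegree ≤ 2 := by
  have h : ∀ i : Fin 3, ((C (p i) - X i : MvPolynomial (Fin 3) ℝ) ^ 2).totalDegree ≤ 2 := fun i => by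
    refine (totalDegree_pow _ _).trans ?_
    have : (C (p i) - X i : MvPolynomial (Fin 3) ℝ).totalDegree ≤ 1 :=
      (totalDegree_sub _ _).trans (by simp)
    omega
  refine (totalDegree_sub _ _).trans (max_le ((totalDegree_add _ _).trans (max_le
    ((totalDegree_add _ _).trans (max_le (h 0) (h 1))) (h 2))) ?_)
  rw [totalDegree_C]
  exact Nat.zero_le 2

open Classical in
theorem hilb_nb_add_hilb_sdiff_le (α : ℝ) (p : Fin 3 → ℝ) (Q : Finset (Fin 3 → ℝ)) (E : ℕ) :
    hilb (nb α p Q) (E + 2) + hilb (Q \ nb α p Q) E ≤ hilb Q (E + 2) := by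
  have h := hilb_add_hilb_le (A := nb α p Q) (B := Q \ nb α p Q) (totalDegree_spherePoly_le α p)
    (fun a ha => eval_spherePoly_eq_zero.2 (mem_nb.1 ha).2)
    (fun b hb h => (Finset.mem_sdiff.1 hb).2
      (mem_nb.2 ⟨(Finset.mem_sdiff.1 hb).1, eval_spherePoly_eq_zero.1 h⟩)) E
  rwa [Finset.union_sdiff_of_subset (s := nb α p Q) (Finset.filter_subset _ _)] at h

theorem succ_le_hilb {n : ℕ} {Y : Finset (Fin n → ℝ)} {E : ℕ} (h : E + 1 ≤ Y.card) :
    E + 1 ≤ hilb Y E := by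
  obtain ⟨Z, hZ, hc⟩ := Finset.exists_subset_card_eq h
  exact hc ▸ (card_le_hilb Z hc.le).trans (hilb_mono hZ E)

open Classical in
theorem card_le_of_hilb_lt {α : ℝ} (L : ℕ) : ∀ (E : ℕ) (S R : Finset (Fin 3 → ℝ)),
    (∀ r ∈ R, ∀ r' ∈ R, r ≠ r' → (nb α r S ∩ nb α r' S).card ≤ 2) →
    (∀ r ∈ R, E + 4 * L ≤ (nb α r S).card) → hilb S (E + 2 * L) < L * (E + 1) → R.card ≤ L := by
  induction L with
  | zero => intro E S R _ _ h; simp at h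
  | succ L ih =>
    intro E S R h2 hR hS
    obtain rfl | ⟨r, hr⟩ := R.eq_empty_or_nonempty
    · simp
    rw [← Finset.insert_erase hr, Finset.card_insert_of_notMem (by simp)]
    refine Nat.succ_le_succ (ih E (S \ nb α r S) (R.erase r) ?_ ?_ ?_)
    · intro a ha b hb hab
      refine (Finset.card_le_card ?_).trans
        (h2 a (Finset.mem_of_mem_erase ha) b (Finset.mem_of_mem_erase hb) hab)
      exact Finset.inter_subset_inter (Finset.filter_subset_filter _ Finset.sdiff_subset)
        (Finset.filter_subset_filter _ Finset.sdiff_subset)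
    · intro a ha
      have h3 := h2 a (Finset.mem_of_mem_erase ha) r hr (Finset.ne_of_mem_erase ha)
      have h4 := hR a (Finset.mem_of_mem_erase ha)
      have h5 : nb α a (S \ nb α r S) = nb α a S \ (nb α a S ∩ nb α r S) := by
        ext x; simp only [mem_nb, Finset.mem_sdiff, Finset.mem_inter]; tauto
      rw [h5, Finset.card_sdiff_of_subset Finset.inter_subset_left]
      omega
    · have h3 := hilb_nb_add_hilb_sdiff_le α r S (E + 2 * L)
      have h4 : E + 2 * L + 2 + 1 ≤ hilb (nb α r S) (E + 2 * L + 2) :=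
        succ_le_hilb (by have := hR r hr; omega)
      have h5 : E + 2 * (L + 1) = E + 2 * L + 2 := by ring
      rw [h5] at hS
      nlinarith

open Classical in
theorem hinge_le_of_hilb_lt {α : ℝ} (E L : ℕ) : ∃ K : ℕ, ∀ P Q : Finset (Fin 3 → ℝ),
    hilb Q (E + 2 * L) < L * (E + 1) → hinge α P Q ≤ K * (P.card + Q.card ^ 2) := by
  induction L with
  | zero => exact ⟨0, fun P Q h => by simp at h⟩
  | succ L ih =>
    obtain ⟨K, hK⟩ := ih
    set k := E + 4 * (L + 1) + 3 with hk
    have poor : ∀ P S : Finset (Fin 3 → ℝ), (∀ p ∈ P, (nb α p S).card < k) →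
        hinge α P S ≤ P.card * k ^ 2 := fun P S h => by
      rw [hinge, ← smul_eq_mul]
      exact Finset.sum_le_card_nsmul _ _ _ fun p hp => Nat.pow_le_pow_left (h p hp).le 2
    refine ⟨2 * (k ^ 2 + L + 2) + 2 * K, fun P Q hQ => ?_⟩
    by_cases hrich : ∃ p ∈ P, k ≤ (nb α p Q).card
    · obtain ⟨p, hp, hpk⟩ := hrich
      set S := nb α p Q with hS
      have hSQ : S ⊆ Q := Finset.filter_subset _ _
      have h1 : hinge α P Q ≤ 2 * hinge α P S + 2 * hinge α P (Q \ S) := by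
        conv_lhs => rw [← Finset.union_sdiff_of_subset hSQ]
        exact hinge_union_le P S (Q \ S)
      have h2 : hinge α P (Q \ S) ≤ K * (P.card + (Q \ S).card ^ 2) := by
        apply hK
        have h3 := hilb_nb_add_hilb_sdiff_le α p Q (E + 2 * L)
        have h4 : E + 2 * L + 2 + 1 ≤ hilb (nb α p Q) (E + 2 * L + 2) :=
          succ_le_hilb (by rw [← hS]; omega)
        have h5 : E + 2 * (L + 1) = E + 2 * L + 2 := by ring
        rw [h5] at hQ
        rw [hS]
        nlinarith
      have h3 : (Q \ S).card ≤ Q.card := Finset.card_le_card Finset.sdiff_subset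
      have h4 : S.card ≤ Q.card := Finset.card_le_card hSQ
      have hR : ((P.erase p).filter fun r => k ≤ (nb α r S).card).card ≤ L + 1 := by
        refine card_le_of_hilb_lt (α := α) (L + 1) E S _ ?_ ?_ ((hilb_mono hSQ _).trans_lt hQ)
        · intro r hr r' hr' hrr'
          by_contra! hlt
          simp only [Finset.mem_filter, Finset.mem_erase] at hr hr'
          have := min_card_le_two (α := α) (P := {p, r, r'}) (Q := nb α r S ∩ nb α r' S) (by
            intro a ha q hq
            simp only [Finset.mem_inter, mem_nb, hS] at hq
            simp only [Finset.mem_insert, Finset.mem_singleton] at ha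
            rcases ha with rfl | rfl | rfl <;> tauto) hlt
          rw [Finset.card_eq_three.2 ⟨p, r, r', hr.1.1.symm, hr'.1.1.symm, hrr', rfl⟩] at this
          omega
        · intro r hr
          have := (Finset.mem_filter.1 hr).2
          omega
      have h5 : hinge α P S ≤ (L + 2) * S.card ^ 2 + P.card * k ^ 2 := by
        rw [← hinge_sdiff_add (P₀ := P.filter fun r => k ≤ (nb α r S).card)
          (Finset.filter_subset _ _), add_comm]
        refine add_le_add (hinge_le_of_card_le ?_) ((poor _ S ?_).trans ?_)
        · calc _ ≤ (insert p ((P.erase p).filter fun r => k ≤ (nb α r S).card)).card := by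
                refine Finset.card_le_card fun x hx => ?_
                simp only [Finset.mem_filter, Finset.mem_insert, Finset.mem_erase] at hx ⊢
                tauto
            _ ≤ _ := (Finset.card_insert_le _ _).trans (by omega)
        · intro q hq
          simp only [Finset.mem_sdiff, Finset.mem_filter, not_and, not_le] at hq
          exact hq.2 hq.1
        · exact Nat.mul_le_mul_right _ (Finset.card_le_card Finset.sdiff_subset)
      have h6 : (Q \ S).card ^ 2 ≤ Q.card ^ 2 := Nat.pow_le_pow_left h3 2
      have h7 : S.card ^ 2 ≤ Q.card ^ 2 := Nat.pow_le_pow_left h4 2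
      calc hinge α P Q ≤ 2 * ((L + 2) * Q.card ^ 2 + P.card * k ^ 2) +
            2 * (K * (P.card + Q.card ^ 2)) := by
            refine h1.trans (add_le_add (Nat.mul_le_mul_left _ (h5.trans ?_))
              (Nat.mul_le_mul_left _ (h2.trans ?_))) <;> gcongr
        _ ≤ _ := by
          generalize k ^ 2 = x
          generalize Q.card ^ 2 = y
          nlinarith [Nat.zero_le (x * y), Nat.zero_le (L * P.card)]
    · push Not at hrich
      refine (poor P Q hrich).trans ?_
      generalize k ^ 2 = x
      generalize Q.card ^ 2 = y
      have h : P.card * x ≤ x * (P.card + y) := by nlinarith [Nat.zero_le (x * y)]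
      exact h.trans (Nat.mul_le_mul_right _ (by omega))

/-- Hinges with endpoints on a curve. -/
theorem hinge_le_of_isRelPrime (α : ℝ) (d e : ℕ) : ∃ K : ℕ, ∀ f g : MvPolynomial (Fin 3) ℝ,
    f ≠ 0 → g ≠ 0 → IsRelPrime f g → f.totalDegree ≤ d → g.totalDegree ≤ e →
    ∀ P Q : Finset (Fin 3 → ℝ), (∀ q ∈ Q, eval q f = 0) → (∀ q ∈ Q, eval q g = 0) →
    hinge α P Q ≤ K * (P.card + Q.card ^ 2) := by
  obtain ⟨K, hK⟩ := hinge_le_of_hilb_lt (α := α) (d * e * (2 * (d * e + 1) + 2) + d + e) (d * e + 1)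
  refine ⟨K, fun f g hf hg hfg hfd hge P Q hQf hQg => hK P Q ?_⟩
  refine (hilb_le_linear hf hg hfg Q hQf hQg (by omega)).trans_lt ?_
  have h1 : f.totalDegree * g.totalDegree ≤ d * e := Nat.mul_le_mul hfd hge
  refine (Nat.mul_le_mul_right _ h1).trans_lt ?_
  generalize d * e = A
  nlinarith

/-- The horizontal circle at height `s` on a sphere of radius `α > s` is infinite. -/
theorem infinite_setOf_onSphere {α s : ℝ} (hs : 0 ≤ s) (hsα : s < α) (p : Fin 3 → ℝ) :
    {x | OnSphere α p x ∧ x 2 = p 2 + s}.Infinite := by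
  have h0 : 0 < α ^ 2 - s ^ 2 := by nlinarith
  refine Set.infinite_of_injOn_mapsTo (s := Set.Ioo 0 (√(α ^ 2 - s ^ 2)))
    (f := fun a => ![p 0 + a, p 1 + √(α ^ 2 - s ^ 2 - a ^ 2), p 2 + s]) ?_ ?_
    (Set.Ioo_infinite (Real.sqrt_pos.2 h0))
  · intro a _ b _ hab
    simpa using congrFun hab 0
  · intro a ha
    have h1 : a ^ 2 < α ^ 2 - s ^ 2 := by
      have := Real.lt_sqrt ha.1.le |>.1 ha.2
      exact this
    have h2 : √(α ^ 2 - s ^ 2 - a ^ 2) ^ 2 = α ^ 2 - s ^ 2 - a ^ 2 := Real.sq_sqrt (by linarith)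
    refine ⟨?_, by simp⟩
    simp only [OnSphere, Matrix.cons_val_zero, Matrix.cons_val_one, Matrix.cons_val]
    linear_combination h2

/-- Finite subsets of a sphere can have quadratically growing Hilbert function. -/
theorem exists_finset_onSphere {α : ℝ} (hα : 0 < α) (p : Fin 3 → ℝ) (E L : ℕ) :
    ∃ Y : Finset (Fin 3 → ℝ), (∀ y ∈ Y, OnSphere α p y ∧ ∃ j < L, y 2 = p 2 + α / (j + 2)) ∧
      L * (E + 1) ≤ hilb Y (E + L) := by
  classical
  induction L with
  | zero => exact ⟨∅, by simp, by simp⟩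
  | succ L ih =>
    obtain ⟨Y, hY, hL⟩ := ih
    have hlt : α / ((L : ℝ) + 2) < α := div_lt_self hα (by
      have : (0 : ℝ) ≤ L := Nat.cast_nonneg L
      linarith)
    obtain ⟨A, hA, hAc⟩ := (infinite_setOf_onSphere (s := α / ((L : ℝ) + 2)) (by positivity) hlt
      p).exists_subset_card_eq (E + L + 2)
    refine ⟨A ∪ Y, ?_, ?_⟩
    · intro y hy
      rcases Finset.mem_union.1 hy with h | h
      · exact ⟨(hA h).1, L, L.lt_succ_self, (hA h).2⟩
      · obtain ⟨h1, j, hj, h2⟩ := hY y h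
        exact ⟨h1, j, by omega, h2⟩
    · have h := hilb_add_hilb_le (A := A) (B := Y)
        (s := X 2 - C (p 2 + α / ((L : ℝ) + 2))) (k := 1)
        ((totalDegree_sub_C_le _ _).trans (by simp))
        (fun a ha => by simp [(hA ha).2]) (fun b hb h0 => by
          obtain ⟨-, j, hj, h2⟩ := hY b hb
          simp only [map_sub, eval_X, eval_C, h2] at h0
          have h3 : α / ((j : ℝ) + 2) = α / ((L : ℝ) + 2) := by linarith
          rw [div_eq_div_iff (by positivity) (by positivity)] at h3
          have h4 := mul_left_cancel₀ hα.ne' h3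
          have h5 : (j : ℝ) < L := by exact_mod_cast hj
          linarith) (E + L)
      have h2 : E + L + 1 + 1 ≤ hilb A (E + L + 1) := succ_le_hilb (by rw [hAc])
      rw [← add_assoc]
      nlinarith

theorem exists_eval_stereo_ne_zero {α : ℝ} (hα : 0 < α) (p : Fin 3 → ℝ)
    {f : MvPolynomial (Fin 3) ℝ} (hf : Irreducible f) (hfp : ¬ f ∣ spherePoly α p) :
    ∃ w, eval (stereo α p w) f ≠ 0 := by
  by_contra! h
  have hrel : IsRelPrime f (spherePoly α p) := hf.isRelPrime_iff_not_dvd.2 hfp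
  have hs : spherePoly α p ≠ 0 := fun h0 => hfp (h0 ▸ dvd_zero f)
  obtain ⟨a, ha⟩ : ∃ a, f.totalDegree = a := ⟨_, rfl⟩
  obtain ⟨b, hb⟩ : ∃ b, (spherePoly α p).totalDegree = b := ⟨_, rfl⟩
  obtain ⟨Y, hY, hle⟩ := exists_finset_onSphere hα p (a * b * (a * b + 3) + a + b) (a * b + 1)
  have h1 := hilb_le_linear hf.ne_zero hs hrel Y (fun y hy => by
    obtain ⟨h2, j, -, h3⟩ := hY y hy
    obtain ⟨w, rfl⟩ := exists_stereo_eq hα h2 (by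
      rw [h3]
      have : α / ((j : ℝ) + 2) < α := div_lt_self hα (by
        have : (0 : ℝ) ≤ j := Nat.cast_nonneg j
        linarith)
      linarith)
    exact h w) (fun y hy => eval_spherePoly_eq_zero.2 (hY y hy).1)
    (E := a * b * (a * b + 3) + a + b + (a * b + 1)) (by omega)
  rw [ha, hb] at h1
  have := hle.trans h1
  generalize a * b = A at *
  nlinarith

theorem totalDegree_pos_of_not_isUnit {f : MvPolynomial (Fin 3) ℝ} (h0 : f ≠ 0)
    (hf : ¬ IsUnit f) : 0 < f.totalDegree := by
  by_contra! h
  rw [Nat.le_zero, totalDegree_eq_zero_iff_eq_C] at h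
  rw [h] at hf h0
  refine hf ((IsUnit.mk0 _ fun h1 => h0 ?_).map C)
  rw [h1, C_0]

/-- There are many polynomials of degree at most `D` independent modulo a given nonconstant one. -/
theorem exists_linearIndependent_not_dvd {f : MvPolynomial (Fin 3) ℝ} (hf0 : f ≠ 0)
    (hf : 0 < f.totalDegree) {D t : ℕ} (hD : f.totalDegree ≤ D) (ht : t ≤ (D + 2).choose 2) :
    ∃ w : Fin t → MvPolynomial (Fin 3) ℝ, LinearIndependent ℝ w ∧
      ∀ g ∈ Submodule.span ℝ (Set.range w), g.totalDegree ≤ D ∧ (g ≠ 0 → ¬ f ∣ g) := by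
  set V := restrictTotalDegree (Fin 3) ℝ D with hV
  set W := (restrictTotalDegree (Fin 3) ℝ (D - f.totalDegree)).map (LinearMap.mulLeft ℝ f) with hW
  have hfin : FiniteDimensional ℝ V := inferInstance
  have hWV : W ≤ V := by
    rintro _ ⟨g, hg, rfl⟩
    have hg : g.totalDegree ≤ D - f.totalDegree := (mem_restrictTotalDegree _ _ _).1 hg
    refine (mem_restrictTotalDegree _ _ _).2 ((totalDegree_mul _ _).trans ?_)
    omega
  have hWfin : FiniteDimensional ℝ W := Submodule.finiteDimensional_of_le hWV
  obtain ⟨W', hW'⟩ := W.exists_isCompl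
  have hUV : W' ⊓ V ≤ V := inf_le_right
  have hUfin : FiniteDimensional ℝ (W' ⊓ V : Submodule ℝ (MvPolynomial (Fin 3) ℝ)) :=
    Submodule.finiteDimensional_of_le hUV
  have hsup : W ⊔ W' ⊓ V = V := by rw [← sup_inf_assoc_of_le _ hWV, hW'.sup_eq_top, top_inf_eq]
  have hinf : W ⊓ (W' ⊓ V) = ⊥ := by rw [← inf_assoc, hW'.inf_eq_bot, bot_inf_eq]
  have hrank := Submodule.finrank_sup_add_finrank_inf_eq W (W' ⊓ V)
  rw [hsup, hinf, finrank_bot, hV, finrank_restrictTotalDegree, hW, finrank_map_of_injective _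
    (mul_right_injective₀ hf0), finrank_restrictTotalDegree, ← hV] at hrank
  have hle : (D - f.totalDegree + 3).choose 3 ≤ (D + 2).choose 3 :=
    Nat.choose_le_choose 3 (by omega)
  have hpascal : (D + 3).choose 3 = (D + 2).choose 2 + (D + 2).choose 3 := Nat.choose_succ_succ _ _
  obtain ⟨w, hw⟩ := exists_linearIndependent_of_le_finrank
    (R := ℝ) (M := (W' ⊓ V : Submodule ℝ (MvPolynomial (Fin 3) ℝ))) (n := t) (by omega)
  refine ⟨fun i => w i, hw.map' (Submodule.subtype _) (Submodule.ker_subtype _), fun g hg => ?_⟩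
  have hgU : g ∈ W' ⊓ V := by
    refine Submodule.span_le.2 ?_ hg
    rintro _ ⟨i, rfl⟩
    exact (w i).2
  have hgD : g.totalDegree ≤ D := (mem_restrictTotalDegree _ _ _).1 hgU.2
  refine ⟨hgD, ?_⟩
  rintro hg0 ⟨k, rfl⟩
  have hk0 : k ≠ 0 := right_ne_zero_of_mul hg0
  rw [totalDegree_mul_of_isDomain hf0 hk0] at hgD
  have : f * k ∈ W ⊓ (W' ⊓ V) :=
    ⟨⟨k, (mem_restrictTotalDegree _ _ _).2 (by omega), rfl⟩, hgU⟩
  rw [hinf] at this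
  exact hg0 ((Submodule.mem_bot ℝ).1 this)

theorem hingeBound_mono {ε : ℝ} (hε : 0 ≤ ε) (m : ℕ) {n n' : ℕ} (h : n ≤ n') :
    hingeBound ε m n ≤ hingeBound ε m n' := by
  have h' : (n : ℝ) ≤ n' := by exact_mod_cast h
  unfold hingeBound
  gcongr

theorem add_sq_le_hingeBound (ε : ℝ) (m n : ℕ) : ((m + n ^ 2 : ℕ) : ℝ) ≤ hingeBound ε m n := by
  unfold hingeBound
  push_cast
  have : 0 ≤ √(m * (n : ℝ) ^ 3) * (n : ℝ) ^ ε := by positivity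
  linarith

theorem hinge_le_of_irreducible {α ε : ℝ} (hα : 0 < α) (hε : 0 ≤ ε) (d : ℕ) :
    ∃ A : ℝ, 0 ≤ A ∧ ∀ P Q : Finset (Fin 3 → ℝ),
      (∃ f : MvPolynomial (Fin 3) ℝ, Irreducible f ∧ f.totalDegree ≤ d ∧ ∀ q ∈ Q, eval q f = 0) →
      (hinge α P Q : ℝ) ≤ A * hingeBound ε P.card Q.card := by
  classical
  obtain ⟨t, M, D, κ, hdD, ht, hκ, h1, h2, hM, htD, hκD⟩ := exists_params_surface hε d
  obtain ⟨K, hK⟩ := hinge_le_of_isRelPrime α d D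
  refine hinge_le_of_partition (B := K) (D := D) hε ht hκ (by positivity) h1 h2 hM
    (fun Q => ∃ f : MvPolynomial (Fin 3) ℝ, Irreducible f ∧ f.totalDegree ≤ d ∧
      ∀ q ∈ Q, eval q f = 0) ?_ ?_
  · rintro Q Q' hQ ⟨f, hf, hfd, hfQ⟩
    exact ⟨f, hf, hfd, fun q hq => hfQ q (hQ hq)⟩
  · rintro Q ⟨f, hf, hfd, hfQ⟩ hQ2
    obtain ⟨w, hw, hwf⟩ := exists_linearIndependent_not_dvd hf.ne_zero
      (totalDegree_pos_of_not_isUnit hf.ne_zero hf.not_isUnit) (hfd.trans hdD) htD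
    refine ⟨w, hw, fun g hg => ⟨(hwf g hg).1, fun hg0 P => ?_⟩, fun P => ?_⟩
    · have h := hK f g hf.ne_zero hg0 (hf.isRelPrime_iff_not_dvd.2 ((hwf g hg).2 hg0)) hfd
        (hwf g hg).1 P (Q.filter (eval · g = 0)) (fun q hq => hfQ q (Finset.mem_filter.1 hq).1)
        (fun q hq => (Finset.mem_filter.1 hq).2)
      calc (hinge α P (Q.filter (eval · g = 0)) : ℝ)
          ≤ ((K * (P.card + (Q.filter (eval · g = 0)).card ^ 2) : ℕ) : ℝ) := by exact_mod_cast h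
        _ ≤ K * hingeBound ε P.card (Q.filter (eval · g = 0)).card := by
          rw [Nat.cast_mul]
          exact mul_le_mul_of_nonneg_left (add_sq_le_hingeBound _ _ _) (Nat.cast_nonneg _)
        _ ≤ _ := mul_le_mul_of_nonneg_left
          (hingeBound_mono hε _ (Finset.card_le_card (Finset.filter_subset _ _)))
          (Nat.cast_nonneg _)
    · refine ⟨P.filter (f ∣ spherePoly α ·), Finset.filter_subset _ _, ?_, ?_⟩
      · by_contra! h
        refine hQ2.not_ge (min_card_le_two (α := α) (fun q hq p hp => ?_) h)
        refine OnSphere.symm (eval_spherePoly_eq_zero.1 ?_)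
        obtain ⟨k, hk⟩ := (Finset.mem_filter.1 hp).2
        rw [hk, eval_mul, hfQ q hq, zero_mul]
      · intro p hp fs hfs hfsD Y hYQ hYp hY0 hY
        have hnd : ¬ f ∣ spherePoly α p := by
          simp only [Finset.mem_sdiff, Finset.mem_filter, not_and] at hp
          exact hp.2 hp.1
        have h := (card_le_of_signs_sphere hα p hfsD hYp hY0 hY).2 f d hfd
          (fun y hy => hfQ y (hYQ hy)) (exists_eval_stereo_ne_zero hα p hf hnd)
        rw [hfs] at h
        exact (Nat.cast_le.2 h).trans hκD

/-- Hinges with endpoints on a surface. -/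
theorem hinge_le_of_surface {α ε : ℝ} (hα : 0 < α) (hε : 0 ≤ ε) (d : ℕ) :
    ∃ A : ℝ, 0 ≤ A ∧ ∀ (f : MvPolynomial (Fin 3) ℝ), f ≠ 0 → f.totalDegree ≤ d →
      ∀ P Q : Finset (Fin 3 → ℝ), (∀ q ∈ Q, eval q f = 0) →
      (hinge α P Q : ℝ) ≤ A * hingeBound ε P.card Q.card := by
  classical
  induction d with
  | zero =>
    refine ⟨0, le_rfl, fun f hf0 hfd P Q hQ => ?_⟩
    have hu : IsUnit f := by
      by_contra hu
      exact (totalDegree_pos_of_not_isUnit hf0 hu).not_ge hfd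
    obtain rfl : Q = ∅ := Finset.eq_empty_of_forall_notMem fun q hq =>
      (hu.map (eval q)).ne_zero (hQ q hq)
    simp [hinge, nb]
  | succ d ih =>
    obtain ⟨A, hA, h⟩ := ih
    obtain ⟨A', hA', h'⟩ := hinge_le_of_irreducible hα hε (d + 1)
    refine ⟨4 * A + A', by positivity, fun f hf0 hfd P Q hQ => ?_⟩
    have hB := hingeBound_nonneg ε P.card Q.card
    by_cases hu : IsUnit f
    · obtain rfl : Q = ∅ := Finset.eq_empty_of_forall_notMem fun q hq =>
        (hu.map (eval q)).ne_zero (hQ q hq)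
      have : (hinge α P ∅ : ℝ) = 0 := by simp [hinge, nb]
      rw [this]
      positivity
    by_cases hf : Irreducible f
    · have := h' P Q ⟨f, hf, hfd, hQ⟩
      nlinarith
    obtain ⟨a, b, ha, hb, rfl⟩ := (irreducible_or_factor hu).resolve_left hf
    have ha0 := left_ne_zero_of_mul hf0
    have hb0 := right_ne_zero_of_mul hf0
    rw [totalDegree_mul_of_isDomain ha0 hb0] at hfd
    have hapos := totalDegree_pos_of_not_isUnit ha0 ha
    have hbpos := totalDegree_pos_of_not_isUnit hb0 hb
    have hQab : Q = Q.filter (eval · a = 0) ∪ Q.filter (eval · b = 0) := by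
      rw [← Finset.filter_or]
      refine (Finset.filter_true_of_mem fun q hq => ?_).symm
      simpa [eval_mul] using hQ q hq
    have h1 := h a ha0 (by omega) P (Q.filter (eval · a = 0)) fun q hq => (Finset.mem_filter.1 hq).2
    have h2 := h b hb0 (by omega) P (Q.filter (eval · b = 0)) fun q hq => (Finset.mem_filter.1 hq).2
    have m1 := mul_le_mul_of_nonneg_left (hingeBound_mono hε P.card
      (Finset.card_le_card (Finset.filter_subset (eval · a = 0) Q))) hA
    have m2 := mul_le_mul_of_nonneg_left (hingeBound_mono hε P.card
      (Finset.card_le_card (Finset.filter_subset (eval · b = 0) Q))) hA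
    have h3 := hinge_union_le (α := α) P (Q.filter (eval · a = 0)) (Q.filter (eval · b = 0))
    rw [← hQab] at h3
    have h4 : (hinge α P Q : ℝ) ≤ 2 * hinge α P (Q.filter (eval · a = 0)) +
      2 * hinge α P (Q.filter (eval · b = 0)) := by exact_mod_cast h3
    nlinarith

theorem hinge_le_hingeBound {α ε : ℝ} (hα : 0 < α) (hε : 0 < ε) :
    ∃ A : ℝ, 0 ≤ A ∧ ∀ P Q : Finset (Fin 3 → ℝ),
      (hinge α P Q : ℝ) ≤ A * hingeBound ε P.card Q.card := by
  classical
  obtain ⟨t, M, D, κ, ht, hκ, h1, h2, hM, htD, hκD⟩ := exists_params_space hε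
  obtain ⟨B, hB, hS⟩ := hinge_le_of_surface hα hε.le D
  obtain ⟨w, hw⟩ := exists_linearIndependent_of_le_finrank (R := ℝ)
    (M := restrictTotalDegree (Fin 3) ℝ D) (n := t + 1) (by rwa [finrank_restrictTotalDegree])
  obtain ⟨A, hA, h⟩ := hinge_le_of_partition (α := α) (D := D) hε.le ht hκ hB h1 h2 hM
    (fun _ => True) (fun _ _ _ _ => trivial) (fun Q _ _ => by
      refine ⟨fun i => w i, hw.map' (Submodule.subtype _) (Submodule.ker_subtype _),
        fun g hg => ?_, fun P => ⟨∅, Finset.empty_subset _, by simp, ?_⟩⟩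
      · have hgD : g.totalDegree ≤ D := (mem_restrictTotalDegree _ _ _).1 (by
          refine Submodule.span_le.2 ?_ hg
          rintro _ ⟨i, rfl⟩
          exact (w i).2)
        refine ⟨hgD, fun hg0 P => (hS g hg0 hgD P _ fun q hq => (Finset.mem_filter.1 hq).2).trans ?_⟩
        exact mul_le_mul_of_nonneg_left
          (hingeBound_mono hε.le _ (Finset.card_le_card (Finset.filter_subset _ _))) hB
      · intro p _ fs hfs hfsD Y _ hYp hY0 hY
        have h := (card_le_of_signs_sphere hα p hfsD hYp hY0 hY).1
        rw [hfs] at h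
        exact (Nat.cast_le.2 h).trans hκD)
  exact ⟨A, hA, fun P Q => h P Q trivial⟩

/-- A set of `n` points in space determines `O(n ^ (2 + ε))` hinges. -/
theorem hinge_self_le {α ε : ℝ} (hα : 0 < α) (hε : 0 < ε) :
    ∃ A : ℝ, 0 < A ∧ ∀ P : Finset (Fin 3 → ℝ), P.Nonempty →
      (hinge α P P : ℝ) ≤ A * (P.card : ℝ) ^ (2 + ε) := by
  obtain ⟨A, hA, h⟩ := hinge_le_hingeBound hα hε
  refine ⟨3 * (A + 1), by positivity, fun P hP => (h P P).trans ?_⟩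
  have hn : (1 : ℝ) ≤ P.card := by exact_mod_cast hP.card_pos
  unfold hingeBound
  generalize (P.card : ℝ) = n at hn
  have h0 : (0 : ℝ) < n := by linarith
  have e1 : √(n * n ^ 3) = n ^ 2 := by
    rw [show n * n ^ 3 = (n ^ 2) ^ 2 by ring, Real.sqrt_sq (by positivity)]
  have e2 : n ^ (2 + ε) = n ^ 2 * n ^ ε := by rw [Real.rpow_add h0]; norm_num
  have e3 : 1 ≤ n ^ ε := Real.one_le_rpow hn hε.le
  rw [e1, e2]
  have e4 : n ≤ n ^ 2 := by nlinarith
  have e5 : n ^ 2 ≤ n ^ 2 * n ^ ε := by nlinarith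
  have e6 : A * (n ^ 2 * n ^ ε + n ^ 2 + n) ≤ A * (3 * (n ^ 2 * n ^ ε)) :=
    mul_le_mul_of_nonneg_left (by linarith) hA
  have e7 : 0 ≤ n ^ 2 * n ^ ε := by positivity
  linarith

end

open Classical in
/-- A configuration is determined up to boundedly many choices by its values on `K`, if each vertex
outside `K` has three neighbours in `K`. -/
theorem card_filter_eqOn_le {V : Type*} [Fintype V] {α : ℝ} {adj : V → V → Prop}
    {𝒞 : Finset (V → Fin 3 → ℝ)} (hinj : ∀ φ ∈ 𝒞, Function.Injective φ)
    (hadj : ∀ φ ∈ 𝒞, ∀ u v, adj u v → OnSphere α (φ u) (φ v)) {K : Finset V}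
    (hK : ∀ v ∉ K, ∃ n : Fin 3 → V, Function.Injective n ∧ ∀ i, n i ∈ K ∧ adj v (n i))
    {φ₀ : V → Fin 3 → ℝ} (hφ₀ : φ₀ ∈ 𝒞) :
    (𝒞.filter fun φ => ∀ u ∈ K, φ u = φ₀ u).card ≤ 2 ^ Fintype.card V := by
  set F := 𝒞.filter fun φ => ∀ u ∈ K, φ u = φ₀ u with hF
  have hsub : F ⊆ Fintype.piFinset fun v => F.image fun φ => φ v := fun φ hφ =>
    Fintype.mem_piFinset.2 fun v => Finset.mem_image_of_mem _ hφ
  refine (Finset.card_le_card hsub).trans ?_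
  rw [Fintype.card_piFinset]
  refine (Finset.prod_le_pow_card _ _ 2 fun v _ => ?_).trans (by simp)
  by_cases hv : v ∈ K
  · have : (F.image fun φ => φ v) ⊆ {φ₀ v} := by
      intro x hx
      obtain ⟨φ, hφ, rfl⟩ := Finset.mem_image.1 hx
      exact Finset.mem_singleton.2 ((Finset.mem_filter.1 hφ).2 v hv)
    exact (Finset.card_le_card this).trans (by simp)
  · obtain ⟨n, hn, hnK⟩ := hK v hv
    refine min_card_le_two (α := α) (Q := Finset.univ.image (φ₀ ∘ n)) (fun x hx y hy => ?_) ?_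
    · obtain ⟨φ, hφ, rfl⟩ := Finset.mem_image.1 hx
      obtain ⟨i, -, rfl⟩ := Finset.mem_image.1 hy
      obtain ⟨h1, h2⟩ := Finset.mem_filter.1 hφ
      rw [Function.comp_apply, ← h2 _ (hnK i).1]
      exact hadj φ h1 _ _ (hnK i).2
    · rw [Finset.card_image_of_injective _ ((hinj φ₀ hφ₀).comp hn)]
      simp

open Classical in
theorem card_configs_le_pow {V : Type*} [Fintype V] {α : ℝ} {adj : V → V → Prop}
    {𝒞 : Finset (V → Fin 3 → ℝ)} (hinj : ∀ φ ∈ 𝒞, Function.Injective φ)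
    (hadj : ∀ φ ∈ 𝒞, ∀ u v, adj u v → OnSphere α (φ u) (φ v)) {E : Finset (Fin 3 → ℝ)}
    (hE : ∀ φ ∈ 𝒞, ∀ v, φ v ∈ E) {K : Finset V}
    (hK : ∀ v ∉ K, ∃ n : Fin 3 → V, Function.Injective n ∧ ∀ i, n i ∈ K ∧ adj v (n i)) :
    𝒞.card ≤ 2 ^ Fintype.card V * E.card ^ K.card := by
  have h := Finset.card_le_mul_card_image (s := 𝒞) (f := fun φ (u : K) => φ u)
    (2 ^ Fintype.card V) (by
      intro ψ hψ
      obtain ⟨φ₀, hφ₀, rfl⟩ := Finset.mem_image.1 hψ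
      refine le_trans (Finset.card_le_card fun φ hφ => ?_) (card_filter_eqOn_le hinj hadj hK hφ₀)
      obtain ⟨h1, h2⟩ := Finset.mem_filter.1 hφ
      exact Finset.mem_filter.2 ⟨h1, fun u hu => congrFun h2 ⟨u, hu⟩⟩)
  refine h.trans (Nat.mul_le_mul_left _ ?_)
  have hsub : (𝒞.image fun φ (u : K) => φ u) ⊆ Fintype.piFinset fun _ : K => E := by
    intro ψ hψ
    obtain ⟨φ, hφ, rfl⟩ := Finset.mem_image.1 hψ
    exact Fintype.mem_piFinset.2 fun u => hE φ hφ u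
  exact (Finset.card_le_card hsub).trans (by simp)

open Classical in
theorem card_configs_le_hinge {V : Type*} [Fintype V] {α : ℝ} {adj : V → V → Prop}
    {𝒞 : Finset (V → Fin 3 → ℝ)} (hinj : ∀ φ ∈ 𝒞, Function.Injective φ)
    (hadj : ∀ φ ∈ 𝒞, ∀ u v, adj u v → OnSphere α (φ u) (φ v)) {E : Finset (Fin 3 → ℝ)}
    (hE : ∀ φ ∈ 𝒞, ∀ v, φ v ∈ E) {K : Finset V} {r a b : V}
    (hK : ∀ v ∉ insert r (insert a (insert b K)), ∃ n : Fin 3 → V, Function.Injective n ∧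
      ∀ i, n i ∈ insert r (insert a (insert b K)) ∧ adj v (n i))
    (hra : adj r a) (hrb : adj r b) :
    𝒞.card ≤ 2 ^ Fintype.card V * (hinge α E E * E.card ^ K.card) := by
  have h := Finset.card_le_mul_card_image (s := 𝒞)
    (f := fun φ => ((⟨φ r, (φ a, φ b)⟩ : Σ _ : Fin 3 → ℝ, (Fin 3 → ℝ) × (Fin 3 → ℝ)),
      fun u : K => φ u)) (2 ^ Fintype.card V) (by
      intro ψ hψ
      obtain ⟨φ₀, hφ₀, rfl⟩ := Finset.mem_image.1 hψ
      refine le_trans (Finset.card_le_card fun φ hφ => ?_) (card_filter_eqOn_le hinj hadj hK hφ₀)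
      obtain ⟨h1, h2⟩ := Finset.mem_filter.1 hφ
      simp only [Prod.mk.injEq, Sigma.mk.injEq, heq_eq_eq] at h2
      obtain ⟨⟨hr, ha, hb⟩, h3⟩ := h2
      refine Finset.mem_filter.2 ⟨h1, fun u hu => ?_⟩
      simp only [Finset.mem_insert] at hu
      rcases hu with rfl | rfl | rfl | hu
      · exact hr
      · exact ha
      · exact hb
      · exact congrFun h3 ⟨u, hu⟩)
  refine h.trans (Nat.mul_le_mul_left _ ?_)
  have hsub : (𝒞.image fun φ => ((⟨φ r, (φ a, φ b)⟩ :
      Σ _ : Fin 3 → ℝ, (Fin 3 → ℝ) × (Fin 3 → ℝ)), fun u : K => φ u)) ⊆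
      (E.sigma fun p => nb α p E ×ˢ nb α p E) ×ˢ Fintype.piFinset fun _ : K => E := by
    intro ψ hψ
    obtain ⟨φ, hφ, rfl⟩ := Finset.mem_image.1 hψ
    simp only [Finset.mem_product, Finset.mem_sigma, Fintype.mem_piFinset, mem_nb]
    exact ⟨⟨hE φ hφ r, ⟨hE φ hφ a, hadj φ hφ _ _ hra⟩, hE φ hφ b, hadj φ hφ _ _ hrb⟩,
      fun u => hE φ hφ u⟩
  refine (Finset.card_le_card hsub).trans (le_of_eq ?_)
  rw [Finset.card_product, Finset.card_sigma, hinge]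
  simp [sq]

/-- The number of vertices of `T_{c,h}` whose depth has the parity of `h`. -/
def parityCount (c : ℕ) : ℕ → ℕ
  | 0 => 1
  | 1 => c
  | h + 2 => parityCount c h + c ^ (h + 2)

theorem ncard_setOf_length_eq (c k : ℕ) : {l : List (Fin c) | l.length = k}.ncard = c ^ k := by
  have h : Nat.card (List.Vector (Fin c) k) = c ^ k := by
    rw [Nat.card_eq_fintype_card, card_vector, Fintype.card_fin]
  exact h

theorem ncard_parity_le (c : ℕ) : ∀ h : ℕ,
    {l : List (Fin c) | l.length ≤ h ∧ l.length % 2 = h % 2}.ncard ≤ parityCount c h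
  | 0 => by
    have : {l : List (Fin c) | l.length ≤ 0 ∧ l.length % 2 = 0 % 2} =
        {l : List (Fin c) | l.length = 0} := by ext; simp only [Set.mem_ofPred_eq]; omega
    rw [this, ncard_setOf_length_eq]
    simp [parityCount]
  | 1 => by
    have : {l : List (Fin c) | l.length ≤ 1 ∧ l.length % 2 = 1 % 2} =
        {l : List (Fin c) | l.length = 1} := by ext; simp only [Set.mem_ofPred_eq]; omega
    rw [this, ncard_setOf_length_eq]
    simp [parityCount]
  | h + 2 => by
    have : {l : List (Fin c) | l.length ≤ h + 2 ∧ l.length % 2 = (h + 2) % 2} =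
        {l : List (Fin c) | l.length ≤ h ∧ l.length % 2 = h % 2} ∪
        {l : List (Fin c) | l.length = h + 2} := by
      ext; simp only [Set.mem_ofPred_eq, Set.mem_union]; omega
    rw [this, parityCount]
    refine (Set.ncard_union_le _ _).trans ?_
    rw [ncard_setOf_length_eq]
    exact Nat.add_le_add_right (ncard_parity_le c h) _

theorem parityCount_eq {c : ℕ} (hc : 2 ≤ c) (h : ℕ) : (parityCount c h : ℝ) =
    (c : ℝ) ^ h * (1 + 1 / ((c : ℝ) ^ 2 - 1)) + (-1 : ℝ) ^ h / (2 * ((c : ℝ) + 1)) +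
      1 / (2 * (1 - (c : ℝ))) := by
  have hc' : (2 : ℝ) ≤ c := by exact_mod_cast hc
  have h1 : (c : ℝ) ^ 2 - 1 = (c - 1) * (c + 1) := by ring
  have h2 : (c : ℝ) - 1 ≠ 0 := by linarith
  have h3 : (c : ℝ) + 1 ≠ 0 := by linarith
  have h4 : 1 - (c : ℝ) = -(c - 1) := by ring
  rw [h1, h4]
  induction h using Nat.twoStepInduction with
  | zero => simp only [parityCount]; push_cast; field_simp; ring
  | one => simp only [parityCount]; field_simp; ring
  | more h ih _ =>
    simp only [parityCount]
    push_cast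
    rw [ih, pow_add (-1 : ℝ) h 2, pow_add (c : ℝ) h 2]
    field_simp
    ring

instance (c h : ℕ) : Finite (TreeVert c h) :=
  (List.finite_length_le (Fin c) h).to_subtype

theorem exists_three_neighbours {c h : ℕ} (hc : 2 ≤ c) (v : TreeVert c h) (hv : v.1 ≠ [])
    (hvh : v.1.length < h) : ∃ n : Fin 3 → TreeVert c h, Function.Injective n ∧
      ∀ i, (n i).1.length % 2 = (v.1.length + 1) % 2 ∧ treeAdj c h v (n i) := by
  obtain ⟨l, hl⟩ := v
  obtain ⟨i, t, rfl⟩ := List.exists_cons_of_ne_nil hv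
  simp only [List.length_cons] at hvh hl
  let x : TreeVert c h := ⟨t, by omega⟩
  let y : TreeVert c h := ⟨⟨0, by omega⟩ :: i :: t, by simp only [List.length_cons]; omega⟩
  let z : TreeVert c h := ⟨⟨1, by omega⟩ :: i :: t, by simp only [List.length_cons]; omega⟩
  have hxy : x ≠ y := fun h => by
    have := congrArg (fun u : TreeVert c _ => u.1.length) h
    simp only [x, y, List.length_cons] at this
    omega
  have hxz : x ≠ z := fun h => by
    have := congrArg (fun u : TreeVert c _ => u.1.length) h
    simp only [x, z, List.length_cons] at this
    omega
  have hyz : y ≠ z := fun h => by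
    have := congrArg Subtype.val h
    simp [y, z] at this
  refine ⟨![x, y, z], ?_, ?_⟩
  · intro a b hab
    fin_cases a <;> fin_cases b <;> simp_all [eq_comm]
  · intro a
    fin_cases a
    · exact ⟨show t.length % 2 = (t.length + 1 + 1) % 2 by omega, Or.inl ⟨i, rfl⟩⟩
    · exact ⟨by simp [y], Or.inr ⟨_, rfl⟩⟩
    · exact ⟨by simp [z], Or.inr ⟨_, rfl⟩⟩

theorem onSphere_of_norm_sub_eq {α : ℝ} {x y : Pt3} (h : ‖x - y‖ = α) :
    OnSphere α x.ofLp y.ofLp := by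
  rw [OnSphere, ← h, EuclideanSpace.norm_eq, Real.sq_sqrt (by positivity)]
  simp [Fin.sum_univ_three]

open Classical in
/-- The vertices of `T_{c,h}` whose depth has the parity of `h`. -/
def parityVerts (c h : ℕ) [Fintype (TreeVert c h)] : Finset (TreeVert c h) :=
  Finset.univ.filter fun v => v.1.length % 2 = h % 2

theorem mem_parityVerts {c h : ℕ} [Fintype (TreeVert c h)] {v : TreeVert c h} :
    v ∈ parityVerts c h ↔ v.1.length % 2 = h % 2 := by
  classical
  exact Finset.mem_filter.trans (and_iff_right (Finset.mem_univ v))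

theorem card_parityVerts_le (c h : ℕ) [Fintype (TreeVert c h)] :
    (parityVerts c h).card ≤ parityCount c h := by
  classical
  refine le_trans ?_ (ncard_parity_le c h)
  have hinj : Function.Injective (fun v : TreeVert c h => v.1) := Subtype.val_injective
  rw [← Finset.card_image_of_injective _ hinj, ← Set.ncard_coe_finset]
  refine Set.ncard_le_ncard ?_ ((List.finite_length_le (Fin c) h).subset fun l hl => hl.1)
  intro l hl
  obtain ⟨v, hv, rfl⟩ := Finset.mem_image.1 (Finset.mem_coe.1 hl)
  exact ⟨v.2, mem_parityVerts.1 hv⟩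

open Classical in
/-- Passing from configurations in Euclidean space to configurations in coordinates. -/
theorem exists_coordinate_configs {c h : ℕ} [Fintype (TreeVert c h)] {α : ℝ} (E : Finset Pt3) :
    ∃ 𝒞 : Finset (TreeVert c h → Fin 3 → ℝ), 𝒞.card = (distTreeConfigs3 c h α E).ncard ∧
      (∀ φ ∈ 𝒞, Function.Injective φ) ∧
      (∀ φ ∈ 𝒞, ∀ u v, treeAdj c h u v → OnSphere α (φ u) (φ v)) ∧
      ∀ φ ∈ 𝒞, ∀ v, φ v ∈ E.image WithLp.ofLp := by
  have hfin : (distTreeConfigs3 c h α E).Finite :=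
    (Fintype.piFinset fun _ : TreeVert c h => E).finite_toSet.subset fun φ hφ =>
      Finset.mem_coe.2 (Fintype.mem_piFinset.2 hφ.1)
  have hinj : Function.Injective fun (φ : TreeVert c h → Pt3) v => (φ v).ofLp := fun φ ψ h =>
    funext fun v => WithLp.ofLp_injective 2 (congrFun h v)
  refine ⟨hfin.toFinset.image fun φ v => (φ v).ofLp, ?_, ?_, ?_, ?_⟩
  · rw [Finset.card_image_of_injective _ hinj, Set.ncard_eq_toFinset_card _ hfin]
  all_goals
    intro φ hφ
    obtain ⟨ψ, hψ, rfl⟩ := Finset.mem_image.1 hφ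
    obtain ⟨h1, h2, h3⟩ := hfin.mem_toFinset.1 hψ
  · exact (WithLp.ofLp_injective 2).comp h2
  · exact fun u v huv => onSphere_of_norm_sub_eq (h3 u v huv)
  · exact fun v => Finset.mem_image_of_mem _ (h1 v)

theorem ncard_distTreeConfigs3_le_of_even {c h : ℕ} [Fintype (TreeVert c h)] (hc : 2 ≤ c)
    (hh : h % 2 = 0) (α : ℝ) (E : Finset Pt3) :
    (distTreeConfigs3 c h α E).ncard ≤
      2 ^ Fintype.card (TreeVert c h) * E.card ^ (parityVerts c h).card := by
  classical
  obtain ⟨𝒞, h𝒞, hinj, hadj, hE⟩ := exists_coordinate_configs (c := c) (h := h) (α := α) E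
  rw [← h𝒞, ← Finset.card_image_of_injective E (WithLp.ofLp_injective 2)]
  refine card_configs_le_pow hinj hadj hE fun v hv => ?_
  have hv' : v.1.length % 2 ≠ h % 2 := fun h0 => hv (mem_parityVerts.2 h0)
  have := v.2
  obtain ⟨n, hn, h1⟩ := exists_three_neighbours hc v (by
    intro h0
    rw [h0] at hv'
    exact hv' hh.symm) (lt_of_le_of_ne this fun h0 => hv' (by rw [h0]))
  refine ⟨n, hn, fun i => ⟨?_, (h1 i).2⟩⟩
  have := (h1 i).1
  exact mem_parityVerts.2 (by omega)

theorem ncard_distTreeConfigs3_le_of_odd {c h : ℕ} [Fintype (TreeVert c h)] (hc : 2 ≤ c)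
    (hh : h % 2 = 1) (α : ℝ) (E : Finset Pt3) :
    ∃ k, k + 2 = (parityVerts c h).card ∧
    (distTreeConfigs3 c h α E).ncard ≤ 2 ^ Fintype.card (TreeVert c h) *
      (hinge α (E.map ⟨WithLp.ofLp, WithLp.ofLp_injective 2⟩)
        (E.map ⟨WithLp.ofLp, WithLp.ofLp_injective 2⟩) * E.card ^ k) := by
  classical
  obtain ⟨𝒞, h𝒞, hinj, hadj, hE⟩ := exists_coordinate_configs (c := c) (h := h) (α := α) E
  let r : TreeVert c h := ⟨[], Nat.zero_le _⟩
  let a : TreeVert c h := ⟨[⟨0, by omega⟩], by simp only [List.length_singleton]; omega⟩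
  let b : TreeVert c h := ⟨[⟨1, by omega⟩], by simp only [List.length_singleton]; omega⟩
  have hab : a ≠ b := fun h => by
    have := congrArg Subtype.val h
    simp [a, b] at this
  have ha : a ∈ parityVerts c h := mem_parityVerts.2 hh.symm
  have hb : b ∈ (parityVerts c h).erase a := 
    Finset.mem_erase.2 ⟨hab.symm, mem_parityVerts.2 hh.symm⟩
  refine ⟨(((parityVerts c h).erase a).erase b).card, ?_, ?_⟩
  · rw [← Finset.card_erase_add_one ha, ← Finset.card_erase_add_one hb]
  have hK : insert r (insert a (insert b (((parityVerts c h).erase a).erase b))) =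
      insert r (parityVerts c h) := by rw [Finset.insert_erase hb, Finset.insert_erase ha]
  rw [← h𝒞, ← Finset.card_map ⟨WithLp.ofLp, WithLp.ofLp_injective 2⟩]
  refine card_configs_le_hinge (r := r) (a := a) (b := b) hinj hadj (fun φ hφ v => ?_) ?_ ?_ ?_
  · rw [Finset.map_eq_image]
    exact hE φ hφ v
  · rw [hK]
    intro v hv
    simp only [Finset.mem_insert, not_or] at hv
    obtain ⟨hvr, hv⟩ := hv
    have hv' : v.1.length % 2 ≠ h % 2 := fun h0 => hv (mem_parityVerts.2 h0)
    obtain ⟨n, hn, h1⟩ := exists_three_neighbours hc v (fun h0 => hvr (Subtype.ext h0))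
      (lt_of_le_of_ne v.2 fun h0 => hv' (by rw [h0]))
    refine ⟨n, hn, fun i => ⟨Finset.mem_insert_of_mem ?_, (h1 i).2⟩⟩
    have := (h1 i).1
    exact mem_parityVerts.2 (by omega)
  · exact Or.inr ⟨_, rfl⟩
  · exact Or.inr ⟨_, rfl⟩

/-- **technical tree estimate in three dimensions.**  Fix `c ≥ 2`,
`h ≥ 1`, `α > 0`, and `ε > 0`.  Then `f₃(T_{c,h,α}; n) ≲ n^E` with
`E = c^h (1 + 1/(c² − 1)) + (−1)^h/(2(c+1)) + 1/(2(1 − c)) + ε`: there are constants `C`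
and `N` such that for all `n > N`, every set of `n` points in `ℝ³` has at most `C · n^E`
distance `T_{c,h,α}`-configurations. -/
theorem distance_tree_technical_bound_threeDim (c h : ℕ) (hc : 2 ≤ c) (hh : 1 ≤ h)
    (α : ℝ) (hα : 0 < α) (ε : ℝ) (hε : 0 < ε) :
    ∃ C : ℝ, 0 < C ∧ ∃ N : ℕ, ∀ n : ℕ, N < n → ∀ E : Finset Pt3, E.card = n →
      ((distTreeConfigs3 c h α E).ncard : ℝ) ≤
        C * (n : ℝ) ^ ((c : ℝ) ^ h * (1 + 1 / ((c : ℝ) ^ 2 - 1)) +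
          (-1 : ℝ) ^ h / (2 * ((c : ℝ) + 1)) + 1 / (2 * (1 - (c : ℝ))) + ε) := by

  classical
  have : Fintype (TreeVert c h) := Fintype.ofFinite _
  rw [← parityCount_eq hc h]
  have hcard : ((parityVerts c h).card : ℝ) ≤ parityCount c h := by
    exact_mod_cast card_parityVerts_le c h
  obtain ⟨A, hA, hhinge⟩ := hinge_self_le hα hε
  refine ⟨2 ^ Fintype.card (TreeVert c h) * (A + 1), by positivity, 0, fun n hn E hE => ?_⟩
  have hn1 : (1 : ℝ) ≤ n := by exact_mod_cast hn
  have hn0 : (0 : ℝ) < n := by linarith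
  have h2 : (0 : ℝ) < 2 ^ Fintype.card (TreeVert c h) := by positivity
  obtain hpar | hpar := Nat.mod_two_eq_zero_or_one h
  · have h1 : ((distTreeConfigs3 c h α E).ncard : ℝ) ≤
        2 ^ Fintype.card (TreeVert c h) * (n : ℝ) ^ (parityVerts c h).card := by
      exact_mod_cast hE ▸ ncard_distTreeConfigs3_le_of_even hc hpar α E
    refine h1.trans ?_
    rw [mul_assoc]
    refine mul_le_mul_of_nonneg_left ?_ h2.le
    have h3 : (n : ℝ) ^ (parityVerts c h).card ≤ (n : ℝ) ^ ((parityCount c h : ℝ) + ε) := by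
      rw [← Real.rpow_natCast]
      exact Real.rpow_le_rpow_of_exponent_le hn1 (by linarith)
    have h4 : (0 : ℝ) ≤ (n : ℝ) ^ ((parityCount c h : ℝ) + ε) := by positivity
    nlinarith
  · obtain ⟨k, hk, hle⟩ := ncard_distTreeConfigs3_le_of_odd hc hpar α E
    set E' := E.map ⟨WithLp.ofLp, WithLp.ofLp_injective 2⟩ with hE'
    have hE'n : E'.card = n := by rw [hE', Finset.card_map, hE]
    have h1 : ((distTreeConfigs3 c h α E).ncard : ℝ) ≤
        2 ^ Fintype.card (TreeVert c h) * ((hinge α E' E' : ℝ) * (n : ℝ) ^ k) := by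
      rw [hE] at hle
      exact_mod_cast hle
    have h3 := hhinge E' (Finset.card_pos.1 (by omega))
    rw [hE'n] at h3
    refine h1.trans ?_
    rw [mul_assoc]
    refine mul_le_mul_of_nonneg_left ?_ h2.le
    calc (hinge α E' E' : ℝ) * (n : ℝ) ^ k ≤ A * (n : ℝ) ^ (2 + ε) * (n : ℝ) ^ k := by gcongr
      _ = A * (n : ℝ) ^ ((2 + ε) + k) := by rw [Real.rpow_add hn0 (2 + ε) k, Real.rpow_natCast]; ring
      _ ≤ (A + 1) * (n : ℝ) ^ ((parityCount c h : ℝ) + ε) := by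
        have hk' : (k : ℝ) + 2 = (parityVerts c h).card := by exact_mod_cast hk
        refine mul_le_mul (by linarith) (Real.rpow_le_rpow_of_exponent_le hn1 (by linarith))
          (by positivity) (by positivity)
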